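/- Let $r \le 1 \le q < p < \infty$, $0 < r$, and let $u, v, w$ be weights on $(a,b)$ with $0 < \int_x^b w < \infty$ for all $x \in (a,b)$. Then $\big(\int_a^b \big(\int_a^t f^r v\big)^{q/r} u\,dt\big)^{1/q} \le C \big(\int_a^b \big(\int_a^t f\big)^{p} w\,dt\big)^{1/p}$ holds for all nonnegative measurable $f$ if and only if $C_1$, $C_6$, and $C_7$ are all finite, where $C_1 := \operatorname{ess\,sup}_{x\in(a,b)} (\int_x^b w)^{-1/p} \operatorname{ess\,sup}_{t\in(x,b)} (\int_t^b u)^{1/q} V_r(x,t)$, $C_6$ is as in case (vi) of the main theorem, and $C_7 := \big(\int_a^b w(x)\, \operatorname{ess\,sup}_{y\in(a,x)} (\int_y^b w)^{-p/(p-q)} \operatorname{ess\,sup}_{t\in(y,x)} (\int_t^x u)^{p/(p-q)} V_r(y,t)^{pq/(p-q)}\, dx\big)^{(p-q)/(pq)}$; moreover the best constant satisfies $C \approx C_1 + C_6 + C_7$. -/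

import Mathlib

open MeasureTheory Set ENNReal

noncomputable section

/-- `w` is a weight on `(a,b)`: measurable, positive and finite there. -/
def IsWeight (a b : ℝ) (w : ℝ → ℝ≥0∞) : Prop :=
  Measurable w ∧ ∀ x ∈ Set.Ioo a b, 0 < w x ∧ w x < ∞

/-- The quantity `V_r(x,t)`: `(∫_x^t v^{1/(1-r)})^{(1-r)/r}` for `0 < r < 1`,
and `ess sup_{(x,t)} v` for `r = 1`. -/
def Vr (r : ℝ) (v : ℝ → ℝ≥0∞) (x t : ℝ) : ℝ≥0∞ :=
  if r = 1 then essSup v (volume.restrict (Set.Ioo x t))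
  else (∫⁻ s in Set.Ioo x t, v s ^ (1 / (1 - r))) ^ ((1 - r) / r)

/-- The Cesàro–Cesàro inequality (2.2) with constant `C`:
`(∫_a^b (∫_a^t f^r v)^{q/r} u dt)^{1/q} ≤ C (∫_a^b (∫_a^t f)^p w dt)^{1/p}`
for all nonnegative measurable `f` on `(a,b)`. -/
def CesCesIneq (a b r p q : ℝ) (u v w : ℝ → ℝ≥0∞) (C : ℝ≥0∞) : Prop :=
  ∀ f : ℝ → ℝ≥0∞, Measurable f →
    (∫⁻ t in Set.Ioo a b, (∫⁻ s in Set.Ioo a t, f s ^ r * v s) ^ (q / r) * u t) ^ (1 / q) ≤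
      C * (∫⁻ t in Set.Ioo a b, (∫⁻ s in Set.Ioo a t, f s) ^ p * w t) ^ (1 / p)

/-- The best (least) constant in the Cesàro–Cesàro inequality. -/
def BestC (a b r p q : ℝ) (u v w : ℝ → ℝ≥0∞) : ℝ≥0∞ :=
  sInf {C | CesCesIneq a b r p q u v w C}

def C₁ (a b r p q : ℝ) (u v w : ℝ → ℝ≥0∞) : ℝ≥0∞ :=
  essSup (fun x => (∫⁻ t in Set.Ioo x b, w t) ^ (-(1 / p)) *
      essSup (fun t => (∫⁻ s in Set.Ioo t b, u s) ^ (1 / q) * Vr r v x t)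
        (volume.restrict (Set.Ioo x b)))
    (volume.restrict (Set.Ioo a b))

def C₂ (a b r p q : ℝ) (u v w : ℝ → ℝ≥0∞) : ℝ≥0∞ :=
  ⨆ x ∈ Set.Ioo a b, (∫⁻ t in Set.Ioo x b, w t) ^ (-(1 / p)) *
    (∫⁻ t in Set.Ioo x b,
        (∫⁻ s in Set.Ioo t b, u s) ^ (q / (1 - q)) * u t * Vr r v x t ^ (q / (1 - q))) ^
      ((1 - q) / q)

def C₃ (a b r p q : ℝ) (u v w : ℝ → ℝ≥0∞) : ℝ≥0∞ :=
  ⨆ x ∈ Set.Ioo a b, (∫⁻ t in Set.Ioo x b, u t) ^ (1 / q) *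
    (∫⁻ t in Set.Ioo a x,
        (∫⁻ s in Set.Ioo t b, w s) ^ (-(p / (p - r))) * w t * Vr r v t x ^ (p * r / (p - r))) ^
      ((p - r) / (p * r))

def C₄ (a b r p q : ℝ) (u v w : ℝ → ℝ≥0∞) : ℝ≥0∞ :=
  (∫⁻ x in Set.Ioo a b, (∫⁻ s in Set.Ioo x b, u s) ^ (q / (p - q)) * u x *
      essSup (fun t => (∫⁻ s in Set.Ioo t b, w s) ^ (-(q / (p - q))) *
          Vr r v t x ^ (p * q / (p - q)))
        (volume.restrict (Set.Ioo a x))) ^ ((p - q) / (p * q))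

def C₅ (a b r p q : ℝ) (u v w : ℝ → ℝ≥0∞) : ℝ≥0∞ :=
  (∫⁻ x in Set.Ioo a b, w x *
      ⨆ y ∈ Set.Ioo a x, (∫⁻ s in Set.Ioo y b, w s) ^ (-(p / (p - q))) *
        (∫⁻ t in Set.Ioo y x,
            (∫⁻ s in Set.Ioo t x, u s) ^ (q / (1 - q)) * u t * Vr r v y t ^ (q / (1 - q))) ^
          (p * (1 - q) / (p - q))) ^ ((p - q) / (p * q))

def C₆ (a b r p q : ℝ) (u v w : ℝ → ℝ≥0∞) : ℝ≥0∞ :=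
  (∫⁻ x in Set.Ioo a b, w x *
      essSup (fun y => (∫⁻ s in Set.Ioo y b, w s)⁻¹ *
          (∫⁻ t in Set.Ioo y x, (∫⁻ s in Set.Ioo t b, u s) ^ (q / (p - q)) * u t *
              (∫⁻ s in Set.Ioo a y, (∫⁻ σ in Set.Ioo s b, w σ) ^ (-(p / (p - r))) * w s *
                  Vr r v s y ^ (p * r / (p - r))) ^ ((p - r) * q / ((p - q) * r))))
        (volume.restrict (Set.Ioo a x))) ^ ((p - q) / (p * q))

def C₇ (a b r p q : ℝ) (u v w : ℝ → ℝ≥0∞) : ℝ≥0∞ :=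
  (∫⁻ x in Set.Ioo a b, w x *
      essSup (fun y => (∫⁻ s in Set.Ioo y b, w s) ^ (-(p / (p - q))) *
          essSup (fun t => (∫⁻ s in Set.Ioo t x, u s) ^ (p / (p - q)) *
              Vr r v y t ^ (p * q / (p - q)))
            (volume.restrict (Set.Ioo y x)))
        (volume.restrict (Set.Ioo a x))) ^ ((p - q) / (p * q))

/-- The tail integral `∫_x^b φ`. -/
def tail (φ : ℝ → ℝ≥0∞) (b x : ℝ) : ℝ≥0∞ := ∫⁻ s in Ioo x b, φ s

section Intervals

lemma lintegral_Ioo_add {x y z : ℝ} (hxy : x ≤ y) (hyz : y ≤ z) (g : ℝ → ℝ≥0∞) :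
    (∫⁻ s in Ioo x y, g s) + ∫⁻ s in Ioo y z, g s = ∫⁻ s in Ioo x z, g s := by
  rw [setLIntegral_congr (Ioo_ae_eq_Ioc (a := x) (b := y)),
    setLIntegral_congr (Ioo_ae_eq_Ioc (a := y) (b := z)),
    setLIntegral_congr (Ioo_ae_eq_Ioc (a := x) (b := z)), ← Ioc_union_Ioc_eq_Ioc hxy hyz,
    lintegral_union measurableSet_Ioc (Ioc_disjoint_Ioc_of_le le_rfl)]

lemma lintegral_Ioo_mono {x y x' y' : ℝ} (hx : x' ≤ x) (hy : y ≤ y') (g : ℝ → ℝ≥0∞) :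
    ∫⁻ s in Ioo x y, g s ≤ ∫⁻ s in Ioo x' y', g s :=
  lintegral_mono_set (Ioo_subset_Ioo hx hy)

lemma lintegral_Ioo_self (x : ℝ) (g : ℝ → ℝ≥0∞) : ∫⁻ s in Ioo x x, g s = 0 := by simp

lemma tail_antitone (φ : ℝ → ℝ≥0∞) (b : ℝ) : Antitone (tail φ b) :=
  fun _ _ h => lintegral_Ioo_mono h le_rfl φ

lemma monotone_lintegral_Ioo (φ : ℝ → ℝ≥0∞) (a : ℝ) :
    Monotone fun t => ∫⁻ s in Ioo a t, φ s :=
  fun _ _ h => lintegral_Ioo_mono le_rfl h φ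

lemma sum_lintegral_Ioo {x : ℕ → ℝ} (hx : Monotone x) (g : ℝ → ℝ≥0∞) (n : ℕ) :
    ∑ i ∈ Finset.range n, ∫⁻ s in Ioo (x i) (x (i + 1)), g s = ∫⁻ s in Ioo (x 0) (x n), g s := by
  induction n with
  | zero => simp
  | succ n ih =>
    rw [Finset.sum_range_succ, ih, lintegral_Ioo_add (hx (Nat.zero_le n)) (hx n.le_succ)]

lemma tsum_lintegral_Ioo {x : ℕ → ℝ} {d : ℝ} (hx : Monotone x) (hd : ∀ k, x k < d)
    (hc : ∀ t < d, ∃ k, t < x k) (g : ℝ → ℝ≥0∞) :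
    ∑' i, ∫⁻ s in Ioo (x i) (x (i + 1)), g s = ∫⁻ s in Ioo (x 0) d, g s := by
  have hU : Ioo (x 0) d = ⋃ k, Ioo (x 0) (x k) := by
    ext t
    simp only [mem_Ioo, mem_iUnion]
    constructor
    · rintro ⟨h0, h1⟩
      obtain ⟨k, hk⟩ := hc t h1
      exact ⟨k, h0, hk⟩
    · rintro ⟨k, h0, hk⟩
      exact ⟨h0, hk.trans (hd k)⟩
  rw [hU, setLIntegral_iUnion_of_directed]
  · rw [ENNReal.tsum_eq_iSup_nat]
    simp_rw [sum_lintegral_Ioo hx]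
  · exact Monotone.directed_le (fun i j h => Ioo_subset_Ioo le_rfl (hx h))

lemma lintegral_Ioo_le_of_forall {c d : ℝ} {g : ℝ → ℝ≥0∞} {B : ℝ≥0∞}
    (h : ∀ y ∈ Ioo c d, ∫⁻ s in Ioo y d, g s ≤ B) : ∫⁻ s in Ioo c d, g s ≤ B := by
  rcases le_or_gt d c with hdc | hcd
  · simp [Ioo_eq_empty_of_le hdc]
  obtain ⟨y, hy, hyc, hlim⟩ := exists_seq_strictAnti_tendsto' hcd
  have hU : Ioo c d = ⋃ k, Ioo (y k) d := by
    ext t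
    simp only [mem_Ioo, mem_iUnion]
    constructor
    · rintro ⟨h0, h1⟩
      obtain ⟨k, hk⟩ := ((tendsto_order.1 hlim).2 t h0).exists
      exact ⟨k, hk, h1⟩
    · rintro ⟨k, h0, h1⟩
      exact ⟨(hyc k).1.trans h0, h1⟩
  rw [hU, setLIntegral_iUnion_of_directed]
  · exact iSup_le fun k => h _ (hyc k)
  · exact Monotone.directed_le (fun i j h => Ioo_subset_Ioo (hy.antitone h) le_rfl)

lemma le_essSup_Ioo {c d y₁ y₂ : ℝ} {g : ℝ → ℝ≥0∞} {κ : ℝ≥0∞} (h12 : y₁ < y₂)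
    (hc : c ≤ y₁) (hd : y₂ ≤ d) (h : ∀ y ∈ Ioo y₁ y₂, κ ≤ g y) :
    κ ≤ essSup g (volume.restrict (Ioo c d)) := by
  have h1 : ∀ᵐ y ∂(volume.restrict (Ioo y₁ y₂)), g y ≤ essSup g (volume.restrict (Ioo c d)) :=
    ae_restrict_of_ae_restrict_of_subset (Ioo_subset_Ioo hc hd) (ENNReal.ae_le_essSup g)
  have h2 : ∀ᵐ y ∂(volume.restrict (Ioo y₁ y₂)), κ ≤ essSup g (volume.restrict (Ioo c d)) := by
    filter_upwards [h1, ae_restrict_mem measurableSet_Ioo] with y hy hm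
    exact (h y hm).trans hy
  have : (ae (volume.restrict (Ioo y₁ y₂))).NeBot := by
    rw [ae_neBot, Ne, Measure.restrict_eq_zero, Real.volume_Ioo]
    simpa using h12
  exact h2.exists.choose_spec

lemma essSup_Ioo_le {c d : ℝ} {g : ℝ → ℝ≥0∞} {κ : ℝ≥0∞} (h : ∀ y ∈ Ioo c d, g y ≤ κ) :
    essSup g (volume.restrict (Ioo c d)) ≤ κ :=
  essSup_le_of_ae_le _ (by
    filter_upwards [ae_restrict_mem measurableSet_Ioo] with y hy using h y hy)

lemma essSup_Ioo_mono {c d c' d' : ℝ} {g g' : ℝ → ℝ≥0∞} (hc : c' ≤ c) (hd : d ≤ d')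
    (h : ∀ y ∈ Ioo c d, g y ≤ g' y) :
    essSup g (volume.restrict (Ioo c d)) ≤ essSup g' (volume.restrict (Ioo c' d')) := by
  refine essSup_le_of_ae_le _ ?_
  filter_upwards [ae_restrict_mem measurableSet_Ioo,
    ae_restrict_of_ae_restrict_of_subset (Ioo_subset_Ioo hc hd) (ENNReal.ae_le_essSup g')]
    with y hy h'
  exact (h y hy).trans h'

lemma exists_tail_eq {φ : ℝ → ℝ≥0∞} (hφ : Measurable φ) {c d : ℝ} (hcd : c < d)
    (hfin : tail φ d c ≠ ∞) {l : ℝ≥0∞} (hl0 : 0 < l) (hl : l ≤ tail φ d c) :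
    ∃ x ∈ Ico c d, tail φ d x = l := by
  set ψ : ℝ → ℝ := fun s => ((Ioo c d).indicator φ s).toReal with hψ
  have hind : ∫⁻ s, (Ioo c d).indicator φ s = tail φ d c := lintegral_indicator measurableSet_Ioo _
  have hm : Measurable ((Ioo c d).indicator φ) := hφ.indicator measurableSet_Ioo
  have hint : Integrable ψ :=
    integrable_toReal_of_lintegral_ne_top hm.aemeasurable (by rwa [hind])
  have hcont : Continuous fun x => ∫ s in d..x, ψ s :=
    intervalIntegral.continuous_primitive (fun _ _ => hint.intervalIntegrable) d
  have htail : ∀ x ∈ Icc c d, tail φ d x = ENNReal.ofReal (-∫ s in d..x, ψ s) := by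
    intro x hx
    rw [← intervalIntegral.integral_symm, intervalIntegral.integral_of_le hx.2,
      integral_Ioc_eq_integral_Ioo,
      ofReal_integral_eq_lintegral_ofReal hint.integrableOn
        (Filter.Eventually.of_forall fun s => ENNReal.toReal_nonneg)]
    have hae : ∀ᵐ s, (Ioo c d).indicator φ s < ∞ := ae_lt_top hm (by rwa [hind])
    refine lintegral_congr_ae ?_
    filter_upwards [ae_restrict_of_ae hae, ae_restrict_mem measurableSet_Ioo] with s hs hsm
    rw [hψ]
    simp only
    rw [ENNReal.ofReal_toReal hs.ne, indicator_of_mem (show s ∈ Ioo c d from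
      ⟨hx.1.trans_lt hsm.1, hsm.2⟩)]
  have hcont' : ContinuousOn (fun x => tail φ d x) (Icc c d) :=
    (ENNReal.continuous_ofReal.comp hcont.neg).continuousOn.congr htail
  have himg : Icc (tail φ d d) (tail φ d c) ⊆ tail φ d '' Icc c d :=
    intermediate_value_Icc' hcd.le hcont'
  have hd0 : tail φ d d = 0 := by simp [tail]
  obtain ⟨x, hx, hxl⟩ := @himg l ⟨by simp [hd0], hl⟩
  refine ⟨x, ⟨hx.1, lt_of_le_of_ne hx.2 ?_⟩, hxl⟩
  rintro rfl
  exact hl0.ne' (hxl.symm.trans hd0)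

/-- Points `x 0 = c < x 1 < ⋯ → d` along which the tail of `φ` decays geometrically. -/
structure IsGrid (φ : ℝ → ℝ≥0∞) (c d : ℝ) (M : ℝ≥0∞) (x : ℕ → ℝ) : Prop where
  zero : x 0 = c
  strictMono : StrictMono x
  lt : ∀ k, x k < d
  cover : ∀ t < d, ∃ k, t < x k
  tail_succ : ∀ k, M * tail φ d (x (k + 1)) = tail φ d (x k)

lemma exists_grid {φ : ℝ → ℝ≥0∞} (hφ : Measurable φ) {c d : ℝ} (hcd : c < d)
    (hfin : tail φ d c ≠ ∞) (hpos : ∀ x ∈ Ioo c d, 0 < tail φ d x) {M : ℝ≥0∞} (hM : 2 ≤ M)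
    (hMt : M ≠ ∞) : ∃ x, IsGrid φ c d M x := by
  have hM0 : M ≠ 0 := (lt_of_lt_of_le (by norm_num) hM).ne'
  have hc0 : 0 < tail φ d c := by
    obtain ⟨y, hy⟩ := exists_between hcd
    exact (hpos y hy).trans_le (tail_antitone φ d hy.1.le)
  have hl0 : ∀ k : ℕ, 0 < tail φ d c / M ^ k := fun k =>
    ENNReal.div_pos hc0.ne' (ENNReal.pow_ne_top hMt)
  have hle : ∀ k : ℕ, tail φ d c / M ^ k ≤ tail φ d c := fun k =>
    ENNReal.div_le_of_le_mul (le_mul_of_one_le_right' (one_le_pow₀ (le_trans (by norm_num) hM)))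
  have hex : ∀ k : ℕ, ∃ x ∈ Ico c d, tail φ d x = tail φ d c / M ^ (k + 1) := fun k =>
    exists_tail_eq hφ hcd hfin (hl0 _) (hle _)
  choose y hy hyt using hex
  obtain ⟨x, hx0, hxs⟩ : ∃ x : ℕ → ℝ, x 0 = c ∧ ∀ k, x (k + 1) = y k :=
    ⟨fun k => Nat.casesOn k c y, rfl, fun _ => rfl⟩
  have hxt : ∀ k, tail φ d (x k) = tail φ d c / M ^ k := by
    intro k
    cases k with
    | zero => simp [hx0]
    | succ k => rw [hxs]; exact hyt k
  have hsucc : ∀ k, M * tail φ d (x (k + 1)) = tail φ d (x k) := by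
    intro k
    rw [hxt, hxt, pow_succ, ENNReal.div_eq_inv_mul, ENNReal.div_eq_inv_mul,
      ENNReal.mul_inv (Or.inr hMt) (Or.inr hM0), mul_comm (M ^ k)⁻¹, ← mul_assoc, ← mul_assoc,
      ENNReal.mul_inv_cancel hM0 hMt, one_mul]
  have hlt : ∀ k, tail φ d (x (k + 1)) < tail φ d (x k) := by
    intro k
    have h0 : tail φ d (x (k + 1)) ≠ 0 := by rw [hxt]; exact (hl0 _).ne'
    have ht : tail φ d (x (k + 1)) ≠ ∞ := by
      rw [hxt]; exact ((hle _).trans_lt hfin.lt_top).ne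
    calc tail φ d (x (k + 1)) < 2 * tail φ d (x (k + 1)) := by
          rw [two_mul]; exact ENNReal.lt_add_right ht h0
      _ ≤ M * tail φ d (x (k + 1)) := by gcongr
      _ = _ := hsucc k
  refine ⟨x, hx0, strictMono_nat_of_lt_succ fun k => ?_, fun k => ?_, fun t ht => ?_, hsucc⟩
  · by_contra hcon
    exact absurd (tail_antitone φ d (not_lt.1 hcon)) (not_le.2 (hlt k))
  · cases k with
    | zero => rw [hx0]; exact hcd
    | succ k => rw [hxs]; exact (hy k).2
  · rcases lt_or_ge t c with htc | htc
    · exact ⟨0, by rwa [hx0]⟩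
    have htp : 0 < tail φ d t := by
      rcases htc.eq_or_lt with rfl | h
      · exact hc0
      · exact hpos t ⟨h, ht⟩
    have hlim : Filter.Tendsto (fun k : ℕ => tail φ d c / M ^ k) Filter.atTop (nhds 0) := by
      have h1 : M⁻¹ < 1 := ENNReal.inv_lt_one.2 (lt_of_lt_of_le (by norm_num) hM)
      have h2 := ENNReal.Tendsto.const_mul (a := tail φ d c)
        (ENNReal.tendsto_pow_atTop_nhds_zero_of_lt_one h1) (Or.inr hfin)
      simpa [div_eq_mul_inv, ENNReal.inv_pow] using h2
    obtain ⟨k, hk⟩ := ((tendsto_order.1 hlim).2 _ htp).exists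
    refine ⟨k, ?_⟩
    by_contra hcon
    exact absurd (tail_antitone φ d (not_lt.1 hcon)) (not_le.2 (by rw [hxt]; exact hk))

end Intervals

section Sums

lemma add_rpow_le_two_rpow_mul {κ : ℝ} (hκ : 0 ≤ κ) (x y : ℝ≥0∞) :
    (x + y) ^ κ ≤ 2 ^ κ * (x ^ κ + y ^ κ) := by
  rcases le_total x y with h | h
  · calc (x + y) ^ κ ≤ (2 * y) ^ κ := by rw [two_mul]; gcongr
      _ = 2 ^ κ * y ^ κ := ENNReal.mul_rpow_of_nonneg _ _ hκ
      _ ≤ _ := by gcongr; exact le_add_self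
  · calc (x + y) ^ κ ≤ (2 * x) ^ κ := by rw [two_mul]; gcongr
      _ = 2 ^ κ * x ^ κ := ENNReal.mul_rpow_of_nonneg _ _ hκ
      _ ≤ _ := by gcongr; exact le_self_add

lemma sum_rpow_le_rpow_sum {ι : Type*} (s : Finset ι) (f : ι → ℝ≥0∞) {q : ℝ} (hq : 1 ≤ q) :
    ∑ i ∈ s, f i ^ q ≤ (∑ i ∈ s, f i) ^ q := by
  classical
  induction s using Finset.induction_on with
  | empty => simp
  | insert i s hi ih =>
    rw [Finset.sum_insert hi, Finset.sum_insert hi]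
    exact (add_le_add_right ih _).trans (ENNReal.add_rpow_le_rpow_add _ _ hq)

lemma sum_geometric_forward {K : ℝ≥0∞} {g d ω : ℕ → ℝ≥0∞} {n : ℕ} (h0 : g 0 = 0)
    (hg : ∀ i < n, g (i + 1) ≤ K * (g i + d i)) (hω : ∀ i < n, 2 * K * ω (i + 1) ≤ ω i) :
    ∑ i ∈ Finset.range n, ω i * g (i + 1) + 2 * K * ω n * g n ≤
      2 * K * ∑ i ∈ Finset.range n, ω i * d i := by
  induction n with
  | zero => simp [h0]
  | succ n ih =>
    have ih := ih (fun i hi => hg i (by lia)) (fun i hi => hω i (by lia))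
    rw [Finset.sum_range_succ, Finset.sum_range_succ]
    calc _ ≤ ∑ i ∈ Finset.range n, ω i * g (i + 1) + ω n * g (n + 1) + ω n * g (n + 1) := by
          gcongr; exact hω n (by lia)
      _ = ∑ i ∈ Finset.range n, ω i * g (i + 1) + 2 * ω n * g (n + 1) := by ring
      _ ≤ ∑ i ∈ Finset.range n, ω i * g (i + 1) + 2 * ω n * (K * (g n + d n)) := by
          gcongr; exact hg n (by lia)
      _ = (∑ i ∈ Finset.range n, ω i * g (i + 1) + 2 * K * ω n * g n) + 2 * K * (ω n * d n) := by
          ring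
      _ ≤ 2 * K * ∑ i ∈ Finset.range n, ω i * d i + 2 * K * (ω n * d n) := by gcongr
      _ = _ := by ring

lemma sum_geometric_backward {K : ℝ≥0∞} {A D κ : ℕ → ℝ≥0∞} {n : ℕ}
    (hA : ∀ i < n, A i ≤ K * (D i + A (i + 1))) (hκ : ∀ i < n, 2 * K * κ i ≤ κ (i + 1)) :
    ∑ i ∈ Finset.range n, κ i * A i ≤ 2 * K * ∑ i ∈ Finset.range n, κ i * D i + κ n * A n := by
  induction n with
  | zero => simp
  | succ n ih =>
    have ih := ih (fun i hi => hA i (by lia)) (fun i hi => hκ i (by lia))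
    rw [Finset.sum_range_succ, Finset.sum_range_succ]
    calc _ ≤ 2 * K * ∑ i ∈ Finset.range n, κ i * D i + κ n * A n + κ n * A n := by gcongr
      _ = 2 * K * ∑ i ∈ Finset.range n, κ i * D i + 2 * κ n * A n := by ring
      _ ≤ 2 * K * ∑ i ∈ Finset.range n, κ i * D i + 2 * κ n * (K * (D n + A (n + 1))) := by
          gcongr; exact hA n (by lia)
      _ = 2 * K * (∑ i ∈ Finset.range n, κ i * D i + κ n * D n) + 2 * K * κ n * A (n + 1) := by
          ring
      _ ≤ _ := by gcongr; exact hκ n (by lia)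

lemma add_rpow_le_add_mul {κ : ℝ} (hκ : 1 ≤ κ) (x y : ℝ≥0∞) :
    (x + y) ^ κ ≤ x ^ κ + ENNReal.ofReal κ * (y * (x + y) ^ (κ - 1)) := by
  have hκ0 : 0 < κ := by linarith
  rcases eq_or_ne x ∞ with rfl | hx
  · simp [hκ0]
  rcases eq_or_ne y ∞ with rfl | hy
  · have h1 : (∞ : ℝ≥0∞) ^ (κ - 1) ≠ 0 := by
      rcases hκ.eq_or_lt with rfl | h
      · simp
      · rw [ENNReal.top_rpow_of_pos (by linarith)]; simp
    simp only [add_top]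
    rw [ENNReal.top_mul h1, ENNReal.mul_top (by simpa using hκ0)]
    simp
  lift x to NNReal using hx
  lift y to NNReal using hy
  rcases eq_or_ne (x + y) 0 with h | h
  · rw [add_eq_zero] at h
    simp [h.1, h.2, hκ0]
  have hz : 0 < ((x + y : NNReal) : ℝ) := by exact_mod_cast pos_iff_ne_zero.2 h
  have hreal : ((x : ℝ) + y) ^ κ ≤ (x : ℝ) ^ κ + κ * (y * ((x : ℝ) + y) ^ (κ - 1)) := by
    have hz' : 0 < (x : ℝ) + y := by exact_mod_cast hz
    have hb := one_add_mul_self_le_rpow_one_add (s := -((y : ℝ) / (x + y))) (p := κ)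
      (by rw [neg_le_neg_iff, div_le_one hz']; linarith [x.2]) hκ
    have h1 : 1 + -((y : ℝ) / (x + y)) = x / (x + y) := by field_simp; ring
    rw [h1, Real.div_rpow x.coe_nonneg hz'.le] at hb
    have hp : 0 < ((x : ℝ) + y) ^ κ := Real.rpow_pos_of_pos hz' _
    have h2 := mul_le_mul_of_nonneg_right hb hp.le
    rw [div_mul_cancel₀ _ hp.ne'] at h2
    have h3 : ((x : ℝ) + y) ^ (κ - 1) = (x + y) ^ κ / (x + y) := by
      rw [Real.rpow_sub hz', Real.rpow_one]
    rw [h3]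
    have h4 : (1 + κ * -((y : ℝ) / (x + y))) * (x + y) ^ κ
      = (x + y) ^ κ - κ * (y * ((x + y) ^ κ / (x + y))) := by ring
    linarith
  have hne : (x + y) ≠ 0 := h
  rw [← ENNReal.coe_add, ← ENNReal.coe_rpow_of_nonneg _ hκ0.le,
    ← ENNReal.coe_rpow_of_nonneg _ hκ0.le, ← ENNReal.coe_rpow_of_nonneg _ (by linarith),
    ENNReal.ofReal, ← ENNReal.coe_mul, ← ENNReal.coe_mul, ← ENNReal.coe_add, ENNReal.coe_le_coe,
    ← NNReal.coe_le_coe]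
  push_cast
  rw [Real.coe_toNNReal _ hκ0.le]
  exact hreal

lemma rpow_le_sum_mul_rpow_forward {κ : ℝ} (hκ : 1 ≤ κ) {S σ : ℕ → ℝ≥0∞} (h0 : S 0 = 0)
    (hS : ∀ i, S (i + 1) = S i + σ i) (n : ℕ) :
    S n ^ κ ≤ ENNReal.ofReal κ * ∑ i ∈ Finset.range n, σ i * S (i + 1) ^ (κ - 1) := by
  induction n with
  | zero => simp [h0, show 0 < κ by linarith]
  | succ n ih =>
    rw [Finset.sum_range_succ, mul_add]
    calc S (n + 1) ^ κ ≤ S n ^ κ + ENNReal.ofReal κ * (σ n * S (n + 1) ^ (κ - 1)) := by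
          rw [hS]; exact add_rpow_le_add_mul hκ _ _
      _ ≤ _ := by gcongr

lemma rpow_le_sum_mul_rpow_backward {κ : ℝ} (hκ : 1 ≤ κ) {T σ : ℕ → ℝ≥0∞} {n : ℕ} (h0 : T n = 0)
    (hT : ∀ i < n, T i = T (i + 1) + σ i) {j : ℕ} (hj : j ≤ n) :
    T j ^ κ ≤ ENNReal.ofReal κ * ∑ i ∈ Finset.Ico j n, σ i * T i ^ (κ - 1) := by
  induction hj using Nat.decreasingInduction with
  | self => simp [h0, show 0 < κ by linarith]
  | of_succ j hj ih =>
    rw [Finset.sum_eq_sum_Ico_succ_bot hj, mul_add, add_comm]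
    calc T j ^ κ ≤ T (j + 1) ^ κ + ENNReal.ofReal κ * (σ j * T j ^ (κ - 1)) := by
          rw [hT j hj]; exact add_rpow_le_add_mul hκ _ _
      _ ≤ _ := by gcongr

lemma sum_iSup_le_of_forall {ι : Type*} {A : ℕ → Set ι} (hA : ∀ i, (A i).Nonempty)
    {F : ℕ → ι → ℝ≥0∞} {n : ℕ} {B : ℝ≥0∞}
    (h : ∀ g : ℕ → ι, (∀ i, g i ∈ A i) → ∑ i ∈ Finset.range n, F i (g i) ≤ B) :
    ∑ i ∈ Finset.range n, ⨆ x ∈ A i, F i x ≤ B := by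
  have : ∀ i, Nonempty (A i) := fun i => (hA i).to_subtype
  have key : ∑ i ∈ Finset.range n, ⨆ g : (∀ i, A i), F i (g i) ≤ B := by
    rw [ENNReal.finsetSum_iSup]
    · exact iSup_le fun g => h (fun i => g i) fun i => (g i).2
    · intro g g'
      classical
      refine ⟨fun i => if F i (g i) ≤ F i (g' i) then g' i else g i, fun i => ?_⟩
      dsimp only
      split_ifs with hc
      · exact ⟨hc, le_rfl⟩
      · exact ⟨le_rfl, (not_le.1 hc).le⟩
  refine le_trans (Finset.sum_le_sum fun i _ => ?_) key
  refine iSup₂_le fun x hx => ?_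
  classical
  have g0 : ∀ i, A i := fun i => Classical.arbitrary _
  have := le_iSup (fun g : (∀ i, A i) => F i (g i)) (Function.update g0 i ⟨x, hx⟩)
  simpa using this

end Sums

section Vr

variable {r : ℝ} {v : ℝ → ℝ≥0∞}

lemma Vr_mono (hr0 : 0 < r) (hr1 : r ≤ 1) {x y x' y' : ℝ} (hx : x' ≤ x) (hy : y ≤ y') :
    Vr r v x y ≤ Vr r v x' y' := by
  unfold Vr
  split_ifs with h
  · exact essSup_Ioo_mono hx hy fun _ _ => le_rfl
  · have : 0 ≤ (1 - r) / r := div_nonneg (by linarith) hr0.le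
    exact ENNReal.rpow_le_rpow (lintegral_Ioo_mono hx hy _) this

lemma lintegral_rpow_mul_le (hr0 : 0 < r) (hr1 : r ≤ 1) (hv : Measurable v) {f : ℝ → ℝ≥0∞}
    (hf : Measurable f) (x t : ℝ) :
    ∫⁻ s in Ioo x t, f s ^ r * v s ≤ Vr r v x t ^ r * (∫⁻ s in Ioo x t, f s) ^ r := by
  unfold Vr
  split_ifs with h
  · subst h
    simp only [ENNReal.rpow_one]
    rw [← lintegral_const_mul _ hf]
    refine lintegral_mono_ae ?_
    filter_upwards [ENNReal.ae_le_essSup v (μ := volume.restrict (Ioo x t))] with s hs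
    rw [mul_comm]
    gcongr
  · have hr1 : r < 1 := lt_of_le_of_ne hr1 h
    have hc : (1 / (1 - r)).HolderConjugate (1 / r) := by
      rw [Real.holderConjugate_iff]
      refine ⟨?_, by simp⟩
      rw [lt_div_iff₀ (by linarith)]; linarith
    have h1 := ENNReal.lintegral_mul_le_Lp_mul_Lq (volume.restrict (Ioo x t)) hc hv.aemeasurable
      (hf.pow_const r).aemeasurable
    have h2 : ∀ s, (f s ^ r) ^ r⁻¹ = f s := fun s => by
      rw [← ENNReal.rpow_mul, mul_inv_cancel₀ hr0.ne', ENNReal.rpow_one]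
    simp only [Pi.mul_apply, one_div, inv_inv, h2] at h1
    simp only [one_div]
    rw [← ENNReal.rpow_mul, div_mul_cancel₀ _ hr0.ne']
    simpa [mul_comm] using h1

lemma Vr_pos (hr0 : 0 < r) (hr1 : r ≤ 1) {a b x t : ℝ} (hv : IsWeight a b v) (hx : a ≤ x)
    (hxt : x < t) (ht : t ≤ b) : 0 < Vr r v x t := by
  have hvol : 0 < volume (Ioo x t) := by rw [Real.volume_Ioo]; simpa using hxt
  have hpos : ∀ s ∈ Ioo x t, 0 < v s := fun s hs =>
    (hv.2 s ⟨hx.trans_lt hs.1, hs.2.trans_le ht⟩).1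
  unfold Vr
  split_ifs with h
  · rw [pos_iff_ne_zero]
    intro h0
    have h1 : v =ᵐ[volume.restrict (Ioo x t)] 0 := ENNReal.essSup_eq_zero_iff.1 h0
    have h2 : ∀ᵐ s ∂(volume.restrict (Ioo x t)), False := by
      filter_upwards [h1, ae_restrict_mem measurableSet_Ioo] with s hs hm
      exact (hpos s hm).ne' hs
    rw [Filter.eventually_false_iff_eq_bot, ae_eq_bot, Measure.restrict_eq_zero] at h2
    exact hvol.ne' h2
  · have hr1 : r < 1 := lt_of_le_of_ne hr1 h
    refine ENNReal.rpow_pos_of_nonneg ?_ (div_nonneg (by linarith) hr0.le)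
    rw [setLIntegral_pos_iff (hv.1.pow_const _)]
    refine hvol.trans_le (measure_mono fun s hs => ⟨?_, hs⟩)
    exact (ENNReal.rpow_pos_of_nonneg (hpos s hs) (by simp; linarith)).ne'

lemma Vr_rpow_le (hr0 : 0 < r) (hr1 : r ≤ 1) {ρ : ℝ} (hρ : 0 ≤ ρ) {x y z : ℝ} (hxy : x ≤ y)
    (hyz : y ≤ z) : Vr r v x z ^ ρ ≤ 2 ^ (ρ / r) * (Vr r v x y ^ ρ + Vr r v y z ^ ρ) := by
  have h1 : (1 : ℝ≥0∞) ≤ 2 ^ (ρ / r) := by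
    simpa using ENNReal.rpow_le_rpow (z := ρ / r) (show (1 : ℝ≥0∞) ≤ 2 by norm_num) (by positivity)
  unfold Vr
  split_ifs with h
  · have hmax : essSup v (volume.restrict (Ioo x z)) ≤
        max (essSup v (volume.restrict (Ioo x y))) (essSup v (volume.restrict (Ioo y z))) := by
      refine essSup_le_of_ae_le _ ?_
      have e1 := ENNReal.ae_le_essSup v (μ := volume.restrict (Ioo x y))
      have e2 := ENNReal.ae_le_essSup v (μ := volume.restrict (Ioo y z))
      rw [ae_restrict_iff' measurableSet_Ioo] at e1 e2
      rw [Filter.EventuallyLE, ae_restrict_iff' measurableSet_Ioo]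
      have e3 : ∀ᵐ s : ℝ, s ≠ y := by simp [ae_iff]
      filter_upwards [e1, e2, e3] with s s1 s2 s3 hs
      rcases lt_or_gt_of_ne s3 with hlt | hgt
      · exact (s1 ⟨hs.1, hlt⟩).trans (le_max_left _ _)
      · exact (s2 ⟨hgt, hs.2⟩).trans (le_max_right _ _)
    calc _ ≤ max (essSup v (volume.restrict (Ioo x y)))
          (essSup v (volume.restrict (Ioo y z))) ^ ρ := by gcongr
      _ ≤ essSup v (volume.restrict (Ioo x y)) ^ ρ
          + essSup v (volume.restrict (Ioo y z)) ^ ρ := by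
          rcases le_total (essSup v (volume.restrict (Ioo x y)))
            (essSup v (volume.restrict (Ioo y z))) with hle | hle
          · rw [max_eq_right hle]; exact le_add_self
          · rw [max_eq_left hle]; exact le_self_add
      _ ≤ _ := le_mul_of_one_le_left' h1
  · rw [← lintegral_Ioo_add hxy hyz, ← ENNReal.rpow_mul, ← ENNReal.rpow_mul, ← ENNReal.rpow_mul]
    refine (add_rpow_le_two_rpow_mul (by
      exact mul_nonneg (div_nonneg (by linarith) hr0.le) hρ) _ _).trans ?_
    gcongr
    · norm_num
    · rw [div_mul_eq_mul_div]
      gcongr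
      nlinarith

lemma exists_rpow_le_lintegral (hr0 : 0 < r) (hr1 : r ≤ 1) (hv : Measurable v) {x t : ℝ}
    {μ : ℝ≥0∞} (hμ : μ < Vr r v x t) :
    ∃ f : ℝ → ℝ≥0∞, Measurable f ∧ (∀ s, s ∉ Ioo x t → f s = 0) ∧
      ∫⁻ s in Ioo x t, f s ≤ 1 ∧ μ ^ r ≤ ∫⁻ s in Ioo x t, f s ^ r * v s := by
  unfold Vr at hμ
  split_ifs at hμ with h
  · subst h
    set A : Set ℝ := {s | μ < v s} with hA
    have hAm : MeasurableSet A := measurableSet_lt measurable_const hv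
    set m := volume.restrict (Ioo x t) A with hm
    have hm0 : m ≠ 0 := by
      intro h0
      refine absurd (essSup_le_of_ae_le μ ?_) (not_le.2 hμ)
      rw [Filter.EventuallyLE, ae_iff]
      have h1 : {a | ¬v a ≤ μ} = A := by ext s; simp [hA]
      rw [h1]
      exact h0
    have hmt : m ≠ ∞ := measure_ne_top _ _
    refine ⟨(A ∩ Ioo x t).indicator fun _ => m⁻¹,
      measurable_const.indicator (hAm.inter measurableSet_Ioo), fun s hs => ?_, ?_, ?_⟩
    · exact indicator_of_notMem (fun h => hs h.2) _
    · rw [lintegral_indicator (hAm.inter measurableSet_Ioo), lintegral_const,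
        Measure.restrict_apply_univ, Measure.restrict_apply (hAm.inter measurableSet_Ioo)]
      rw [inter_assoc, inter_self, ← Measure.restrict_apply hAm, ← hm]
      exact ENNReal.inv_mul_le_one m
    · simp only [ENNReal.rpow_one]
      calc μ = ∫⁻ s in Ioo x t, (A ∩ Ioo x t).indicator (fun _ => m⁻¹ * μ) s := by
            rw [lintegral_indicator (hAm.inter measurableSet_Ioo), lintegral_const,
              Measure.restrict_apply_univ, Measure.restrict_apply (hAm.inter measurableSet_Ioo)]
            rw [inter_assoc, inter_self, ← Measure.restrict_apply hAm, ← hm, mul_comm m⁻¹,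
              mul_assoc, ENNReal.inv_mul_cancel hm0 hmt, mul_one]
        _ ≤ _ := by
            refine lintegral_mono fun s => ?_
            by_cases hs : s ∈ A ∩ Ioo x t
            · simp only [indicator_of_mem hs]
              gcongr
              exact hs.1.le
            · simp [indicator_of_notMem hs]
  · have hr1 : r < 1 := lt_of_le_of_ne hr1 h
    have hκ : 0 < 1 / (1 - r) := by simp; linarith
    set g : ℕ → ℝ → ℝ≥0∞ := fun n s => min (v s) n ^ (1 / (1 - r)) with hg
    have hgm : ∀ n, Measurable (g n) := fun n => (hv.min measurable_const).pow_const _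
    have hlim : Filter.Tendsto (fun n => ∫⁻ s in Ioo x t, g n s) Filter.atTop
        (nhds (∫⁻ s in Ioo x t, v s ^ (1 / (1 - r)))) := by
      refine lintegral_tendsto_of_tendsto_of_monotone (fun n => (hgm n).aemeasurable)
        (Filter.Eventually.of_forall fun s m n hmn => ?_)
        (Filter.Eventually.of_forall fun s => ?_)
      · simp only [hg]
        gcongr
      · have h1 : Filter.Tendsto (fun n : ℕ => min (v s) (n : ℝ≥0∞)) Filter.atTop
            (nhds (min (v s) ∞)) := tendsto_const_nhds.min ENNReal.tendsto_nat_nhds_top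
        rw [min_eq_left le_top] at h1
        exact (ENNReal.continuous_rpow_const.tendsto _).comp h1
    have hlim2 := (ENNReal.continuous_rpow_const (y := (1 - r) / r).tendsto _).comp hlim
    obtain ⟨n, hn⟩ := ((tendsto_order.1 hlim2).1 _ hμ).exists
    simp only [Function.comp_apply] at hn
    set S := ∫⁻ s in Ioo x t, g n s with hS
    have hS0 : S ≠ 0 := by
      rintro h0
      rw [h0, ENNReal.zero_rpow_of_pos (div_pos (by linarith) hr0)] at hn
      simp at hn
    have hSt : S ≠ ∞ := by
      refine ((lintegral_mono (g := fun _ => (n : ℝ≥0∞) ^ (1 / (1 - r))) fun s => ?_).trans_lt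
        ?_).ne
      · simp only [hg]; gcongr; exact min_le_right _ _
      · rw [lintegral_const]
        refine ENNReal.mul_lt_top ?_ (measure_lt_top _ _)
        exact ENNReal.rpow_lt_top_of_nonneg hκ.le (by simp)
    refine ⟨(Ioo x t).indicator fun s => S⁻¹ * g n s,
      ((hgm n).const_mul _).indicator measurableSet_Ioo,
      fun s hs => indicator_of_notMem hs _, ?_, ?_⟩
    · rw [setLIntegral_congr_fun measurableSet_Ioo
        (fun s hs => indicator_of_mem hs fun s => S⁻¹ * g n s), lintegral_const_mul _ (hgm n)]
      exact ENNReal.inv_mul_le_one S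
    · calc μ ^ r ≤ (S ^ ((1 - r) / r)) ^ r := by gcongr
        _ = S⁻¹ ^ r * S := by
            rw [← ENNReal.rpow_mul, div_mul_cancel₀ _ hr0.ne', ENNReal.inv_rpow,
              ← ENNReal.rpow_neg]
            nth_rw 3 [← ENNReal.rpow_one S]
            rw [← ENNReal.rpow_add _ _ hS0 hSt]
            congr 1; ring
        _ = ∫⁻ s in Ioo x t, S⁻¹ ^ r * g n s := by rw [lintegral_const_mul _ (hgm n)]
        _ ≤ _ := by
            refine setLIntegral_mono' measurableSet_Ioo fun s hs => ?_
            rw [indicator_of_mem hs, ENNReal.mul_rpow_of_nonneg _ _ hr0.le, mul_assoc]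
            gcongr
            simp only [hg]
            calc min (v s) n ^ (1 / (1 - r))
                = (min (v s) n ^ (1 / (1 - r))) ^ r * min (v s) n := by
                  nth_rw 3 [← ENNReal.rpow_one (min (v s) n)]
                  rw [← ENNReal.rpow_mul,
                    ← ENNReal.rpow_add_of_nonneg _ _ (by positivity) (by norm_num)]
                  congr 1
                  field_simp [show (1 - r) ≠ 0 by linarith]
                  ring
              _ ≤ _ := by gcongr; exact min_le_left _ _

lemma exists_half_rpow_le_lintegral (hr0 : 0 < r) (hr1 : r ≤ 1) (hv : Measurable v) {x t : ℝ}
    (hfin : Vr r v x t ≠ ∞) :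
    ∃ f : ℝ → ℝ≥0∞, Measurable f ∧ (∀ s, s ∉ Ioo x t → f s = 0) ∧
      ∫⁻ s in Ioo x t, f s ≤ 1 ∧ (Vr r v x t / 2) ^ r ≤ ∫⁻ s in Ioo x t, f s ^ r * v s := by
  rcases eq_or_ne (Vr r v x t) 0 with h | h
  · exact ⟨0, measurable_const, by simp, by simp, by simp [h, hr0]⟩
  · exact exists_rpow_le_lintegral hr0 hr1 hv (ENNReal.half_lt_self h hfin)

end Vr

section Mazya

/-- Discrete Mazya inequality: a weighted Hardy inequality for partial sums forces the
summability of the associated weights. -/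
lemma sum_le_of_discrete_hardy {P Q : ℝ} (hQ : 1 ≤ Q) (hQP : Q < P) {σ ν : ℕ → ℝ≥0∞} {N : ℕ}
    (hσ : ∀ i < N, σ i ≠ ∞) (hν : ∀ i < N, ν i ≠ ∞) {A : ℝ≥0∞}
    (h : ∀ θ : ℕ → ℝ≥0∞, ∑ i ∈ Finset.range N,
      (∑ j ∈ Finset.range (i + 1), σ j ^ (1 - 1 / P) * θ j) ^ Q * ν i ≤
        A * (∑ j ∈ Finset.range N, θ j ^ P) ^ (Q / P)) :
    ∑ i ∈ Finset.range N, ν i * (∑ m ∈ Finset.Ico i N, ν m) ^ (Q / (P - Q)) *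
        (∑ j ∈ Finset.range (i + 1), σ j) ^ (Q * (P - 1) / (P - Q)) ≤
      (ENNReal.ofReal ((P - 1) / (P - Q)) ^ Q * ENNReal.ofReal (P / (P - Q)) ^ (Q / P)) ^
        (P / (P - Q)) * A ^ (P / (P - Q)) := by
  have hPQ : 0 < P - Q := by linarith
  have hP0 : 0 < P := by linarith
  have hQ0 : 0 < Q := by linarith
  set S : ℕ → ℝ≥0∞ := fun n => ∑ j ∈ Finset.range n, σ j with hS
  set T : ℕ → ℝ≥0∞ := fun i => ∑ m ∈ Finset.Ico i N, ν m with hT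
  have hS1 : ∀ i, S (i + 1) = S i + σ i := fun i => Finset.sum_range_succ _ _
  have hT1 : ∀ i < N, T i = T (i + 1) + ν i := fun i hi => by
    simp only [hT]; rw [Finset.sum_eq_sum_Ico_succ_bot hi, add_comm]
  have hSm : Monotone S := fun i j hij =>
    Finset.sum_le_sum_of_subset (Finset.range_mono hij)
  have hTm : Antitone T := fun i j hij =>
    Finset.sum_le_sum_of_subset (Finset.Ico_subset_Ico hij le_rfl)
  have hSfin : ∀ i ≤ N, S i ≠ ∞ := fun i hi =>
    ENNReal.sum_ne_top.2 fun j hj => hσ j (by simp at hj; lia)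
  have hTfin : ∀ i, T i ≠ ∞ := fun i =>
    ENNReal.sum_ne_top.2 fun j hj => hν j (by simp at hj; lia)
  change ∑ i ∈ Finset.range N, ν i * T i ^ (Q / (P - Q)) * S (i + 1) ^ (Q * (P - 1) / (P - Q)) ≤ _
  set X := ∑ i ∈ Finset.range N,
    ν i * T i ^ (Q / (P - Q)) * S (i + 1) ^ (Q * (P - 1) / (P - Q)) with hX
  have hXfin : X ≠ ∞ := by
    refine ENNReal.sum_ne_top.2 fun i hi => ?_
    have hi : i < N := by simpa using hi
    refine ENNReal.mul_ne_top (ENNReal.mul_ne_top (hν i hi) ?_) ?_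
    · exact ENNReal.rpow_ne_top_of_nonneg (by positivity) (hTfin i)
    · refine ENNReal.rpow_ne_top_of_nonneg ?_ (hSfin _ hi)
      exact div_nonneg (mul_nonneg hQ0.le (by linarith)) hPQ.le
  set γ := (Q - 1) / (P - Q) with hγ
  have hγ0 : 0 ≤ γ := div_nonneg (by linarith) hPQ.le
  have hγ1 : γ + 1 = (P - 1) / (P - Q) := by rw [hγ]; field_simp; ring
  set θ : ℕ → ℝ≥0∞ := fun j => σ j ^ (1 / P) * (S (j + 1) ^ γ * T j ^ (1 / (P - Q))) with hθ
  have h1 := h θ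
  have hσθ : ∀ j, σ j ^ (1 - 1 / P) * θ j = σ j * (S (j + 1) ^ γ * T j ^ (1 / (P - Q))) := by
    intro j
    simp only [hθ]
    rw [← mul_assoc, ← ENNReal.rpow_add_of_nonneg _ _ _ (by positivity)]
    · simp
    · rw [sub_nonneg, div_le_one hP0]; linarith
  have hlow : X ≤ ENNReal.ofReal (γ + 1) ^ Q * ∑ i ∈ Finset.range N,
      (∑ j ∈ Finset.range (i + 1), σ j ^ (1 - 1 / P) * θ j) ^ Q * ν i := by
    rw [hX, Finset.mul_sum]
    refine Finset.sum_le_sum fun i _ => ?_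
    have h2 := rpow_le_sum_mul_rpow_forward (κ := γ + 1) (by linarith) (S := S) (σ := σ)
      (by simp [hS]) hS1 (i + 1)
    rw [add_sub_cancel_right] at h2
    have h3 : T i ^ (1 / (P - Q)) * ∑ j ∈ Finset.range (i + 1), σ j * S (j + 1) ^ γ ≤
        ∑ j ∈ Finset.range (i + 1), σ j ^ (1 - 1 / P) * θ j := by
      rw [Finset.mul_sum]
      refine Finset.sum_le_sum fun j hj => ?_
      rw [hσθ]
      calc _ ≤ T j ^ (1 / (P - Q)) * (σ j * S (j + 1) ^ γ) := by
            gcongr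
            exact hTm (by simp at hj; lia)
        _ = _ := by ring
    calc ν i * T i ^ (Q / (P - Q)) * S (i + 1) ^ (Q * (P - 1) / (P - Q))
        = ν i * (T i ^ (1 / (P - Q)) * S (i + 1) ^ (γ + 1)) ^ Q := by
          rw [ENNReal.mul_rpow_of_nonneg _ _ hQ0.le, ← ENNReal.rpow_mul, ← ENNReal.rpow_mul,
            hγ1, mul_assoc]
          congr 3
          · ring
          · ring
      _ ≤ ν i * (T i ^ (1 / (P - Q)) * (ENNReal.ofReal (γ + 1) *
            ∑ j ∈ Finset.range (i + 1), σ j * S (j + 1) ^ γ)) ^ Q := by gcongr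
      _ = ν i * (ENNReal.ofReal (γ + 1) * (T i ^ (1 / (P - Q)) *
            ∑ j ∈ Finset.range (i + 1), σ j * S (j + 1) ^ γ)) ^ Q := by ring_nf
      _ ≤ ν i * (ENNReal.ofReal (γ + 1) *
            ∑ j ∈ Finset.range (i + 1), σ j ^ (1 - 1 / P) * θ j) ^ Q := by gcongr
      _ = _ := by rw [ENNReal.mul_rpow_of_nonneg _ _ hQ0.le]; ring
  have hup : ∑ j ∈ Finset.range N, θ j ^ P ≤ ENNReal.ofReal (P / (P - Q)) * X := by
    have hα : 1 ≤ P / (P - Q) := by rw [le_div_iff₀ hPQ]; linarith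
    have hα1 : P / (P - Q) - 1 = Q / (P - Q) := by field_simp; ring
    calc ∑ j ∈ Finset.range N, θ j ^ P
        = ∑ j ∈ Finset.range N, σ j * S (j + 1) ^ (γ * P) * T j ^ (P / (P - Q)) := by
          refine Finset.sum_congr rfl fun j _ => ?_
          simp only [hθ]
          rw [ENNReal.mul_rpow_of_nonneg _ _ hP0.le, ENNReal.mul_rpow_of_nonneg _ _ hP0.le,
            ← ENNReal.rpow_mul, ← ENNReal.rpow_mul, ← ENNReal.rpow_mul,
            one_div_mul_cancel hP0.ne', ENNReal.rpow_one, mul_assoc]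
          congr 3
          ring
      _ ≤ ∑ j ∈ Finset.range N, σ j * S (j + 1) ^ (γ * P) * (ENNReal.ofReal (P / (P - Q)) *
            ∑ i ∈ Finset.Ico j N, ν i * T i ^ (Q / (P - Q))) := by
          refine Finset.sum_le_sum fun j hj => ?_
          gcongr
          rw [← hα1]
          exact rpow_le_sum_mul_rpow_backward hα (by simp [hT]) hT1 (by simp at hj; lia)
      _ = ENNReal.ofReal (P / (P - Q)) * ∑ j ∈ Finset.range N, ∑ i ∈ Finset.Ico j N,
            σ j * S (j + 1) ^ (γ * P) * (ν i * T i ^ (Q / (P - Q))) := by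
          simp_rw [Finset.mul_sum]
          refine Finset.sum_congr rfl fun j _ => Finset.sum_congr rfl fun i _ => by ring
      _ = ENNReal.ofReal (P / (P - Q)) * ∑ i ∈ Finset.range N, ∑ j ∈ Finset.range (i + 1),
            σ j * S (j + 1) ^ (γ * P) * (ν i * T i ^ (Q / (P - Q))) := by
          congr 1
          refine Finset.sum_comm' fun j i => ?_
          simp only [Finset.mem_range, Finset.mem_Ico]
          lia
      _ ≤ _ := by
          rw [hX]
          gcongr with i hi
          rw [← Finset.sum_mul]
          calc _ ≤ (∑ j ∈ Finset.range (i + 1), σ j * S (i + 1) ^ (γ * P)) *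
                (ν i * T i ^ (Q / (P - Q))) := by
                gcongr with j hj
                exact hSm (by simp at hj; lia)
            _ = S (i + 1) ^ (1 + γ * P) * (ν i * T i ^ (Q / (P - Q))) := by
                rw [← Finset.sum_mul, ENNReal.rpow_add_of_nonneg _ _ zero_le_one (by positivity),
                  ENNReal.rpow_one]
            _ = _ := by
                rw [mul_comm]
                congr 2
                rw [hγ]; field_simp; ring
  have hmain : X ≤ (ENNReal.ofReal (γ + 1) ^ Q * ENNReal.ofReal (P / (P - Q)) ^ (Q / P) * A) *
      X ^ (Q / P) := by
    calc X ≤ _ := hlow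
      _ ≤ ENNReal.ofReal (γ + 1) ^ Q * (A * (ENNReal.ofReal (P / (P - Q)) * X) ^ (Q / P)) := by
          gcongr
          exact h1.trans (by gcongr)
      _ = _ := by rw [ENNReal.mul_rpow_of_nonneg _ _ (by positivity)]; ring
  rw [hγ1] at hmain
  rw [← ENNReal.mul_rpow_of_nonneg _ _ (by positivity)]
  rcases eq_or_ne X 0 with h0 | h0
  · rw [h0]; exact zero_le
  have h2 : X ^ (1 - Q / P) ≤
      ENNReal.ofReal ((P - 1) / (P - Q)) ^ Q * ENNReal.ofReal (P / (P - Q)) ^ (Q / P) * A := by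
    rw [ENNReal.rpow_sub _ _ h0 hXfin, ENNReal.rpow_one]
    exact ENNReal.div_le_of_le_mul hmain
  calc X = (X ^ (1 - Q / P)) ^ (P / (P - Q)) := by
        rw [← ENNReal.rpow_mul]
        have : (1 - Q / P) * (P / (P - Q)) = 1 := by field_simp
        rw [this, ENNReal.rpow_one]
    _ ≤ _ := by gcongr

end Mazya

section Testing

variable {a b p q r : ℝ} {u v w : ℝ → ℝ≥0∞} {C : ℝ≥0∞}

lemma CesCesIneq.Vr_mul_le (h : CesCesIneq a b r p q u v w C) (hr0 : 0 < r) (hr1 : r ≤ 1)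
    (hq : 0 < q) (hp : 0 < p) (hv : Measurable v) (hu : Measurable u) {x t : ℝ}
    (hx : a ≤ x) (hxt : x < t) (ht : t < b) :
    Vr r v x t * tail u b t ^ (1 / q) ≤ C * tail w b x ^ (1 / p) := by
  refine ENNReal.mul_le_of_forall_lt fun μ hμ c hc => ?_
  refine (mul_le_mul_right hc.le _).trans ?_
  obtain ⟨f, hf, hf0, hf1, hfμ⟩ := exists_rpow_le_lintegral hr0 hr1 hv hμ
  have h1 := h f hf
  have hL : (μ ^ q * tail u b t) ^ (1 / q) ≤
      (∫⁻ t in Ioo a b, (∫⁻ s in Ioo a t, f s ^ r * v s) ^ (q / r) * u t) ^ (1 / q) := by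
    gcongr
    calc μ ^ q * tail u b t = ∫⁻ s in Ioo t b, μ ^ q * u s := (lintegral_const_mul _ hu).symm
      _ ≤ ∫⁻ τ in Ioo t b, (∫⁻ s in Ioo a τ, f s ^ r * v s) ^ (q / r) * u τ := by
          refine setLIntegral_mono' measurableSet_Ioo fun τ hτ => ?_
          gcongr
          calc μ ^ q = (μ ^ r) ^ (q / r) := by
                rw [← ENNReal.rpow_mul, mul_div_cancel₀ _ hr0.ne']
            _ ≤ _ := by
                gcongr
                exact hfμ.trans (lintegral_Ioo_mono hx hτ.1.le _)
      _ ≤ _ := lintegral_Ioo_mono (hx.trans hxt.le) le_rfl _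
  have hR : (∫⁻ t in Ioo a b, (∫⁻ s in Ioo a t, f s) ^ p * w t) ^ (1 / p) ≤
      tail w b x ^ (1 / p) := by
    gcongr
    rw [← lintegral_Ioo_add hx (hxt.trans ht).le]
    have h0 : ∫⁻ t in Ioo a x, (∫⁻ s in Ioo a t, f s) ^ p * w t = 0 := by
      refine (setLIntegral_congr_fun measurableSet_Ioo fun τ hτ => ?_).trans lintegral_zero
      have : ∫⁻ s in Ioo a τ, f s = 0 :=
        (setLIntegral_congr_fun measurableSet_Ioo fun s hs =>
          hf0 s fun hs' => absurd (hs'.1.trans hs.2) (not_lt.2 hτ.2.le)).trans lintegral_zero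
      simp [this, hp]
    rw [h0, zero_add]
    refine setLIntegral_mono' measurableSet_Ioo fun τ _ => ?_
    refine mul_le_of_le_one_left' (ENNReal.rpow_le_one ?_ hp.le)
    refine le_trans ?_ hf1
    have hfi : f = (Ioo x t).indicator f := by
      ext s
      by_cases hs : s ∈ Ioo x t
      · rw [indicator_of_mem hs]
      · rw [indicator_of_notMem hs, hf0 s hs]
    calc ∫⁻ s in Ioo a τ, f s ≤ ∫⁻ s, f s := setLIntegral_le_lintegral _ _
      _ = ∫⁻ s in Ioo x t, f s := by
          conv_lhs => rw [hfi]
          exact lintegral_indicator measurableSet_Ioo _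
  calc μ * tail u b t ^ (1 / q) = (μ ^ q * tail u b t) ^ (1 / q) := by
        rw [ENNReal.mul_rpow_of_nonneg _ _ (by positivity), ← ENNReal.rpow_mul,
          mul_one_div_cancel hq.ne', ENNReal.rpow_one]
    _ ≤ _ := hL.trans (h1.trans (by gcongr))

lemma sum_lintegral_Ioo_le {s e : ℕ → ℝ} {n : ℕ} (h0 : a ≤ s 0) (hse : ∀ i ≤ n, s i ≤ e i)
    (hes : ∀ i < n, e i ≤ s (i + 1)) (g : ℝ → ℝ≥0∞) :
    ∑ i ∈ Finset.range (n + 1), ∫⁻ τ in Ioo (s i) (e i), g τ ≤ ∫⁻ τ in Ioo a (e n), g τ := by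
  have hae : ∀ i ≤ n, a ≤ e i := by
    intro i hi
    induction i with
    | zero => exact h0.trans (hse 0 hi)
    | succ i ih => exact (ih (by lia)).trans ((hes i (by lia)).trans (hse _ hi))
  induction n with
  | zero => simpa using lintegral_Ioo_mono h0 le_rfl g
  | succ n ih =>
    rw [Finset.sum_range_succ]
    calc _ ≤ (∫⁻ τ in Ioo a (e n), g τ) + ∫⁻ τ in Ioo (e n) (e (n + 1)), g τ := by
          refine add_le_add (ih (fun i hi => hse i (by lia)) (fun i hi => hes i (by lia))
            (fun i hi => hae i (by lia))) (lintegral_Ioo_mono (hes n (by lia)) le_rfl g)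
      _ = _ := lintegral_Ioo_add (hae n (by lia))
          ((hes n (by lia)).trans (hse _ le_rfl)) g

lemma sum_ite_rpow_le {p : ℝ} (hp : 0 < p) (β : ℕ → ℝ≥0∞) (A : ℕ → Prop) [DecidablePred A]
    (n : ℕ) : (∑ j ∈ Finset.range n, if A j then β j else 0) ^ p ≤
      ∑ i ∈ Finset.range n, if A i then (∑ j ∈ Finset.range (i + 1), β j) ^ p else 0 := by
  induction n with
  | zero => simp [hp]
  | succ n ih =>
    by_cases hA : A n
    · rw [Finset.sum_range_succ (fun i => if A i then (∑ j ∈ Finset.range (i + 1), β j) ^ p else 0),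
        if_pos hA]
      refine le_trans ?_ le_add_self
      gcongr with j
      split_ifs <;> simp
    · rw [Finset.sum_range_succ, Finset.sum_range_succ, if_neg hA, if_neg hA, add_zero, add_zero]
      exact ih

lemma CesCesIneq.sum_le (h : CesCesIneq a b r p q u v w C) (hr0 : 0 < r) (hr1 : r ≤ 1)
    (hq : 0 < q) (hp : 0 < p) (hv : Measurable v) (hu : Measurable u) (hw : Measurable w)
    {N : ℕ} {z t : ℕ → ℝ} {ω β : ℕ → ℝ≥0∞} (hz0 : a ≤ z 0) (hzt : ∀ i ≤ N, z i ≤ t i)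
    (htz : ∀ i < N, t i ≤ z (i + 1)) (htb : t N ≤ b) (hω : ∀ i < N, tail w b (z i) ≤ ω i)
    (hω1 : ∀ i < N, 2 * 2 ^ p * ω (i + 1) ≤ ω i) (hV : ∀ i < N, Vr r v (z i) (t i) ≠ ∞) :
    ∑ i ∈ Finset.range N, (∑ j ∈ Finset.range (i + 1),
        (β j * (Vr r v (z j) (t j) / 2)) ^ r) ^ (q / r) * ∫⁻ s in Ioo (t i) (t (i + 1)), u s ≤
      C ^ q * (2 * 2 ^ p * ∑ i ∈ Finset.range N, ω i * β i ^ p) ^ (q / p) := by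
  have hex : ∀ i : ℕ, ∃ f : ℝ → ℝ≥0∞, i < N → Measurable f ∧
      (∀ s, s ∉ Ioo (z i) (t i) → f s = 0) ∧
      ∫⁻ s in Ioo (z i) (t i), f s ≤ 1 ∧
        (Vr r v (z i) (t i) / 2) ^ r ≤ ∫⁻ s in Ioo (z i) (t i), f s ^ r * v s := fun i => by
    by_cases hi : i < N
    · obtain ⟨f, hf⟩ := exists_half_rpow_le_lintegral hr0 hr1 hv (hV i hi)
      exact ⟨f, fun _ => hf⟩
    · exact ⟨0, fun h => absurd h hi⟩
  choose f hf using hex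
  have hat : ∀ i ≤ N, a ≤ z i := by
    intro i hi
    induction i with
    | zero => exact hz0
    | succ i ih => exact (ih (by lia)).trans ((hzt i (by lia)).trans (htz i (by lia)))
  have htm : ∀ i < N, t i ≤ t (i + 1) := fun i hi => (htz i hi).trans (hzt _ hi)
  set F : ℝ → ℝ≥0∞ := fun s => ∑ j ∈ Finset.range N, β j * f j s with hF
  have hFm : Measurable F := Finset.measurable_fun_sum _ fun j hj =>
    (hf j (by simpa using hj)).1.const_mul _
  have h1 := ENNReal.rpow_le_rpow (h F hFm) hq.le
  rw [ENNReal.mul_rpow_of_nonneg _ _ hq.le, ← ENNReal.rpow_mul, ← ENNReal.rpow_mul,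
    one_div_mul_cancel hq.ne', ENNReal.rpow_one, one_div_mul_eq_div] at h1
  refine le_trans ?_ (h1.trans ?_)
  · rcases N with _ | n
    · simp
    calc _ ≤ ∑ i ∈ Finset.range (n + 1), ∫⁻ τ in Ioo (t i) (t (i + 1)),
          (∫⁻ s in Ioo a τ, F s ^ r * v s) ^ (q / r) * u τ := by
          refine Finset.sum_le_sum fun i hi => ?_
          have hi : i < n + 1 := by simpa using hi
          rw [← lintegral_const_mul _ hu]
          refine setLIntegral_mono' measurableSet_Ioo fun τ hτ => ?_
          gcongr
          calc _ ≤ ∑ j ∈ Finset.range (i + 1), ∫⁻ s in Ioo (z j) (t j), F s ^ r * v s := by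
                refine Finset.sum_le_sum fun j hj => ?_
                have hj : j < n + 1 := by simp at hj; lia
                obtain ⟨hfm, -, -, hfV⟩ := hf j hj
                rw [ENNReal.mul_rpow_of_nonneg _ _ hr0.le]
                calc _ ≤ β j ^ r * ∫⁻ s in Ioo (z j) (t j), f j s ^ r * v s := by gcongr
                  _ = ∫⁻ s in Ioo (z j) (t j), (β j * f j s) ^ r * v s := by
                      rw [← lintegral_const_mul (f := fun s => f j s ^ r * v s) _
                        ((hfm.pow_const r).mul hv)]
                      simp_rw [ENNReal.mul_rpow_of_nonneg _ _ hr0.le, mul_assoc]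
                  _ ≤ _ := by
                      refine lintegral_mono fun s => ?_
                      dsimp only
                      gcongr
                      exact Finset.single_le_sum (f := fun j => β j * f j s)
                        (fun _ _ => zero_le) (Finset.mem_range.2 hj)
            _ ≤ ∫⁻ s in Ioo a (t i), F s ^ r * v s :=
                sum_lintegral_Ioo_le hz0 (fun j hj => hzt j (by lia))
                  (fun j hj => htz j (by lia)) _
            _ ≤ _ := lintegral_Ioo_mono le_rfl hτ.1.le _
      _ ≤ ∫⁻ τ in Ioo a (t (n + 1)),
          (∫⁻ s in Ioo a τ, F s ^ r * v s) ^ (q / r) * u τ :=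
          sum_lintegral_Ioo_le (s := t) (e := fun i => t (i + 1)) (hz0.trans (hzt 0 (by lia)))
            (fun i hi => htm i (by lia)) (fun i hi => le_rfl) _
      _ ≤ _ := lintegral_Ioo_mono le_rfl htb _
  · gcongr
    classical
    calc _ ≤ ∫⁻ τ in Ioo a b, ∑ i ∈ Finset.range N, (Ioi (z i)).indicator
            (fun τ => (∑ j ∈ Finset.range (i + 1), β j) ^ p * w τ) τ := by
          refine lintegral_mono fun τ => ?_
          have hle : ∫⁻ s in Ioo a τ, F s ≤ ∑ j ∈ Finset.range N, if z j < τ then β j else 0 := by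
            simp only [hF]
            rw [lintegral_finsetSum _ fun j hj => (hf j (by simpa using hj)).1.const_mul _]
            refine Finset.sum_le_sum fun j hj => ?_
            obtain ⟨hfm, hf0, hf1, -⟩ := hf j (by simpa using hj)
            rw [lintegral_const_mul _ hfm]
            split_ifs with hlt
            · refine mul_le_of_le_one_right' (le_trans ?_ hf1)
              have hfi : f j = (Ioo (z j) (t j)).indicator (f j) := by
                ext s
                by_cases hs : s ∈ Ioo (z j) (t j)
                · rw [indicator_of_mem hs]
                · rw [indicator_of_notMem hs, hf0 s hs]
              calc ∫⁻ s in Ioo a τ, f j s ≤ ∫⁻ s, f j s := setLIntegral_le_lintegral _ _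
                _ = ∫⁻ s in Ioo (z j) (t j), f j s := by
                    conv_lhs => rw [hfi]
                    exact lintegral_indicator measurableSet_Ioo _
            · have : ∫⁻ s in Ioo a τ, f j s = 0 :=
                (setLIntegral_congr_fun measurableSet_Ioo fun s hs =>
                  hf0 s fun hs' => hlt (hs'.1.trans hs.2)).trans lintegral_zero
              simp [this]
          calc _ ≤ (∑ j ∈ Finset.range N, if z j < τ then β j else 0) ^ p * w τ := by gcongr
            _ ≤ (∑ i ∈ Finset.range N, if z i < τ then
                  (∑ j ∈ Finset.range (i + 1), β j) ^ p else 0) * w τ := by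
                gcongr
                exact sum_ite_rpow_le hp β _ N
            _ = _ := by
                rw [Finset.sum_mul]
                refine Finset.sum_congr rfl fun i _ => ?_
                by_cases hlt : z i < τ
                · simp [hlt]
                · simp [hlt]
      _ = ∑ i ∈ Finset.range N, (∑ j ∈ Finset.range (i + 1), β j) ^ p * tail w b (z i) := by
          rw [lintegral_finsetSum _ fun i _ => (hw.const_mul _).indicator measurableSet_Ioi]
          refine Finset.sum_congr rfl fun i hi => ?_
          rw [lintegral_indicator measurableSet_Ioi, Measure.restrict_restrict measurableSet_Ioi,
            inter_comm, Ioo_inter_Ioi, max_eq_right (hat i (by simp at hi; lia)),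
            lintegral_const_mul _ hw]
          rfl
      _ ≤ ∑ i ∈ Finset.range N, ω i * (∑ j ∈ Finset.range (i + 1), β j) ^ p := by
          refine Finset.sum_le_sum fun i hi => ?_
          rw [mul_comm]
          gcongr
          exact hω i (by simpa using hi)
      _ ≤ _ := le_self_add.trans (sum_geometric_forward
            (g := fun n => (∑ j ∈ Finset.range n, β j) ^ p) (d := fun i => β i ^ p)
            (by simp [hp]) (fun i _ => by
              rw [Finset.sum_range_succ]
              exact add_rpow_le_two_rpow_mul hp.le _ _) hω1)

/-- Combination of testing on blocks with the discrete Mazya inequality. -/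
lemma CesCesIneq.exists_sum_le (hr0 : 0 < r) (hr1 : r ≤ 1) (hq : 1 ≤ q) (hqp : q < p) :
    ∃ K : ℝ≥0∞, K ≠ ∞ ∧ ∀ {a b : ℝ} {u v w : ℝ → ℝ≥0∞} {C : ℝ≥0∞},
      CesCesIneq a b r p q u v w C → Measurable v → Measurable u → Measurable w →
      ∀ {N : ℕ} {z t : ℕ → ℝ} {ω : ℕ → ℝ≥0∞}, a ≤ z 0 → (∀ i ≤ N, z i ≤ t i) →
      (∀ i < N, t i ≤ z (i + 1)) → t N ≤ b → (∀ i < N, tail w b (z i) ≤ ω i) →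
      (∀ i < N, 2 * 2 ^ p * ω (i + 1) ≤ ω i) → (∀ i < N, ω i ≠ 0) → (∀ i < N, ω i ≠ ∞) →
      (∀ i < N, Vr r v (z i) (t i) ≠ ∞) → (∀ i < N, tail u b (t i) ≠ ∞) →
      ∑ i ∈ Finset.range N, (∫⁻ s in Ioo (t i) (t (i + 1)), u s) *
          (∫⁻ s in Ioo (t i) (t N), u s) ^ (q / (p - q)) *
          (∑ j ∈ Finset.range (i + 1), ω j ^ (-(r / (p - r))) *
            Vr r v (z j) (t j) ^ (p * r / (p - r))) ^ ((p - r) * q / ((p - q) * r)) ≤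
        K * C ^ (p * q / (p - q)) := by
  have hp : 0 < p := by linarith
  have hpr : 0 < p - r := by linarith
  have hpq : 0 < p - q := by linarith
  have hQ : 1 ≤ q / r := by rw [le_div_iff₀ hr0]; linarith
  have hQP : q / r < p / r := by gcongr
  set ρ := p * r / (p - r) with hρ
  have hρ0 : 0 < ρ := by positivity
  set η := (p - r) * q / ((p - q) * r) with hη
  have hη0 : 0 < η := by positivity
  have e1 : q / r / (p / r - q / r) = q / (p - q) := by field_simp
  have e2 : q / r * (p / r - 1) / (p / r - q / r) = η := by rw [hη]; field_simp
  have e3 : p / r / (p / r - q / r) = p / (p - q) := by field_simp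
  have e4 : q / r / (p / r) = q / p := by field_simp
  have e5 : 1 - 1 / (p / r) = (p - r) / p := by field_simp
  set K₀ := (ENNReal.ofReal ((p / r - 1) / (p / r - q / r)) ^ (q / r) *
    ENNReal.ofReal (p / (p - q)) ^ (q / p)) ^ (p / (p - q)) with hK₀
  refine ⟨(2 ^ ρ) ^ η * (K₀ * ((2 * 2 ^ p) ^ (q / p)) ^ (p / (p - q))), ?_, ?_⟩
  · refine ENNReal.mul_ne_top ?_ (ENNReal.mul_ne_top ?_ ?_)
    · exact ENNReal.rpow_ne_top_of_nonneg hη0.le (ENNReal.rpow_ne_top_of_nonneg hρ0.le (by simp))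
    · refine ENNReal.rpow_ne_top_of_nonneg (by positivity) (ENNReal.mul_ne_top ?_ ?_)
      · exact ENNReal.rpow_ne_top_of_nonneg (by positivity) (by simp)
      · exact ENNReal.rpow_ne_top_of_nonneg (by positivity) (by simp)
    · refine ENNReal.rpow_ne_top_of_nonneg (by positivity)
        (ENNReal.rpow_ne_top_of_nonneg (by positivity) (ENNReal.mul_ne_top (by simp) ?_))
      exact ENNReal.rpow_ne_top_of_nonneg hp.le (by simp)
  intro a b u v w C h hv hu hw N z t ω hz0 hzt htz htb hω hω1 hω0 hωt hV hU
  have htm : ∀ i < N, t i ≤ t (i + 1) := fun i hi => (htz i hi).trans (hzt _ hi)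
  have htN : ∀ i ≤ N, t i ≤ t N := fun i hi => by
    induction hi using Nat.decreasingInduction with
    | self => exact le_rfl
    | of_succ k hk ih => exact (htm k hk).trans ih
  set σ : ℕ → ℝ≥0∞ := fun j => ω j ^ (-(r / (p - r))) * (Vr r v (z j) (t j) / 2) ^ ρ with hσ
  set ν : ℕ → ℝ≥0∞ := fun i => ∫⁻ s in Ioo (t i) (t (i + 1)), u s with hν
  have hσt : ∀ i < N, σ i ≠ ∞ := fun i hi => by
    refine ENNReal.mul_ne_top ?_ (ENNReal.rpow_ne_top_of_nonneg hρ0.le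
      (ENNReal.div_ne_top (hV i hi) (by simp)))
    rw [ENNReal.rpow_neg]
    exact ENNReal.inv_ne_top.2 (ENNReal.rpow_pos (pos_iff_ne_zero.2 (hω0 i hi)) (hωt i hi)).ne'
  have hνt : ∀ i < N, ν i ≠ ∞ := fun i hi =>
    ((lintegral_Ioo_mono le_rfl ((htN _ hi).trans htb) _).trans_lt (hU i hi).lt_top).ne
  have hT : ∀ i ≤ N, ∑ m ∈ Finset.Ico i N, ν m = ∫⁻ s in Ioo (t i) (t N), u s := fun i hi => by
    induction hi using Nat.decreasingInduction with
    | self => simp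
    | of_succ k hk ih =>
      rw [Finset.sum_eq_sum_Ico_succ_bot hk, ih, lintegral_Ioo_add (htm k hk) (htN _ hk)]
  have key := sum_le_of_discrete_hardy hQ hQP (σ := σ) (ν := ν) (N := N) hσt hνt
    (A := C ^ q * (2 * 2 ^ p) ^ (q / p)) (fun θ => by
      have h1 := h.sum_le hr0 hr1 (by linarith) hp hv hu hw (N := N) (z := z) (t := t) (ω := ω)
        (β := fun j => θ j ^ (1 / r) * ω j ^ (-(1 / p))) hz0 hzt htz htb hω hω1 hV
      rw [ENNReal.mul_rpow_of_nonneg _ _ (by positivity : 0 ≤ q / p), ← mul_assoc] at h1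
      rw [e4, e5]
      refine le_trans (le_of_eq ?_) (h1.trans (le_of_eq ?_))
      · refine Finset.sum_congr rfl fun i hi => ?_
        congr 2
        refine Finset.sum_congr rfl fun j hj => ?_
        simp only [hσ]
        rw [ENNReal.mul_rpow_of_nonneg _ _ hr0.le, ENNReal.mul_rpow_of_nonneg _ _ hr0.le,
          ENNReal.mul_rpow_of_nonneg _ _ (by positivity), ← ENNReal.rpow_mul, ← ENNReal.rpow_mul,
          ← ENNReal.rpow_mul, ← ENNReal.rpow_mul, one_div_mul_cancel hr0.ne', ENNReal.rpow_one]
        have e6 : -(r / (p - r)) * ((p - r) / p) = -(1 / p) * r := by field_simp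
        have e7 : ρ * ((p - r) / p) = r := by rw [hρ]; field_simp
        rw [e6, e7]
        ring
      · congr 2
        refine Finset.sum_congr rfl fun i hi => ?_
        have hi : i < N := by simpa using hi
        rw [ENNReal.mul_rpow_of_nonneg _ _ hp.le, ← ENNReal.rpow_mul, ← ENNReal.rpow_mul]
        have e6 : -(1 / p) * p = -1 := by field_simp
        rw [e6, ENNReal.rpow_neg_one, mul_comm, mul_assoc,
          ENNReal.inv_mul_cancel (hω0 i hi) (hωt i hi), mul_one]
        congr 1; field_simp)
  rw [e1, e2, e3, e4] at key
  calc _ = (2 ^ ρ) ^ η * ∑ i ∈ Finset.range N, ν i * (∑ m ∈ Finset.Ico i N, ν m) ^ (q / (p - q)) *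
        (∑ j ∈ Finset.range (i + 1), σ j) ^ η := by
        rw [Finset.mul_sum]
        refine Finset.sum_congr rfl fun i hi => ?_
        rw [hT i (by simp at hi; lia)]
        have : ∑ j ∈ Finset.range (i + 1), ω j ^ (-(r / (p - r))) * Vr r v (z j) (t j) ^ ρ =
            2 ^ ρ * ∑ j ∈ Finset.range (i + 1), σ j := by
          rw [Finset.mul_sum]
          refine Finset.sum_congr rfl fun j _ => ?_
          simp only [hσ]
          rw [mul_left_comm, ← ENNReal.mul_rpow_of_nonneg _ _ hρ0.le,
            ENNReal.mul_div_cancel (by simp) (by simp)]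
        rw [this, ENNReal.mul_rpow_of_nonneg _ _ hη0.le]
        ring
    _ ≤ (2 ^ ρ) ^ η * (K₀ * (C ^ q * (2 * 2 ^ p) ^ (q / p)) ^ (p / (p - q))) := by gcongr
    _ = _ := by
        have : q * (p / (p - q)) = p * q / (p - q) := by ring
        rw [ENNReal.mul_rpow_of_nonneg _ _ (by positivity), ← ENNReal.rpow_mul C, this]
        ring

end Testing

section Necessity

lemma IsWeight.lintegral_pos {a b : ℝ} {φ : ℝ → ℝ≥0∞} (h : IsWeight a b φ) {x y : ℝ} (hx : a ≤ x)
    (hxy : x < y) (hy : y ≤ b) : 0 < ∫⁻ s in Ioo x y, φ s := by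
  rw [setLIntegral_pos_iff h.1]
  have hvol : 0 < volume (Ioo x y) := by rw [Real.volume_Ioo]; simpa using hxy
  exact hvol.trans_le (measure_mono fun s hs =>
    ⟨(h.2 s ⟨hx.trans_lt hs.1, hs.2.trans_le hy⟩).1.ne', hs⟩)

lemma IsGrid.tail_add {φ : ℝ → ℝ≥0∞} {c d : ℝ} {M : ℝ≥0∞} {x : ℕ → ℝ} (h : IsGrid φ c d M x)
    (j n : ℕ) : M ^ n * tail φ d (x (j + n)) = tail φ d (x j) := by
  induction n with
  | zero => simp
  | succ n ih => rw [pow_succ, mul_assoc, ← add_assoc, h.tail_succ, ih]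

lemma IsGrid.mem_Ico {φ : ℝ → ℝ≥0∞} {c d : ℝ} {M : ℝ≥0∞} {x : ℕ → ℝ} (h : IsGrid φ c d M x)
    {k : ℕ} {y : ℝ} (hc : c ≤ y) (hy : y < x (k + 1)) : ∃ j ≤ k, y ∈ Ico (x j) (x (j + 1)) := by
  induction k with
  | zero => exact ⟨0, le_rfl, by rwa [h.zero], hy⟩
  | succ k ih =>
    rcases lt_or_ge y (x (k + 1)) with hlt | hge
    · obtain ⟨j, hj, hm⟩ := ih hlt
      exact ⟨j, by lia, hm⟩
    · exact ⟨k + 1, le_rfl, hge, hy⟩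

lemma IsGrid.le {φ : ℝ → ℝ≥0∞} {c d : ℝ} {M : ℝ≥0∞} {x : ℕ → ℝ} (h : IsGrid φ c d M x) (k : ℕ) :
    c ≤ x k := h.zero ▸ h.strictMono.monotone (Nat.zero_le k)

lemma lintegral_mul_essSup_le {a b : ℝ} (hab : a < b) {w : ℝ → ℝ≥0∞} (hw : Measurable w)
    {g : ℝ → ℝ → ℝ → ℝ≥0∞} {B : ℝ≥0∞}
    (hanti : ∀ a₁ a₂ y x, a₁ ≤ a₂ → g a₂ y x ≤ g a₁ y x)
    (hmono : ∀ a₁ y x₁ x₂, x₁ ≤ x₂ → g a₁ y x₁ ≤ g a₁ y x₂)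
    (hsup : ∀ y x, a < y → g a y x ≤ ⨆ a₁ ∈ Ioo a y, g a₁ y x)
    (h : ∀ a₁ ∈ Ioo a b, ∫⁻ x in Ioo a₁ b,
      w x * essSup (fun y => g a₁ y x) (volume.restrict (Ioo a₁ x)) ≤ B) :
    ∫⁻ x in Ioo a b, w x * essSup (fun y => g a y x) (volume.restrict (Ioo a x)) ≤ B := by
  obtain ⟨c, hc, hcm, hlim⟩ := exists_seq_strictAnti_tendsto' hab
  set E : ℕ → ℝ → ℝ≥0∞ := fun n x =>
    essSup (fun y => g (c n) y x) (volume.restrict (Ioo (c n) x)) with hE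
  have hEm : ∀ n, Measurable (E n) := fun n => by
    refine Monotone.measurable fun x₁ x₂ h12 => ?_
    exact essSup_Ioo_mono le_rfl h12 fun y _ => hmono _ _ _ _ h12
  have hE1 : ∀ x, essSup (fun y => g a y x) (volume.restrict (Ioo a x)) ≤ ⨆ n, E n x := by
    intro x
    refine essSup_le_of_ae_le _ ?_
    have hall : ∀ᵐ y, ∀ n, y ∈ Ioo (c n) x → g (c n) y x ≤ E n x := by
      rw [ae_all_iff]
      intro n
      rw [← ae_restrict_iff' measurableSet_Ioo]
      exact ENNReal.ae_le_essSup (fun y => g (c n) y x)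
    filter_upwards [ae_restrict_of_ae hall, ae_restrict_mem measurableSet_Ioo] with y hy hm
    refine (hsup y x hm.1).trans (iSup₂_le fun a₁ ha₁ => ?_)
    obtain ⟨n, hn⟩ := ((tendsto_order.1 hlim).2 a₁ ha₁.1).exists
    exact (hanti _ _ y x hn.le).trans
      ((hy n ⟨hn.trans ha₁.2, hm.2⟩).trans (le_iSup (fun n => E n x) n))
  calc _ ≤ ∫⁻ x in Ioo a b, ⨆ n, w x * E n x := by
        refine lintegral_mono fun x => ?_
        rw [← ENNReal.mul_iSup]
        exact mul_le_mul_right (hE1 x) _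
    _ = ⨆ n, ∫⁻ x in Ioo a b, w x * E n x := by
        refine lintegral_iSup (fun n => hw.mul (hEm n)) fun m n hmn x => ?_
        refine mul_le_mul_right ?_ _
        exact essSup_Ioo_mono (hc.antitone hmn) le_rfl fun y _ => hanti _ _ _ _ (hc.antitone hmn)
    _ ≤ B := by
        refine iSup_le fun n => ?_
        rw [← lintegral_Ioo_add (hcm n).1.le (hcm n).2.le]
        have h0 : ∫⁻ x in Ioo a (c n), w x * E n x = 0 := by
          refine (setLIntegral_congr_fun measurableSet_Ioo fun x hx => ?_).trans lintegral_zero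
          simp [hE, Ioo_eq_empty_of_le hx.2.le]
        rw [h0, zero_add]
        exact h _ (hcm n)

lemma tsum_sum_range_succ_eq (f : ℕ → ℕ → ℝ≥0∞) :
    ∑' k, ∑ j ∈ Finset.range (k + 1), f j k = ∑' d, ∑' j, f j (j + d) := by
  have h1 : ∀ k, ∑ j ∈ Finset.range (k + 1), f j k = ∑' j, if j ≤ k then f j k else 0 := by
    intro k
    rw [tsum_eq_sum (s := Finset.range (k + 1))]
    · refine Finset.sum_congr rfl fun j hj => ?_
      rw [if_pos (by simp at hj; lia)]
    · intro j hj
      rw [if_neg (by simp at hj; lia)]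
  simp_rw [h1]
  rw [ENNReal.tsum_comm, ENNReal.tsum_comm (f := fun d j => f j (j + d))]
  refine tsum_congr fun j => ?_
  rw [← ENNReal.summable.sum_add_tsum_nat_add' (k := j)]
  rw [Finset.sum_eq_zero, zero_add]
  · refine tsum_congr fun d => ?_
    rw [if_pos (by lia), add_comm]
  · intro k hk
    rw [if_neg (by simp at hk; lia)]

lemma tsum_le_of_residues {F : ℕ → ℝ≥0∞} {B : ℝ≥0∞} {m : ℕ} (hm : 0 < m)
    (h : ∀ l < m, ∑' i, F (i * m + l) ≤ B) : ∑' j, F j ≤ m * B := by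
  have : NeZero m := ⟨hm.ne'⟩
  rw [← (Nat.divModEquiv m).symm.tsum_eq, ENNReal.tsum_prod', ENNReal.tsum_comm, tsum_fintype]
  calc _ ≤ ∑ _l : Fin m, B := Finset.sum_le_sum fun l _ => by
        simpa [Nat.divModEquiv] using h l l.2
    _ = _ := by simp

variable {a b p q r : ℝ} {u v w : ℝ → ℝ≥0∞} {C : ℝ≥0∞}

lemma CesCesIneq.tail_ne_top (h : CesCesIneq a b r p q u v w C) (hC : C ≠ ∞) (hr0 : 0 < r)
    (hr1 : r ≤ 1) (hq : 0 < q) (hp : 0 < p) (hu : IsWeight a b u) (hv : IsWeight a b v)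
    (hW : ∀ x ∈ Ioo a b, 0 < tail w b x ∧ tail w b x < ∞) {t : ℝ} (ht : t ∈ Ioo a b) :
    tail u b t ≠ ∞ := by
  obtain ⟨x, hax, hxt⟩ := exists_between ht.1
  have h1 := h.Vr_mul_le hr0 hr1 hq hp hv.1 hu.1 hax.le hxt ht.2
  intro htop
  rw [htop, ENNReal.top_rpow_of_pos (by positivity),
    ENNReal.mul_top (Vr_pos hr0 hr1 hv hax.le hxt ht.2.le).ne', top_le_iff] at h1
  exact ENNReal.mul_ne_top hC (ENNReal.rpow_ne_top_of_nonneg (by positivity)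
    (hW x ⟨hax, hxt.trans ht.2⟩).2.ne) h1

lemma CesCesIneq.Vr_ne_top (h : CesCesIneq a b r p q u v w C) (hC : C ≠ ∞) (hr0 : 0 < r)
    (hr1 : r ≤ 1) (hq : 0 < q) (hp : 0 < p) (hu : IsWeight a b u) (hv : IsWeight a b v)
    (hW : ∀ x ∈ Ioo a b, 0 < tail w b x ∧ tail w b x < ∞) {x t : ℝ} (hx : a < x) (hxt : x ≤ t)
    (ht : t < b) : Vr r v x t ≠ ∞ := by
  obtain ⟨t', htt', ht'⟩ := exists_between ht
  have hxt' : x < t' := hxt.trans_lt htt'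
  have h1 := h.Vr_mul_le hr0 hr1 hq hp hv.1 hu.1 hx.le hxt' ht'
  refine ne_top_of_le_ne_top ?_ (Vr_mono hr0 hr1 le_rfl htt'.le)
  intro htop
  have h2 : tail u b t' ^ (1 / q) ≠ 0 := (ENNReal.rpow_pos_of_nonneg
    (hu.lintegral_pos (hx.trans hxt').le ht' le_rfl) (by positivity)).ne'
  rw [htop, ENNReal.top_mul h2, top_le_iff] at h1
  exact ENNReal.mul_ne_top hC (ENNReal.rpow_ne_top_of_nonneg (by positivity)
    (hW x ⟨hx, hxt'.trans ht'⟩).2.ne) h1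

lemma CesCesIneq.C₁_le (h : CesCesIneq a b r p q u v w C) (hr0 : 0 < r)
    (hr1 : r ≤ 1) (hq : 0 < q) (hp : 0 < p) (hu : IsWeight a b u) (hv : IsWeight a b v)
    (hW : ∀ x ∈ Ioo a b, 0 < tail w b x ∧ tail w b x < ∞) : C₁ a b r p q u v w ≤ C := by
  refine essSup_Ioo_le fun x hx => ?_
  have h1 : essSup (fun t => (∫⁻ s in Ioo t b, u s) ^ (1 / q) * Vr r v x t)
      (volume.restrict (Ioo x b)) ≤ C * tail w b x ^ (1 / p) :=
    essSup_Ioo_le fun t ht => by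
      rw [mul_comm]
      exact h.Vr_mul_le hr0 hr1 hq hp hv.1 hu.1 hx.1.le ht.1 ht.2
  refine (mul_le_mul_right h1 _).trans (le_of_eq ?_)
  change tail w b x ^ (-(1 / p)) * _ = C
  rw [mul_left_comm, ← ENNReal.rpow_add _ _ (hW x hx).1.ne' (hW x hx).2.ne]
  simp

end Necessity

section NecessityLocal

variable {a b p q r : ℝ} {u v w : ℝ → ℝ≥0∞} {C : ℝ≥0∞}

lemma four_le_two_mul_two_rpow {p : ℝ} (hp : 1 ≤ p) : (4 : ℝ≥0∞) ≤ 2 * 2 ^ p := by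
  calc (4 : ℝ≥0∞) = 2 * 2 ^ (1 : ℝ) := by rw [ENNReal.rpow_one]; norm_num
    _ ≤ _ := by gcongr; norm_num

lemma IsGrid.lintegral_mul_le_tsum {φ : ℝ → ℝ≥0∞} {c d : ℝ} {M : ℝ≥0∞} {x : ℕ → ℝ}
    (h : IsGrid φ c d M x) {E : ℝ → ℝ≥0∞} {F : ℕ → ℝ≥0∞}
    (hF : ∀ k, ∀ y ∈ Ioo (x k) (x (k + 1)), E y ≤ F k) (hφ : Measurable φ) :
    ∫⁻ y in Ioo c d, φ y * E y ≤ ∑' k, tail φ d (x k) * F k := by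
  rw [← h.zero, ← tsum_lintegral_Ioo h.strictMono.monotone h.lt h.cover]
  refine ENNReal.tsum_le_tsum fun k => ?_
  calc _ ≤ ∫⁻ y in Ioo (x k) (x (k + 1)), φ y * F k :=
        setLIntegral_mono' measurableSet_Ioo fun y hy => by gcongr; exact hF k y hy
    _ = (∫⁻ y in Ioo (x k) (x (k + 1)), φ y) * F k := lintegral_mul_const _ hφ
    _ ≤ _ := by
        gcongr
        exact lintegral_Ioo_mono le_rfl (h.lt _).le _

lemma tsum_succ_mul_inv_pow_le {M : ℝ≥0∞} (hM : 4 ≤ M) :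
    ∑' d : ℕ, (M ^ d)⁻¹ * ((d + 1 : ℕ) : ℝ≥0∞) ≤ 2 := by
  calc _ ≤ ∑' d : ℕ, (2 : ℝ≥0∞)⁻¹ ^ d := by
        refine ENNReal.tsum_le_tsum fun d => ?_
        rw [← ENNReal.inv_pow, ← ENNReal.div_eq_inv_mul]
        refine ENNReal.div_le_of_le_mul ?_
        rw [← ENNReal.div_eq_inv_mul, ENNReal.le_div_iff_mul_le (by simp) (by simp)]
        have h1 : ((d + 1 : ℕ) : ℝ≥0∞) ≤ 2 ^ d := by exact_mod_cast Nat.lt_two_pow_self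
        calc ((d + 1 : ℕ) : ℝ≥0∞) * 2 ^ d ≤ 2 ^ d * 2 ^ d := by gcongr
          _ = 4 ^ d := by rw [← mul_pow]; norm_num
          _ ≤ _ := by gcongr
    _ = 2 := by rw [ENNReal.tsum_geometric, ENNReal.one_sub_inv_two, inv_inv]

/-- The local supremum entering `C₇`. -/
def localSup (r : ℝ) (u v : ℝ → ℝ≥0∞) (α s : ℝ) (y x : ℝ) : ℝ≥0∞ :=
  essSup (fun t => (∫⁻ s in Ioo t x, u s) ^ α * Vr r v y t ^ s) (volume.restrict (Ioo y x))

lemma localSup_mono (hr0 : 0 < r) (hr1 : r ≤ 1) {α s : ℝ} (hα : 0 ≤ α) (hs : 0 ≤ s)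
    {y x y' x' : ℝ} (hy : y' ≤ y) (hx : x ≤ x') :
    localSup r u v α s y x ≤ localSup r u v α s y' x' := by
  refine essSup_Ioo_mono hy hx fun t _ => ?_
  gcongr
  exact Vr_mono hr0 hr1 hy le_rfl

lemma CesCesIneq.exists_tsum_localSup_le (hr0 : 0 < r) (hr1 : r ≤ 1) (hq : 1 ≤ q) (hqp : q < p) :
    ∃ K : ℝ≥0∞, K ≠ ∞ ∧ ∀ {a b : ℝ} {u v w : ℝ → ℝ≥0∞} {C : ℝ≥0∞},
      CesCesIneq a b r p q u v w C → C ≠ ∞ → IsWeight a b u → IsWeight a b v → IsWeight a b w →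
      (∀ x ∈ Ioo a b, 0 < tail w b x ∧ tail w b x < ∞) →
      ∀ {z : ℕ → ℝ}, StrictMono z → (∀ k, z k ∈ Ioo a b) →
      (∀ k, 2 * 2 ^ p * tail w b (z (k + 1)) ≤ tail w b (z k)) →
      ∑' k, tail w b (z k) ^ (-(q / (p - q))) *
        localSup r u v (p / (p - q)) (p * q / (p - q)) (z k) (z (k + 1)) ≤
        K * C ^ (p * q / (p - q)) := by
  obtain ⟨K, hK, hmain⟩ := CesCesIneq.exists_sum_le hr0 hr1 hq hqp
  refine ⟨K, hK, ?_⟩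
  intro a b u v w C h hC hu hv hw hW z hz hzm hz2
  have hp : 0 < p := by linarith
  have hpr : 0 < p - r := by linarith
  have hpq : 0 < p - q := by linarith
  have hq0 : 0 < q := by linarith
  refine ENNReal.tsum_le_of_sum_range_le fun N => ?_
  calc _ ≤ ∑ i ∈ Finset.range N, ⨆ t ∈ Ioo (z i) (z (i + 1)), tail w b (z i) ^ (-(q / (p - q))) *
        ((∫⁻ s in Ioo t (z (i + 1)), u s) ^ (p / (p - q)) *
          Vr r v (z i) t ^ (p * q / (p - q))) := by
        refine Finset.sum_le_sum fun i _ => ?_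
        refine (mul_le_mul_right (c := ⨆ t ∈ Ioo (z i) (z (i + 1)),
          (∫⁻ s in Ioo t (z (i + 1)), u s) ^ (p / (p - q)) *
            Vr r v (z i) t ^ (p * q / (p - q)))
          (essSup_Ioo_le fun t ht => le_iSup₂_of_le t ht le_rfl) _).trans (le_of_eq ?_)
        rw [ENNReal.mul_iSup]
        refine iSup_congr fun t => ?_
        rw [ENNReal.mul_iSup]
    _ ≤ _ := by
        refine sum_iSup_le_of_forall (fun i => nonempty_Ioo.2 (hz i.lt_succ_self))
          fun t ht => ?_
        have htab : ∀ i, t i ∈ Ioo a b := fun i =>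
          ⟨(hzm i).1.trans (ht i).1, (ht i).2.trans (hzm _).2⟩
        refine le_trans (Finset.sum_le_sum fun i hi => ?_) (hmain h hv.1 hu.1 hw.1 (N := N)
          (z := z) (t := t) (ω := fun i => tail w b (z i)) (hzm 0).1.le
          (fun i _ => (ht i).1.le) (fun i _ => (ht i).2.le) (htab N).2.le (fun i _ => le_rfl)
          (fun i _ => hz2 i) (fun i _ => (hW _ (hzm i)).1.ne') (fun i _ => (hW _ (hzm i)).2.ne)
          (fun i _ => h.Vr_ne_top hC hr0 hr1 hq0 hp hu hv hW (hzm i).1 (ht i).1.le (htab i).2)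
          (fun i _ => h.tail_ne_top hC hr0 hr1 hq0 hp hu hv hW (htab i)))
        have hi : i < N := by simpa using hi
        have hη : 0 ≤ (p - r) * q / ((p - q) * r) := by positivity
        have hzN : z (i + 1) ≤ t N := (hz.monotone (by lia)).trans (ht N).1.le
        calc _ = (∫⁻ s in Ioo (t i) (z (i + 1)), u s) *
              (∫⁻ s in Ioo (t i) (z (i + 1)), u s) ^ (q / (p - q)) *
              (tail w b (z i) ^ (-(r / (p - r))) * Vr r v (z i) (t i) ^ (p * r / (p - r))) ^
                ((p - r) * q / ((p - q) * r)) := by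
              have e1 : -(r / (p - r)) * ((p - r) * q / ((p - q) * r)) = -(q / (p - q)) := by
                field_simp
              have e2 : p * r / (p - r) * ((p - r) * q / ((p - q) * r)) = p * q / (p - q) := by
                field_simp
              have e3 : p / (p - q) = 1 + q / (p - q) := by field_simp; ring
              rw [ENNReal.mul_rpow_of_nonneg _ _ hη, ← ENNReal.rpow_mul, ← ENNReal.rpow_mul, e1, e2,
                e3, ENNReal.rpow_add_of_nonneg _ _ zero_le_one (by positivity), ENNReal.rpow_one]
              ring
          _ ≤ _ := by
              gcongr
              · exact (ht (i + 1)).1.le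
              · exact Finset.single_le_sum (f := fun j => tail w b (z j) ^ (-(r / (p - r))) *
                  Vr r v (z j) (t j) ^ (p * r / (p - r))) (fun _ _ => zero_le)
                  (Finset.self_mem_range_succ i)

lemma CesCesIneq.exists_C₇_le (hr0 : 0 < r) (hr1 : r ≤ 1) (hq : 1 ≤ q) (hqp : q < p) :
    ∃ K : ℝ≥0∞, K ≠ ∞ ∧ ∀ {a b : ℝ} {u v w : ℝ → ℝ≥0∞} {C : ℝ≥0∞}, a < b →
      CesCesIneq a b r p q u v w C → C ≠ ∞ → IsWeight a b u → IsWeight a b v → IsWeight a b w →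
      (∀ x ∈ Ioo a b, 0 < tail w b x ∧ tail w b x < ∞) →
      C₇ a b r p q u v w ≤ K * C := by
  obtain ⟨K, hK, hmain⟩ := CesCesIneq.exists_tsum_localSup_le hr0 hr1 hq hqp
  have hp : 0 < p := by linarith
  have hpq : 0 < p - q := by linarith
  have hq0 : 0 < q := by linarith
  set M : ℝ≥0∞ := 2 * 2 ^ p with hM
  have hM4 : 4 ≤ M := four_le_two_mul_two_rpow (by linarith)
  have hM2 : 2 ≤ M := le_trans (by norm_num) hM4
  have hM0 : M ≠ 0 := (lt_of_lt_of_le (by norm_num) hM4).ne'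
  have hMt : M ≠ ∞ := ENNReal.mul_ne_top (by simp)
    (ENNReal.rpow_ne_top_of_nonneg hp.le (by simp))
  set K' := M ^ (p / (p - q)) * (2 * K) with hK'
  refine ⟨K' ^ ((p - q) / (p * q)), ?_, ?_⟩
  · refine ENNReal.rpow_ne_top_of_nonneg (by positivity) (ENNReal.mul_ne_top
      (ENNReal.rpow_ne_top_of_nonneg (by positivity) hMt) (ENNReal.mul_ne_top (by simp) hK))
  intro a b u v w C hab h hC hu hv hw hW
  suffices hs : ∫⁻ x in Ioo a b, w x * essSup (fun y => tail w b y ^ (-(p / (p - q))) *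
      localSup r u v (p / (p - q)) (p * q / (p - q)) y x) (volume.restrict (Ioo a x)) ≤
      K' * C ^ (p * q / (p - q)) by
    calc C₇ a b r p q u v w ≤ (K' * C ^ (p * q / (p - q))) ^ ((p - q) / (p * q)) :=
          ENNReal.rpow_le_rpow hs (by positivity)
      _ = _ := by
          rw [ENNReal.mul_rpow_of_nonneg _ _ (by positivity), ← ENNReal.rpow_mul]
          have : p * q / (p - q) * ((p - q) / (p * q)) = 1 := by field_simp
          rw [this, ENNReal.rpow_one]
  refine lintegral_mul_essSup_le hab hw.1 (g := fun _ y x => tail w b y ^ (-(p / (p - q))) *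
      localSup r u v (p / (p - q)) (p * q / (p - q)) y x) (fun _ _ _ _ _ => le_rfl)
    (fun _ y x₁ x₂ h12 => ?_) (fun y x hy => ?_) fun a₁ ha₁ => ?_
  · gcongr
    exact localSup_mono hr0 hr1 (by positivity) (by positivity) le_rfl h12
  · obtain ⟨a₁, ha₁⟩ := exists_between hy
    exact le_iSup₂_of_le a₁ ha₁ le_rfl
  obtain ⟨x, hx⟩ := exists_grid hw.1 ha₁.2 (hW a₁ ha₁).2.ne
    (fun y hy => (hW y ⟨ha₁.1.trans hy.1, hy.2⟩).1) hM2 hMt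
  have hxm : ∀ k, x k ∈ Ioo a b := fun k => ⟨ha₁.1.trans_le (hx.le k), hx.lt k⟩
  set L : ℝ → ℝ → ℝ≥0∞ := localSup r u v (p / (p - q)) (p * q / (p - q)) with hL
  set W : ℕ → ℝ≥0∞ := fun k => tail w b (x k) with hWd
  have hW0 : ∀ k, W k ≠ 0 := fun k => (hW _ (hxm k)).1.ne'
  have hWt : ∀ k, W k ≠ ∞ := fun k => (hW _ (hxm k)).2.ne
  have hWs : ∀ k, M * W (k + 1) = W k := hx.tail_succ
  refine (hx.lintegral_mul_le_tsum (F := fun k => ∑ j ∈ Finset.range (k + 1),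
    W (j + 1) ^ (-(p / (p - q))) * L (x j) (x (k + 1))) (fun k y hy => ?_) hw.1).trans ?_
  · refine essSup_Ioo_le fun y' hy' => ?_
    obtain ⟨j, hj, hjm⟩ := hx.mem_Ico hy'.1.le (hy'.2.trans hy.2)
    refine le_trans ?_ (Finset.single_le_sum (f := fun j => W (j + 1) ^ (-(p / (p - q))) *
      L (x j) (x (k + 1))) (fun _ _ => zero_le) (Finset.mem_range.2 (Nat.lt_succ_of_le hj)))
    refine mul_le_mul' ?_ (localSup_mono hr0 hr1 (by positivity) (by positivity) hjm.1 hy.2.le)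
    rw [ENNReal.rpow_neg, ENNReal.rpow_neg, ENNReal.inv_le_inv]
    gcongr
    exact tail_antitone w b hjm.2.le
  · calc _ = ∑' k, ∑ j ∈ Finset.range (k + 1),
          W k * (W (j + 1) ^ (-(p / (p - q))) * L (x j) (x (k + 1))) := by
          simp_rw [Finset.mul_sum, hWd]
      _ = ∑' d, ∑' j, W (j + d) * (W (j + 1) ^ (-(p / (p - q))) * L (x j) (x (j + d + 1))) :=
          tsum_sum_range_succ_eq fun j k =>
            W k * (W (j + 1) ^ (-(p / (p - q))) * L (x j) (x (k + 1)))
      _ = ∑' d, M ^ (p / (p - q)) * ((M ^ d)⁻¹ *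
            ∑' j, W j ^ (-(q / (p - q))) * L (x j) (x (j + d + 1))) := by
          refine tsum_congr fun d => ?_
          rw [← ENNReal.tsum_mul_left, ← ENNReal.tsum_mul_left]
          refine tsum_congr fun j => ?_
          have e1 : W (j + d) = (M ^ d)⁻¹ * W j := by
            rw [hWd]; dsimp only
            rw [← hx.tail_add j d, ← mul_assoc, ENNReal.inv_mul_cancel (pow_ne_zero d hM0)
              (ENNReal.pow_ne_top hMt), one_mul]
          have e2 : W (j + 1) ^ (-(p / (p - q))) = M ^ (p / (p - q)) * W j ^ (-(p / (p - q))) := by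
            rw [← hWs j, ENNReal.mul_rpow_of_ne_top hMt (hWt _), ← mul_assoc,
              ← ENNReal.rpow_add _ _ hM0 hMt]
            simp
          have e3 : W j * W j ^ (-(p / (p - q))) = W j ^ (-(q / (p - q))) := by
            nth_rw 1 [← ENNReal.rpow_one (W j)]
            rw [← ENNReal.rpow_add _ _ (hW0 j) (hWt j)]
            congr 1; field_simp; ring
          rw [e1, e2, ← e3]
          ring
      _ ≤ ∑' d : ℕ, M ^ (p / (p - q)) * ((M ^ d)⁻¹ *
            ((d + 1 : ℕ) * (K * C ^ (p * q / (p - q))))) := by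
          refine ENNReal.tsum_le_tsum fun d => ?_
          gcongr
          refine tsum_le_of_residues d.succ_pos fun l _ => ?_
          have hz : StrictMono fun i : ℕ => x (i * (d + 1) + l) :=
            hx.strictMono.comp fun i j hij => by
              have := Nat.mul_lt_mul_of_pos_right hij d.succ_pos
              lia
          refine le_trans (le_of_eq ?_) (hmain h hC hu hv hw hW hz (fun k => hxm _) fun k => ?_)
          · refine tsum_congr fun i => ?_
            have : i * (d + 1) + l + d + 1 = (i + 1) * (d + 1) + l := by ring
            rw [hWd, this]
          · refine le_trans ?_ (hx.tail_succ (k * (d + 1) + l)).le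
            refine mul_le_mul_right (tail_antitone w b (hx.strictMono.monotone ?_)) _
            nlinarith
      _ = M ^ (p / (p - q)) * ((∑' d : ℕ, (M ^ d)⁻¹ * ((d + 1 : ℕ) : ℝ≥0∞)) *
            (K * C ^ (p * q / (p - q)))) := by
          rw [ENNReal.tsum_mul_left, ← ENNReal.tsum_mul_right]
          simp_rw [mul_assoc]
      _ ≤ M ^ (p / (p - q)) * (2 * (K * C ^ (p * q / (p - q)))) := by
          gcongr
          exact tsum_succ_mul_inv_pow_le hM4
      _ = _ := by rw [hK']; ring

end NecessityLocal

section NecessityKernel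

variable {a b p q r : ℝ} {u v w : ℝ → ℝ≥0∞} {C : ℝ≥0∞}

/-- The inner integral entering `C₆`. -/
def innerKernel (p r : ℝ) (v w : ℝ → ℝ≥0∞) (b a y : ℝ) : ℝ≥0∞ :=
  ∫⁻ s in Ioo a y, tail w b s ^ (-(p / (p - r))) * w s * Vr r v s y ^ (p * r / (p - r))

lemma tail_rpow_neg_mono (φ : ℝ → ℝ≥0∞) (b : ℝ) {κ : ℝ} (hκ : 0 ≤ κ) :
    Monotone fun x => tail φ b x ^ (-κ) := fun x y h => by
  dsimp only
  rw [ENNReal.rpow_neg, ENNReal.rpow_neg, ENNReal.inv_le_inv]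
  exact ENNReal.rpow_le_rpow (tail_antitone φ b h) hκ

lemma Vr_self (hr0 : 0 < r) (hr1 : r ≤ 1) (x : ℝ) : Vr r v x x = 0 := by
  unfold Vr
  split_ifs with h
  · simp
  · have : r < 1 := lt_of_le_of_ne hr1 h
    have : 0 < (1 - r) / r := div_pos (by linarith) hr0
    simp [this]

lemma innerKernel_mono (hr0 : 0 < r) (hr1 : r ≤ 1) (hrp : r < p) {c c' y y' : ℝ} (hc : c' ≤ c)
    (hy : y ≤ y') : innerKernel p r v w b c y ≤ innerKernel p r v w b c' y' := by
  have : 0 < p - r := by linarith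
  have : 0 < p := by linarith
  unfold innerKernel
  refine (lintegral_Ioo_mono hc hy _).trans (lintegral_mono fun s => ?_)
  gcongr
  exact Vr_mono hr0 hr1 le_rfl hy

lemma IsGrid.innerKernel_le (hr0 : 0 < r) (hr1 : r ≤ 1) (hrp : r < p) (hw : Measurable w) {c : ℝ}
    {M : ℝ≥0∞} {x : ℕ → ℝ} (h : IsGrid w c b M x) (hM0 : M ≠ 0) (hMt : M ≠ ∞)
    (h0 : ∀ k, tail w b (x k) ≠ 0) (ht : ∀ k, tail w b (x k) ≠ ∞) {z : ℕ → ℝ} {i : ℕ}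
    (hz : ∀ j ≤ i, z j ≤ x j) {y : ℝ} (hy : y ≤ x (i + 1)) :
    innerKernel p r v w b c y ≤ M ^ (p / (p - r)) * ∑ j ∈ Finset.range (i + 1),
      tail w b (x j) ^ (-(r / (p - r))) * Vr r v (z j) y ^ (p * r / (p - r)) := by
  have hpr : 0 < p - r := by linarith
  have hp : 0 < p := by linarith
  unfold innerKernel
  refine (lintegral_Ioo_mono h.zero.le hy _).trans ?_
  rw [← sum_lintegral_Ioo h.strictMono.monotone, Finset.mul_sum]
  refine Finset.sum_le_sum fun j hj => ?_
  have hj : j ≤ i := by simp at hj; lia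
  have e1 : tail w b (x (j + 1)) ^ (-(p / (p - r))) =
      M ^ (p / (p - r)) * tail w b (x j) ^ (-(p / (p - r))) := by
    rw [← h.tail_succ j, ENNReal.mul_rpow_of_ne_top hMt (ht _), ← mul_assoc,
      ← ENNReal.rpow_add _ _ hM0 hMt]
    simp
  have e2 : tail w b (x j) ^ (-(p / (p - r))) * tail w b (x j) =
      tail w b (x j) ^ (-(r / (p - r))) := by
    nth_rw 2 [← ENNReal.rpow_one (tail w b (x j))]
    rw [← ENNReal.rpow_add _ _ (h0 j) (ht j)]
    congr 1; field_simp; ring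
  calc _ ≤ ∫⁻ s in Ioo (x j) (x (j + 1)), tail w b (x (j + 1)) ^ (-(p / (p - r))) *
        Vr r v (z j) y ^ (p * r / (p - r)) * w s := by
        refine setLIntegral_mono' measurableSet_Ioo fun s hs => ?_
        rw [mul_right_comm]
        gcongr ?_ * ?_ ^ _ * _
        · exact tail_rpow_neg_mono w b (by positivity) hs.2.le
        · exact Vr_mono hr0 hr1 ((hz j hj).trans hs.1.le) le_rfl
    _ = tail w b (x (j + 1)) ^ (-(p / (p - r))) * Vr r v (z j) y ^ (p * r / (p - r)) *
        ∫⁻ s in Ioo (x j) (x (j + 1)), w s := lintegral_const_mul _ hw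
    _ ≤ tail w b (x (j + 1)) ^ (-(p / (p - r))) * Vr r v (z j) y ^ (p * r / (p - r)) *
        tail w b (x j) := by
        gcongr
        exact lintegral_Ioo_mono le_rfl (h.lt _).le w
    _ = _ := by rw [e1, ← e2]; ring

lemma sum_mul_Vr_rpow_le (hr0 : 0 < r) (hr1 : r ≤ 1) {ρ : ℝ} (hρ : 0 < ρ) {z : ℕ → ℝ}
    {κ : ℕ → ℝ≥0∞} {n : ℕ} (hz : ∀ i < n, z i ≤ z (i + 1))
    (hκ : ∀ i < n, 2 * 2 ^ (ρ / r) * κ i ≤ κ (i + 1)) :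
    ∑ j ∈ Finset.range n, κ j * Vr r v (z j) (z n) ^ ρ ≤
      2 * 2 ^ (ρ / r) * ∑ j ∈ Finset.range n, κ j * Vr r v (z j) (z (j + 1)) ^ ρ := by
  have hzn : ∀ i ≤ n, z i ≤ z n := fun i hi => by
    induction hi using Nat.decreasingInduction with
    | self => exact le_rfl
    | of_succ k hk ih => exact (hz k hk).trans ih
  refine (sum_geometric_backward (D := fun j => Vr r v (z j) (z (j + 1)) ^ ρ)
    (fun i hi => Vr_rpow_le hr0 hr1 hρ.le (hz i hi) (hzn _ hi)) hκ).trans (le_of_eq ?_)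
  rw [Vr_self hr0 hr1, ENNReal.zero_rpow_of_pos hρ, mul_zero, add_zero]

/-- The local supremum of `H(y)^η ∫_y^x U^{q/(p-q)} u` over a cell. -/
def cellSup (p q r : ℝ) (u v w : ℝ → ℝ≥0∞) (b c : ℝ) (x x' : ℝ) : ℝ≥0∞ :=
  ⨆ y ∈ Ico x x', innerKernel p r v w b c y ^ ((p - r) * q / ((p - q) * r)) *
    ∫⁻ t in Ioo y x', tail u b t ^ (q / (p - q)) * u t

lemma CesCesIneq.exists_tsum_cellSup_le (hr0 : 0 < r) (hr1 : r ≤ 1) (hq : 1 ≤ q) (hqp : q < p)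
    {M : ℝ≥0∞} (hM : 2 * 2 ^ p ≤ M) (hMr : 2 * 2 ^ (p * r / (p - r) / r) ≤ M ^ (r / (p - r)))
    (hMt : M ≠ ∞) :
    ∃ K : ℝ≥0∞, K ≠ ∞ ∧ ∀ {a b : ℝ} {u v w : ℝ → ℝ≥0∞} {C : ℝ≥0∞},
      CesCesIneq a b r p q u v w C → C ≠ ∞ → IsWeight a b u → IsWeight a b v → IsWeight a b w →
      (∀ x ∈ Ioo a b, 0 < tail w b x ∧ tail w b x < ∞) →
      ∀ {c : ℝ}, c ∈ Ioo a b → ∀ {x : ℕ → ℝ}, IsGrid w c b M x →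
      ∑' k, cellSup p q r u v w b c (x k) (x (k + 1)) ≤ K * C ^ (p * q / (p - q)) := by
  obtain ⟨K, hK, hmain⟩ := CesCesIneq.exists_sum_le hr0 hr1 hq hqp
  have hp : 0 < p := by linarith
  have hpr : 0 < p - r := by linarith
  have hpq : 0 < p - q := by linarith
  have hq0 : 0 < q := by linarith
  have hM0 : M ≠ 0 := (lt_of_lt_of_le (by positivity) hM).ne'
  set ρ := p * r / (p - r) with hρ
  have hρ0 : 0 < ρ := by positivity
  set η := (p - r) * q / ((p - q) * r) with hη
  have hη0 : 0 < η := by positivity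
  set K₁ := M ^ (p / (p - r)) * (2 * 2 ^ (ρ / r) * M ^ (r / (p - r))) with hK₁
  have hK₁t : K₁ ≠ ∞ := by
    refine ENNReal.mul_ne_top (ENNReal.rpow_ne_top_of_nonneg (by positivity) hMt)
      (ENNReal.mul_ne_top (ENNReal.mul_ne_top (by simp) ?_)
      (ENNReal.rpow_ne_top_of_nonneg (by positivity) hMt))
    exact ENNReal.rpow_ne_top_of_nonneg (by positivity) (by simp)
  refine ⟨K₁ ^ η * K, ENNReal.mul_ne_top (ENNReal.rpow_ne_top_of_nonneg hη0.le hK₁t) hK, ?_⟩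
  intro a b u v w C h hC hu hv hw hW c hc x hx
  have hxm : ∀ k, x k ∈ Ioo a b := fun k => ⟨hc.1.trans_le (hx.le k), hx.lt k⟩
  have hW0 : ∀ k, tail w b (x k) ≠ 0 := fun k => (hW _ (hxm k)).1.ne'
  have hWt : ∀ k, tail w b (x k) ≠ ∞ := fun k => (hW _ (hxm k)).2.ne
  refine ENNReal.tsum_le_of_sum_range_le fun N => ?_
  refine sum_iSup_le_of_forall (fun i => nonempty_Ico.2 (hx.strictMono i.lt_succ_self))
    fun y hy => ?_
  have hym : ∀ i, y i ∈ Ioo a b := fun i =>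
    ⟨(hxm i).1.trans_le (hy i).1, (hy i).2.trans (hxm _).2⟩
  set t : ℕ → ℝ := fun i => if i < N then y i else b with ht
  set z : ℕ → ℝ := fun i => if i = 0 then c else y (i - 1) with hz
  have hzs : ∀ i, z (i + 1) = y i := fun i => by simp [hz]
  have hz0 : z 0 = c := by simp [hz]
  have hti : ∀ i < N, t i = y i := fun i hi => by simp [ht, hi]
  have htN : t N = b := by simp [ht]
  have hzx : ∀ i, z i ≤ x i := fun i => by
    cases i with
    | zero => rw [hz0, hx.zero]
    | succ i => rw [hzs]; exact (hy i).2.le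
  have hxz : ∀ i, x i ≤ z (i + 1) := fun i => by rw [hzs]; exact (hy i).1
  have hzy : ∀ i, z i ≤ y i := fun i => (hzx i).trans (hy i).1
  have htail : ∀ i, tail w b (z i) ≤ M * tail w b (x i) := fun i => by
    cases i with
    | zero =>
      rw [hz0, hx.zero]
      have : 1 ≤ M := le_trans (le_trans (by norm_num) (four_le_two_mul_two_rpow
        (by linarith : 1 ≤ p))) hM
      exact le_mul_of_one_le_left zero_le this
    | succ i => rw [hx.tail_succ]; exact tail_antitone w b (hxz i)
  have hMm : ∀ i, (M * tail w b (x i)) ^ (-(r / (p - r))) * M ^ (r / (p - r)) =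
      tail w b (x i) ^ (-(r / (p - r))) := fun i => by
    rw [ENNReal.mul_rpow_of_ne_top hMt (hWt i), mul_right_comm, ← ENNReal.rpow_add _ _ hM0 hMt]
    simp
  have hH : ∀ i, innerKernel p r v w b c (y i) ≤ K₁ * ∑ j ∈ Finset.range (i + 1),
      (M * tail w b (x j)) ^ (-(r / (p - r))) * Vr r v (z j) (y j) ^ ρ := fun i => by
    calc _ ≤ M ^ (p / (p - r)) * ∑ j ∈ Finset.range (i + 1),
          tail w b (x j) ^ (-(r / (p - r))) * Vr r v (z j) (z (i + 1)) ^ ρ := by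
          rw [hzs]
          exact hx.innerKernel_le hr0 hr1 (by linarith) hw.1 hM0 hMt hW0 hWt
            (fun j _ => hzx j) (hy i).2.le
      _ ≤ M ^ (p / (p - r)) * (2 * 2 ^ (ρ / r) * ∑ j ∈ Finset.range (i + 1),
          tail w b (x j) ^ (-(r / (p - r))) * Vr r v (z j) (z (j + 1)) ^ ρ) := by
          gcongr
          refine sum_mul_Vr_rpow_le hr0 hr1 hρ0 (fun j _ => (hzs j).symm ▸ hzy j) fun j _ => ?_
          calc _ ≤ M ^ (r / (p - r)) * tail w b (x j) ^ (-(r / (p - r))) := by gcongr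
            _ = _ := by rw [← hx.tail_succ j, mul_comm, hMm (j + 1)]
      _ = _ := by
          simp_rw [hzs, ← hMm, mul_right_comm _ (M ^ (r / (p - r)))]
          rw [← Finset.sum_mul, hK₁]
          ring
  have hzt : ∀ i ≤ N, z i ≤ t i := fun i hi => by
    rcases eq_or_lt_of_le hi with rfl | hlt
    · rw [htN]; exact (hzx _).trans (hxm _).2.le
    · rw [hti i hlt]; exact hzy i
  have hω : ∀ i < N, 2 * 2 ^ p * (M * tail w b (x (i + 1))) ≤ M * tail w b (x i) := fun i _ => by
    rw [hx.tail_succ]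
    exact mul_le_mul_left hM _
  have hV : ∀ i < N, Vr r v (z i) (t i) ≠ ∞ := fun i hi => by
    rw [hti i hi]
    refine h.Vr_ne_top hC hr0 hr1 hq0 hp hu hv hW ?_ (hzy i) (hym i).2
    cases i with
    | zero => rw [hz0]; exact hc.1
    | succ i => rw [hzs]; exact (hym i).1
  have hU : ∀ i < N, tail u b (t i) ≠ ∞ := fun i hi => by
    rw [hti i hi]
    exact h.tail_ne_top hC hr0 hr1 hq0 hp hu hv hW (hym i)
  have hm := hmain h hv.1 hu.1 hw.1 (N := N) (z := z) (t := t)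
    (ω := fun i => M * tail w b (x i)) (hz0 ▸ hc.1.le) hzt
    (fun i hi => by rw [hti i hi, hzs]) htN.le (fun i _ => htail i) hω
    (fun i _ => mul_ne_zero hM0 (hW0 i)) (fun i _ => ENNReal.mul_ne_top hMt (hWt i)) hV hU
  rw [mul_assoc]
  refine le_trans ?_ (mul_le_mul_right hm (K₁ ^ η))
  rw [Finset.mul_sum]
  refine Finset.sum_le_sum fun i hi => ?_
  have hi : i < N := by simpa using hi
  have hxt : x (i + 1) ≤ t (i + 1) := by
    by_cases hlt : i + 1 < N
    · rw [hti _ hlt]; exact (hy _).1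
    · simp only [ht, if_neg hlt]; exact (hxm _).2.le
  have hφ : ∫⁻ s in Ioo (y i) (x (i + 1)), tail u b s ^ (q / (p - q)) * u s ≤
      tail u b (y i) ^ (q / (p - q)) * ∫⁻ s in Ioo (y i) (t (i + 1)), u s := by
    calc _ ≤ ∫⁻ s in Ioo (y i) (x (i + 1)), tail u b (y i) ^ (q / (p - q)) * u s := by
          refine setLIntegral_mono' measurableSet_Ioo fun s hs => ?_
          gcongr
          exact tail_antitone u b hs.1.le
      _ = tail u b (y i) ^ (q / (p - q)) * ∫⁻ s in Ioo (y i) (x (i + 1)), u s :=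
          lintegral_const_mul _ hu.1
      _ ≤ _ := by gcongr
  calc _ ≤ (K₁ * ∑ j ∈ Finset.range (i + 1), (M * tail w b (x j)) ^ (-(r / (p - r))) *
        Vr r v (z j) (y j) ^ ρ) ^ η *
        (tail u b (y i) ^ (q / (p - q)) * ∫⁻ s in Ioo (y i) (t (i + 1)), u s) := by
        gcongr
        exact hH i
    _ = K₁ ^ η * ((∫⁻ s in Ioo (y i) (t (i + 1)), u s) * tail u b (y i) ^ (q / (p - q)) *
        (∑ j ∈ Finset.range (i + 1), (M * tail w b (x j)) ^ (-(r / (p - r))) *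
        Vr r v (z j) (y j) ^ ρ) ^ η) := by
        rw [ENNReal.mul_rpow_of_nonneg _ _ hη0.le]; ring
    _ = _ := by
        rw [hti i hi, htN]
        congr 3
        refine Finset.sum_congr rfl fun j hj => ?_
        rw [hti j (by simp at hj; lia)]

lemma rpow_iSup₂ {ι : Type*} {A : Set ι} (f : ι → ℝ≥0∞) {κ : ℝ} (hκ : 0 < κ) :
    (⨆ i ∈ A, f i) ^ κ = ⨆ i ∈ A, f i ^ κ := by
  exact (ENNReal.orderIsoRpow κ hκ).map_iSup₂ fun i (_ : i ∈ A) => f i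

lemma measurable_tail_rpow_mul (hu : Measurable u) (b κ : ℝ) :
    Measurable fun t => tail u b t ^ κ * u t :=
  ((tail_antitone u b).measurable.pow_const κ).mul hu

lemma inv_tail_mul_innerKernel_le (hr0 : 0 < r) (hr1 : r ≤ 1) (hrp : r < p) (hrq : q < p)
    (hq0 : 0 < q) {c : ℝ} {M : ℝ≥0∞} {x : ℕ → ℝ} (h : IsGrid w c b M x) {j : ℕ} {y : ℝ}
    (hy : y ∈ Ico (x j) (x (j + 1))) {k : ℕ} (hjk : j ≤ k) :
    (tail w b (x j))⁻¹ * (innerKernel p r v w b c y ^ ((p - r) * q / ((p - q) * r)) *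
      ∫⁻ t in Ioo y (x (k + 1)), tail u b t ^ (q / (p - q)) * u t) ≤
      ∑ i ∈ Finset.range (k + 1),
        (tail w b (x i))⁻¹ * cellSup p q r u v w b c (x i) (x (i + 1)) := by
  have hpr : 0 < p - r := by linarith
  have hpq : 0 < p - q := by linarith
  induction k, hjk using Nat.le_induction with
  | base =>
    refine le_trans (mul_le_mul_right ?_ _) (Finset.single_le_sum (f := fun i =>
      (tail w b (x i))⁻¹ * cellSup p q r u v w b c (x i) (x (i + 1))) (fun _ _ => zero_le)
      (Finset.self_mem_range_succ j))
    exact le_iSup₂_of_le y hy le_rfl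
  | succ k hjk ih =>
    have hyk : y ≤ x (k + 1) := hy.2.le.trans (h.strictMono.monotone (by lia))
    rw [← lintegral_Ioo_add hyk (h.strictMono (k + 1).lt_succ_self).le, mul_add, mul_add,
      Finset.sum_range_succ]
    refine add_le_add ih (mul_le_mul' (ENNReal.inv_le_inv.2 (tail_antitone w b
      (h.strictMono.monotone (by lia)))) ?_)
    refine le_iSup₂_of_le (x (k + 1)) ⟨le_rfl, h.strictMono (k + 1).lt_succ_self⟩ ?_
    gcongr
    exact innerKernel_mono hr0 hr1 hrp le_rfl hyk

lemma CesCesIneq.exists_C₆_le (hr0 : 0 < r) (hr1 : r ≤ 1) (hq : 1 ≤ q) (hqp : q < p) :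
    ∃ K : ℝ≥0∞, K ≠ ∞ ∧ ∀ {a b : ℝ} {u v w : ℝ → ℝ≥0∞} {C : ℝ≥0∞}, a < b →
      CesCesIneq a b r p q u v w C → C ≠ ∞ → IsWeight a b u → IsWeight a b v → IsWeight a b w →
      (∀ x ∈ Ioo a b, 0 < tail w b x ∧ tail w b x < ∞) →
      C₆ a b r p q u v w ≤ K * C := by
  have hp : 0 < p := by linarith
  have hpr : 0 < p - r := by linarith
  have hpq : 0 < p - q := by linarith
  have hq0 : 0 < q := by linarith
  have hone : ∀ {κ : ℝ}, 0 < κ → (1 : ℝ≥0∞) ≤ 2 ^ κ := fun hκ =>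
    ENNReal.one_le_rpow (by norm_num) hκ
  set L : ℝ≥0∞ := 2 * 2 ^ (p * r / (p - r) / r) with hL
  have hL1 : 1 ≤ L := one_le_mul (by norm_num) (hone (by positivity))
  have hLt : L ≠ ∞ := ENNReal.mul_ne_top (by simp)
    (ENNReal.rpow_ne_top_of_nonneg (by positivity) (by simp))
  set M : ℝ≥0∞ := 2 * 2 ^ p * L ^ ((p - r) / r) with hM
  have hMp : 2 * 2 ^ p ≤ M :=
    le_mul_of_one_le_right zero_le (ENNReal.one_le_rpow hL1 (by positivity))
  have hM4 : 4 ≤ M := (four_le_two_mul_two_rpow (by linarith)).trans hMp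
  have hM2 : 2 ≤ M := le_trans (by norm_num) hM4
  have hM0 : M ≠ 0 := (lt_of_lt_of_le (by norm_num) hM4).ne'
  have hMt : M ≠ ∞ := ENNReal.mul_ne_top (ENNReal.mul_ne_top (by simp)
    (ENNReal.rpow_ne_top_of_nonneg hp.le (by simp))) (ENNReal.rpow_ne_top_of_nonneg
      (by positivity) hLt)
  have hMr : L ≤ M ^ (r / (p - r)) := by
    calc L = (L ^ ((p - r) / r)) ^ (r / (p - r)) := by
          rw [← ENNReal.rpow_mul]
          have : (p - r) / r * (r / (p - r)) = 1 := by field_simp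
          rw [this, ENNReal.rpow_one]
      _ ≤ _ := by
          gcongr
          exact le_mul_of_one_le_left zero_le (one_le_mul (by norm_num) (hone hp))
  obtain ⟨K, hK, hmain⟩ := CesCesIneq.exists_tsum_cellSup_le hr0 hr1 hq hqp hMp hMr hMt
  set K' := M * (2 * K) with hK'
  refine ⟨K' ^ ((p - q) / (p * q)), ?_, ?_⟩
  · exact ENNReal.rpow_ne_top_of_nonneg (by positivity) (ENNReal.mul_ne_top hMt
      (ENNReal.mul_ne_top (by simp) hK))
  intro a b u v w C hab h hC hu hv hw hW
  set η := (p - r) * q / ((p - q) * r) with hη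
  have hη0 : 0 < η := by positivity
  set φ : ℝ → ℝ≥0∞ := fun t => tail u b t ^ (q / (p - q)) * u t with hφ
  have hφm : Measurable φ := measurable_tail_rpow_mul hu.1 b _
  suffices hs : ∫⁻ x in Ioo a b, w x * essSup (fun y => (tail w b y)⁻¹ *
      ∫⁻ t in Ioo y x, φ t * innerKernel p r v w b a y ^ η) (volume.restrict (Ioo a x)) ≤
      K' * C ^ (p * q / (p - q)) by
    calc C₆ a b r p q u v w ≤ (K' * C ^ (p * q / (p - q))) ^ ((p - q) / (p * q)) :=
          ENNReal.rpow_le_rpow hs (by positivity)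
      _ = _ := by
          rw [ENNReal.mul_rpow_of_nonneg _ _ (by positivity), ← ENNReal.rpow_mul]
          have : p * q / (p - q) * ((p - q) / (p * q)) = 1 := by field_simp
          rw [this, ENNReal.rpow_one]
  simp_rw [lintegral_mul_const _ hφm]
  refine lintegral_mul_essSup_le hab hw.1 (g := fun a₁ y x => (tail w b y)⁻¹ *
      ((∫⁻ t in Ioo y x, φ t) * innerKernel p r v w b a₁ y ^ η)) (fun a₁ a₂ y x h12 => ?_)
    (fun _ y x₁ x₂ h12 => ?_) (fun y x hy => ?_) fun c hc => ?_
  · gcongr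
    exact innerKernel_mono hr0 hr1 (by linarith) h12 le_rfl
  · gcongr
  · have h1 : innerKernel p r v w b a y ≤ ⨆ a₁ ∈ Ioo a y, innerKernel p r v w b a₁ y :=
      lintegral_Ioo_le_of_forall fun a₁ ha₁ => le_iSup₂_of_le a₁ ha₁ le_rfl
    calc _ ≤ (tail w b y)⁻¹ * ((∫⁻ t in Ioo y x, φ t) *
          (⨆ a₁ ∈ Ioo a y, innerKernel p r v w b a₁ y) ^ η) := by gcongr
      _ = _ := by
          rw [rpow_iSup₂ _ hη0]
          simp_rw [ENNReal.mul_iSup]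
  obtain ⟨x, hx⟩ := exists_grid hw.1 hc.2 (hW c hc).2.ne
    (fun y hy => (hW y ⟨hc.1.trans hy.1, hy.2⟩).1) hM2 hMt
  have hxm : ∀ k, x k ∈ Ioo a b := fun k => ⟨hc.1.trans_le (hx.le k), hx.lt k⟩
  set W : ℕ → ℝ≥0∞ := fun k => tail w b (x k) with hWd
  have hW0 : ∀ k, W k ≠ 0 := fun k => (hW _ (hxm k)).1.ne'
  have hWt : ∀ k, W k ≠ ∞ := fun k => (hW _ (hxm k)).2.ne
  have hWs : ∀ k, M * W (k + 1) = W k := hx.tail_succ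
  set T : ℕ → ℝ≥0∞ := fun k => cellSup p q r u v w b c (x k) (x (k + 1)) with hT
  refine (hx.lintegral_mul_le_tsum (F := fun k => M * ∑ j ∈ Finset.range (k + 1),
    (W j)⁻¹ * T j) (fun k y hy => ?_) hw.1).trans ?_
  · refine essSup_Ioo_le fun y' hy' => ?_
    obtain ⟨j, hj, hjm⟩ := hx.mem_Ico hy'.1.le (hy'.2.trans hy.2)
    have h1 : (tail w b y')⁻¹ ≤ M * (W j)⁻¹ := by
      rw [← hWs j, ENNReal.mul_inv (Or.inl hM0) (Or.inl hMt), ← mul_assoc,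
        ENNReal.mul_inv_cancel hM0 hMt, one_mul, ENNReal.inv_le_inv]
      exact tail_antitone w b hjm.2.le
    calc _ ≤ M * (W j)⁻¹ * (innerKernel p r v w b c y' ^ η * ∫⁻ t in Ioo y' (x (k + 1)), φ t) := by
          rw [mul_comm (innerKernel p r v w b c y' ^ η)]
          gcongr
          exact hy.2.le
      _ ≤ _ := by
          rw [mul_assoc]
          exact mul_le_mul_right (inv_tail_mul_innerKernel_le hr0 hr1 (by linarith) hqp hq0 hx
            hjm hj) M
  · calc _ = ∑' k, ∑ j ∈ Finset.range (k + 1), M * (W k * ((W j)⁻¹ * T j)) := by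
          simp_rw [← Finset.mul_sum, mul_left_comm M]
          rfl
      _ = ∑' d, ∑' j, M * (W (j + d) * ((W j)⁻¹ * T j)) :=
          tsum_sum_range_succ_eq fun j k => M * (W k * ((W j)⁻¹ * T j))
      _ = ∑' d : ℕ, M * ((M ^ d)⁻¹ * ∑' j, T j) := by
          refine tsum_congr fun d => ?_
          rw [← ENNReal.tsum_mul_left, ← ENNReal.tsum_mul_left]
          refine tsum_congr fun j => ?_
          have e1 : W (j + d) = (M ^ d)⁻¹ * W j := by
            simp only [hWd]
            rw [← hx.tail_add j d, ← mul_assoc, ENNReal.inv_mul_cancel (pow_ne_zero d hM0)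
              (ENNReal.pow_ne_top hMt), one_mul]
          have e2 : (M ^ d)⁻¹ * W j * ((W j)⁻¹ * T j) = (M ^ d)⁻¹ * T j := by
            rw [mul_assoc, ← mul_assoc (W j), ENNReal.mul_inv_cancel (hW0 j) (hWt j), one_mul]
          rw [e1, e2]
      _ = M * ((∑' d : ℕ, (M ^ d)⁻¹) * ∑' j, T j) := by
          rw [ENNReal.tsum_mul_left, ENNReal.tsum_mul_right]
      _ ≤ M * (2 * (K * C ^ (p * q / (p - q)))) := by
          gcongr
          · refine le_trans (ENNReal.tsum_le_tsum fun d => ?_) (tsum_succ_mul_inv_pow_le hM4)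
            exact le_mul_of_one_le_right zero_le (by simp)
          · exact hmain h hC hu hv hw hW hc hx
      _ = _ := by rw [hK']; ring

end NecessityKernel

section Sufficiency

variable {a b p q r : ℝ} {u v w : ℝ → ℝ≥0∞}

lemma exists_tail_le_two_mul {φ : ℝ → ℝ≥0∞} (hφ : Measurable φ)
    (h : ∀ x ∈ Ioo a b, 0 < tail φ b x ∧ tail φ b x < ∞) {x : ℝ} (hx : x ∈ Ioo a b) :
    ∃ y ∈ Ioo a x, tail φ b y ≤ 2 * tail φ b x := by
  obtain ⟨c, hac, hcx⟩ := exists_between hx.1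
  rcases le_total (tail φ b c) (2 * tail φ b x) with hle | hle
  · exact ⟨c, ⟨hac, hcx⟩, hle⟩
  obtain ⟨hx0, hxt⟩ := h x hx
  obtain ⟨y, hy, hyt⟩ := exists_tail_eq hφ (hcx.trans hx.2) (h c ⟨hac, hcx.trans hx.2⟩).2.ne
    (l := 2 * tail φ b x) (by simpa using hx0) hle
  refine ⟨y, ⟨hac.trans_le hy.1, ?_⟩, hyt.le⟩
  by_contra! hxy
  have h1 : 2 * tail φ b x ≤ 1 * tail φ b x := by
    rw [← hyt, one_mul]; exact tail_antitone φ b hxy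
  rw [ENNReal.mul_le_mul_iff_left hx0.ne' hxt.ne] at h1
  norm_num at h1

lemma exists_tail_le_two_mul_right {φ : ℝ → ℝ≥0∞} (hφ : Measurable φ) {t : ℝ} (htb : t < b)
    (h0 : 0 < tail φ b t) (hfin : tail φ b t ≠ ∞) :
    ∃ y ∈ Ioo t b, tail φ b t ≤ 2 * tail φ b y := by
  obtain ⟨y, hy, hyt⟩ := exists_tail_eq hφ htb hfin (l := tail φ b t / 2)
    (ENNReal.half_pos h0.ne') ENNReal.half_le_self
  refine ⟨y, ⟨lt_of_le_of_ne hy.1 ?_, hy.2⟩, ?_⟩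
  · rintro rfl
    exact (ENNReal.half_lt_self h0.ne' hfin).ne' hyt
  · rw [hyt, ENNReal.mul_div_cancel (by simp) (by simp)]

lemma rpow_mul_Vr_le_C₁ (hr0 : 0 < r) (hr1 : r ≤ 1) (hq : 0 < q) (hp : 0 < p) {x₁ x₂ t₁ t₂ : ℝ}
    (hx₁ : a ≤ x₁) (hx : x₁ < x₂) (hxt : x₂ ≤ t₁) (ht : t₁ < t₂) (ht₂ : t₂ ≤ b) :
    tail w b x₁ ^ (-(1 / p)) * (tail u b t₂ ^ (1 / q) * Vr r v x₂ t₁) ≤ C₁ a b r p q u v w := by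
  refine le_essSup_Ioo hx hx₁ ((hxt.trans ht.le).trans ht₂) fun x hxm => ?_
  refine mul_le_mul' (tail_rpow_neg_mono w b (by positivity) hxm.1.le)
    (le_essSup_Ioo ht (hxm.2.le.trans hxt) ht₂ fun t htm => ?_)
  refine mul_le_mul' ?_ (Vr_mono hr0 hr1 hxm.2.le htm.1.le)
  exact ENNReal.rpow_le_rpow (tail_antitone u b htm.2.le) (by positivity)

lemma tail_ne_top_of_C₁ (hr0 : 0 < r) (hr1 : r ≤ 1) (hq : 0 < q) (hp : 0 < p)
    (hv : IsWeight a b v) (hW : ∀ x ∈ Ioo a b, 0 < tail w b x ∧ tail w b x < ∞)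
    (hC : C₁ a b r p q u v w ≠ ∞) {t : ℝ} (ht : t ∈ Ioo a b) : tail u b t ≠ ∞ := by
  obtain ⟨t₁, h1, ht₁⟩ := exists_between ht.1
  obtain ⟨x₂, h2, hx₂⟩ := exists_between h1
  obtain ⟨x₁, h3, hx₁⟩ := exists_between h2
  have h := rpow_mul_Vr_le_C₁ (u := u) (v := v) (w := w) hr0 hr1 hq hp h3.le hx₁ hx₂.le ht₁ ht.2.le
  intro htop
  refine hC (top_le_iff.1 (le_trans (le_of_eq ?_) h))
  have hW' := hW x₁ ⟨h3, hx₁.trans (hx₂.trans (ht₁.trans ht.2))⟩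
  rw [htop, ENNReal.top_rpow_of_pos (by positivity), ENNReal.top_mul
    (Vr_pos hr0 hr1 hv h2.le hx₂ (ht₁.trans ht.2).le).ne', ENNReal.mul_top]
  rw [ENNReal.rpow_neg]
  exact ENNReal.inv_ne_zero.2 (ENNReal.rpow_ne_top_of_nonneg (by positivity) hW'.2.ne)

lemma Vr_rpow_mul_tail_le_C₁ (hr0 : 0 < r) (hr1 : r ≤ 1) (hq : 1 ≤ q) (hp : 1 ≤ p)
    (hu : IsWeight a b u) (hv : IsWeight a b v) (hw : Measurable w)
    (hW : ∀ x ∈ Ioo a b, 0 < tail w b x ∧ tail w b x < ∞)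
    (hC : C₁ a b r p q u v w ≠ ∞) {x t : ℝ} (hx : a < x) (hxt : x ≤ t) (ht : t < b) :
    Vr r v x t ^ q * tail u b t ≤ (4 * C₁ a b r p q u v w) ^ q * tail w b x ^ (q / p) := by
  have hq0 : 0 < q := by linarith
  have hp0 : 0 < p := by linarith
  have hxm : x ∈ Ioo a b := ⟨hx, hxt.trans_lt ht⟩
  obtain ⟨x₁, hx₁, hWx⟩ := exists_tail_le_two_mul hw hW hxm
  obtain ⟨t₂, ht₂, hUt⟩ := exists_tail_le_two_mul_right hu.1 ht
    (hu.lintegral_pos (hx.trans_le hxt).le ht le_rfl)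
    (tail_ne_top_of_C₁ hr0 hr1 hq0 hp0 hv hW hC ⟨hx.trans_le hxt, ht⟩)
  have h := rpow_mul_Vr_le_C₁ (u := u) (v := v) (w := w) hr0 hr1 hq0 hp0 hx₁.1.le hx₁.2 hxt
    ht₂.1 ht₂.2.le
  have hW₁ := hW x₁ ⟨hx₁.1, hx₁.2.trans hxm.2⟩
  have hle2 : ∀ {κ : ℝ}, 1 ≤ κ → (2 : ℝ≥0∞) ^ (1 / κ) ≤ 2 := fun {κ} hκ => by
    calc (2 : ℝ≥0∞) ^ (1 / κ) ≤ 2 ^ (1 : ℝ) :=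
          ENNReal.rpow_le_rpow_of_exponent_le (by norm_num)
            (by rw [div_le_iff₀ (by linarith)]; linarith)
      _ = 2 := by simp
  have key : tail u b t ^ (1 / q) * Vr r v x t ≤
      4 * C₁ a b r p q u v w * tail w b x ^ (1 / p) := by
    calc _ ≤ (2 * tail u b t₂) ^ (1 / q) * Vr r v x t := by gcongr
      _ = 2 ^ (1 / q) * (tail u b t₂ ^ (1 / q) * Vr r v x t) := by
          rw [ENNReal.mul_rpow_of_nonneg _ _ (by positivity), mul_assoc]
      _ = 2 ^ (1 / q) * (tail w b x₁ ^ (1 / p) * (tail w b x₁ ^ (-(1 / p)) *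
          (tail u b t₂ ^ (1 / q) * Vr r v x t))) := by
          rw [← mul_assoc (tail w b x₁ ^ (1 / p)), ← ENNReal.rpow_add _ _ hW₁.1.ne' hW₁.2.ne]
          simp
      _ ≤ 2 * ((2 * tail w b x) ^ (1 / p) * C₁ a b r p q u v w) := by
          gcongr
          exact hle2 hq
      _ ≤ 2 * (2 * tail w b x ^ (1 / p) * C₁ a b r p q u v w) := by
          rw [ENNReal.mul_rpow_of_nonneg _ _ (by positivity)]
          gcongr
          exact hle2 hp
      _ = _ := by ring
  calc _ = (tail u b t ^ (1 / q) * Vr r v x t) ^ q := by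
        rw [ENNReal.mul_rpow_of_nonneg _ _ hq0.le, ← ENNReal.rpow_mul, one_div_mul_cancel hq0.ne',
          ENNReal.rpow_one, mul_comm]
    _ ≤ _ := ENNReal.rpow_le_rpow key hq0.le
    _ = _ := by
        rw [ENNReal.mul_rpow_of_nonneg _ _ hq0.le, ← ENNReal.rpow_mul (tail w b x)]
        congr 2; field_simp

lemma IsGrid.lintegral_Ioo_eq {c : ℝ} {x : ℕ → ℝ} (h : IsGrid w c b 2 x)
    (ht : ∀ k, tail w b (x k) ≠ ∞) (k : ℕ) :
    ∫⁻ s in Ioo (x k) (x (k + 1)), w s = tail w b (x (k + 1)) := by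
  have h1 := lintegral_Ioo_add (h.strictMono k.lt_succ_self).le (h.lt (k + 1)).le w
  have h2 := h.tail_succ k
  rw [two_mul] at h2
  exact (ENNReal.add_left_inj (ht (k + 1))).1 (h1.trans h2.symm)

lemma IsGrid.tsum_mul_le_lintegral {c : ℝ} {x : ℕ → ℝ} (h : IsGrid w c b 2 x)
    (ht : ∀ k, tail w b (x k) ≠ ∞) (hw : Measurable w) (hac : a ≤ c) {E : ℝ → ℝ≥0∞}
    {F : ℕ → ℝ≥0∞} (hF : ∀ k, ∀ y ∈ Ioo (x (k + 1)) (x (k + 2)), F k ≤ E y) :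
    ∑' k, tail w b (x k) * F k ≤ 4 * ∫⁻ y in Ioo a b, w y * E y := by
  have hm : Monotone fun k => x (k + 1) := fun i j hij => h.strictMono.monotone (by lia)
  calc _ = ∑' k, 4 * ((∫⁻ y in Ioo (x (k + 1)) (x (k + 2)), w y) * F k) := by
        refine tsum_congr fun k => ?_
        rw [h.lintegral_Ioo_eq ht, ← h.tail_succ k, ← h.tail_succ (k + 1)]
        ring
    _ ≤ ∑' k, 4 * ∫⁻ y in Ioo (x (k + 1)) (x (k + 2)), w y * E y := by
        refine ENNReal.tsum_le_tsum fun k => mul_le_mul_right ?_ _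
        rw [← lintegral_mul_const _ hw]
        exact setLIntegral_mono' measurableSet_Ioo fun y hy => mul_le_mul_right (hF k y hy) _
    _ = 4 * ∫⁻ y in Ioo (x 1) b, w y * E y := by
        rw [ENNReal.tsum_mul_left, tsum_lintegral_Ioo hm (fun k => h.lt _) fun t ht => ?_]
        obtain ⟨k, hk⟩ := h.cover t ht
        exact ⟨k, hk.trans (h.strictMono k.lt_succ_self)⟩
    _ ≤ _ := by
        gcongr
        exact hac.trans (h.le 1)

lemma tsum_rpow_mul_rpow_le (f g : ℕ → ℝ≥0∞) {κ μ : ℝ} (hκ : 0 ≤ κ) (hμ : 0 ≤ μ)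
    (h : κ + μ = 1) :
    ∑' i, f i ^ κ * g i ^ μ ≤ (∑' i, f i) ^ κ * (∑' i, g i) ^ μ := by
  have := ENNReal.lintegral_mul_norm_pow_le (μ := Measure.count) (f := f) (g := g)
    (measurable_of_countable f).aemeasurable (measurable_of_countable g).aemeasurable hκ hμ h
  simpa [lintegral_count] using this

lemma IsGrid.lintegral_rpow_mul_le {c : ℝ} {M : ℝ≥0∞} {t : ℕ → ℝ} (h : IsGrid u c b M t)
    (hu : Measurable u) {κ : ℝ} (hκ : 0 < κ) (hM : 2 * 2 ^ κ ≤ M) {G : ℝ → ℝ≥0∞}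
    (hG : Monotone G) (h0 : G c = 0) {δ : ℕ → ℝ≥0∞} (hδ : ∀ m, G (t (m + 1)) ≤ G (t m) + δ m) :
    ∫⁻ s in Ioo c b, u s * G s ^ κ ≤ 2 * 2 ^ κ * ∑' m, tail u b (t m) * δ m ^ κ := by
  refine (h.lintegral_mul_le_tsum (F := fun m => G (t (m + 1)) ^ κ)
    (fun k y hy => ENNReal.rpow_le_rpow (hG hy.2.le) hκ.le) hu).trans ?_
  refine ENNReal.tsum_le_of_sum_range_le fun n => ?_
  refine le_trans (le_self_add.trans (sum_geometric_forward (K := 2 ^ κ)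
    (g := fun m => G (t m) ^ κ) (d := fun m => δ m ^ κ) ?_ (fun i _ => ?_) fun i _ => ?_)) ?_
  · simp only [h.zero, h0]
    exact ENNReal.zero_rpow_of_pos hκ
  · exact (ENNReal.rpow_le_rpow (hδ i) hκ.le).trans (add_rpow_le_two_rpow_mul hκ.le _ _)
  · rw [← h.tail_succ i]
    exact mul_le_mul_left hM _
  · exact mul_le_mul_right (ENNReal.sum_le_tsum _) _

lemma exists_lintegral_rpow_mul_le (hr0 : 0 < r) (hr1 : r ≤ 1) (hq : 1 ≤ q) :
    ∃ K : ℝ≥0∞, K ≠ ∞ ∧ ∀ {c d : ℝ} {u v f : ℝ → ℝ≥0∞} {B : ℝ≥0∞}, c < d →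
      Measurable u → Measurable v → Measurable f → tail u d c ≠ ∞ →
      (∀ x ∈ Ioo c d, 0 < tail u d x) →
      (∀ t₁ t₂, c < t₁ → t₁ < t₂ → t₂ < d → Vr r v c t₁ ^ q * tail u d t₂ ≤ B) →
      ∫⁻ t in Ioo c d, u t * (∫⁻ s in Ioo c t, f s ^ r * v s) ^ (q / r) ≤
        K * (B * (∫⁻ s in Ioo c d, f s) ^ q) := by
  have hq0 : 0 < q := by linarith
  have hQ : 0 < q / r := by positivity
  set M : ℝ≥0∞ := 2 * 2 ^ (q / r) with hM
  have hM4 : 4 ≤ M := four_le_two_mul_two_rpow (by rw [le_div_iff₀ hr0]; linarith)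
  have hM2 : 2 ≤ M := le_trans (by norm_num) hM4
  have hMt : M ≠ ∞ := ENNReal.mul_ne_top (by simp)
    (ENNReal.rpow_ne_top_of_nonneg hQ.le (by simp))
  refine ⟨M * (M * M), ENNReal.mul_ne_top hMt (ENNReal.mul_ne_top hMt hMt), ?_⟩
  intro c d u v f B hcd hu hv hf hfin hpos hB
  obtain ⟨t, ht⟩ := exists_grid hu hcd hfin hpos hM2 hMt
  have hct : ∀ m, c < t (m + 1) := fun m => ht.zero ▸ ht.strictMono m.succ_pos
  refine (ht.lintegral_rpow_mul_le hu hQ le_rfl (monotone_lintegral_Ioo _ c)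
    (lintegral_Ioo_self _ _) (δ := fun m => ∫⁻ s in Ioo (t m) (t (m + 1)), f s ^ r * v s)
    fun m => ?_).trans ?_
  · rw [lintegral_Ioo_add (ht.le m) (ht.strictMono m.lt_succ_self).le]
  rw [mul_assoc M]
  refine mul_le_mul_right ?_ M
  calc _ ≤ ∑' m, M * M * B * (∫⁻ s in Ioo (t m) (t (m + 1)), f s) ^ q := by
        refine ENNReal.tsum_le_tsum fun m => ?_
        calc _ ≤ M * (M * tail u d (t (m + 1 + 1))) *
              (Vr r v c (t (m + 1)) ^ r * (∫⁻ s in Ioo (t m) (t (m + 1)), f s) ^ r) ^ (q / r) := by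
              rw [ht.tail_succ (m + 1), ht.tail_succ m]
              gcongr
              refine (lintegral_rpow_mul_le hr0 hr1 hv hf _ _).trans ?_
              gcongr
              exact Vr_mono hr0 hr1 (ht.le m) le_rfl
          _ = M * M * (Vr r v c (t (m + 1)) ^ q * tail u d (t (m + 1 + 1))) *
              (∫⁻ s in Ioo (t m) (t (m + 1)), f s) ^ q := by
              rw [ENNReal.mul_rpow_of_nonneg _ _ hQ.le, ← ENNReal.rpow_mul, ← ENNReal.rpow_mul,
                mul_div_cancel₀ _ hr0.ne']
              ring
          _ ≤ _ := by
              gcongr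
              exact hB _ _ (hct m) (ht.strictMono (m + 1).lt_succ_self) (ht.lt _)
    _ = M * M * (B * ∑' m, (∫⁻ s in Ioo (t m) (t (m + 1)), f s) ^ q) := by
        rw [ENNReal.tsum_mul_left, mul_assoc _ B]
    _ ≤ _ := by
        gcongr
        refine ENNReal.tsum_le_of_sum_range_le fun n => (sum_rpow_le_rpow_sum _ _ hq).trans ?_
        rw [sum_lintegral_Ioo ht.strictMono.monotone]
        gcongr
        · exact ht.zero.ge
        · exact (ht.lt n).le

/-- The supremum controlling the inequality localized to `(c, d)`. -/
def cellConst (q r : ℝ) (u v : ℝ → ℝ≥0∞) (c d : ℝ) : ℝ≥0∞ :=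
  ⨆ (t₁ : ℝ) (t₂ : ℝ) (_ : c < t₁ ∧ t₁ < t₂ ∧ t₂ < d), Vr r v c t₁ ^ q * tail u d t₂

lemma cellConst_rpow_le_localSup (hr0 : 0 < r) (hr1 : r ≤ 1) (hq : 0 ≤ q) {α : ℝ} (hα : 0 < α)
    {y x c d : ℝ} (hy : y ≤ c) (hx : d ≤ x) :
    cellConst q r u v c d ^ α ≤ localSup r u v α (q * α) y x := by
  refine (ENNReal.le_rpow_inv_iff hα).1 (iSup_le fun t₁ => iSup_le fun t₂ => iSup_le fun ht =>
    (ENNReal.le_rpow_inv_iff hα).2 ?_)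
  refine le_essSup_Ioo ht.2.1 (hy.trans ht.1.le) (ht.2.2.le.trans hx) fun t htm => ?_
  rw [ENNReal.mul_rpow_of_nonneg _ _ hα.le, ← ENNReal.rpow_mul, mul_comm]
  gcongr
  · exact lintegral_Ioo_mono htm.2.le hx u
  · exact Vr_mono hr0 hr1 hy htm.1.le

lemma IsGrid.tsum_cellConst_le (hr0 : 0 < r) (hr1 : r ≤ 1) (hq : 1 ≤ q) (hqp : q < p) {c : ℝ}
    {x : ℕ → ℝ} (h : IsGrid w c b 2 x) (hc : c ∈ Ioo a b) (hw : Measurable w)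
    (hW : ∀ x ∈ Ioo a b, 0 < tail w b x ∧ tail w b x < ∞) :
    ∑' k, tail w b (x k) ^ (-(q / (p - q))) *
      cellConst q r u v (x k) (x (k + 1)) ^ (p / (p - q)) ≤
      4 * 2 ^ (p / (p - q)) * C₇ a b r p q u v w ^ (p * q / (p - q)) := by
  have hp : 0 < p := by linarith
  have hpq : 0 < p - q := by linarith
  have hq0 : 0 < q := by linarith
  have hxm : ∀ k, x k ∈ Ioo a b := fun k => ⟨hc.1.trans_le (h.le k), h.lt k⟩
  set W : ℕ → ℝ≥0∞ := fun k => tail w b (x k) with hWd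
  have hW0 : ∀ k, W k ≠ 0 := fun k => (hW _ (hxm k)).1.ne'
  have hWt : ∀ k, W k ≠ ∞ := fun k => (hW _ (hxm k)).2.ne
  set α := p / (p - q) with hα
  have hα0 : 0 < α := by positivity
  have hs : p * q / (p - q) = q * α := by rw [hα]; ring
  set E : ℝ → ℝ≥0∞ := fun x => essSup (fun y => tail w b y ^ (-α) *
    localSup r u v α (q * α) y x) (volume.restrict (Ioo a x)) with hE
  have hC : C₇ a b r p q u v w ^ (p * q / (p - q)) = ∫⁻ x in Ioo a b, w x * E x := by
    have : C₇ a b r p q u v w = (∫⁻ x in Ioo a b, w x * E x) ^ ((p - q) / (p * q)) := by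
      rw [hE, ← hs]; rfl
    rw [this, ← ENNReal.rpow_mul]
    have : (p - q) / (p * q) * (p * q / (p - q)) = 1 := by field_simp
    rw [this, ENNReal.rpow_one]
  calc _ = 2 ^ α * ∑' k, W k * ((2 * W k) ^ (-α) *
        cellConst q r u v (x k) (x (k + 1)) ^ α) := by
        rw [← ENNReal.tsum_mul_left]
        refine tsum_congr fun k => ?_
        have e1 : (2 : ℝ≥0∞) ^ α * 2 ^ (-α) = 1 := by
          rw [← ENNReal.rpow_add _ _ (by simp) (by simp)]; simp
        have e2 : W k * W k ^ (-α) = W k ^ (-(q / (p - q))) := by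
          nth_rw 1 [← ENNReal.rpow_one (W k)]
          rw [← ENNReal.rpow_add _ _ (hW0 k) (hWt k)]
          congr 1; rw [hα]; field_simp; ring
        rw [ENNReal.mul_rpow_of_ne_top (by simp) (hWt k), ← e2]
        calc _ = (2 ^ α * 2 ^ (-α)) * (W k * W k ^ (-α) *
              cellConst q r u v (x k) (x (k + 1)) ^ α) := by rw [e1, one_mul]
          _ = _ := by ring
    _ ≤ 2 ^ α * (4 * ∫⁻ x in Ioo a b, w x * E x) := by
        gcongr
        refine h.tsum_mul_le_lintegral hWt hw hc.1.le fun k y hy => ?_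
        obtain ⟨y₁, hy₁, hWy⟩ := exists_tail_le_two_mul hw hW (hxm k)
        have hxy : x k ≤ y := (h.strictMono k.lt_succ_self).le.trans hy.1.le
        refine le_essSup_Ioo hy₁.2 hy₁.1.le hxy fun z hz => mul_le_mul' ?_ ?_
        · rw [ENNReal.rpow_neg, ENNReal.rpow_neg, ENNReal.inv_le_inv]
          exact ENNReal.rpow_le_rpow ((tail_antitone w b hz.1.le).trans hWy) hα0.le
        · exact cellConst_rpow_le_localSup hr0 hr1 hq0.le hα0 hz.2.le hy.1.le
    _ = _ := by rw [hC]; ring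

end Sufficiency

section StepSum

/-- The step function with jumps `h j` at the points `y j`. -/
def stepSum (y : ℕ → ℝ) (h : ℕ → ℝ≥0∞) (t : ℝ) : ℝ≥0∞ := ∑' j, if y j ≤ t then h j else 0

/-- The increment of `stepSum y h` between two points. -/
def stepInc (y : ℕ → ℝ) (h : ℕ → ℝ≥0∞) (t t' : ℝ) : ℝ≥0∞ :=
  ∑' j, if t < y j ∧ y j ≤ t' then h j else 0

variable {y : ℕ → ℝ} {t t' : ℝ}

lemma stepSum_add_stepInc (h : ℕ → ℝ≥0∞) (ht : t ≤ t') :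
    stepSum y h t + stepInc y h t t' = stepSum y h t' := by
  unfold stepSum stepInc
  rw [← ENNReal.tsum_add]
  refine tsum_congr fun j => ?_
  by_cases h1 : y j ≤ t
  · simp [h1, h1.trans ht, h1.not_gt]
  · simp [h1, not_le.1 h1]

lemma stepInc_le_stepSum (h : ℕ → ℝ≥0∞) (ht : t ≤ t') : stepInc y h t t' ≤ stepSum y h t' :=
  stepSum_add_stepInc (y := y) h ht ▸ le_add_self

lemma monotone_stepSum (y : ℕ → ℝ) (h : ℕ → ℝ≥0∞) : Monotone (stepSum y h) := fun _ _ ht =>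
  stepSum_add_stepInc (y := y) h ht ▸ le_self_add

lemma stepSum_le_tsum (h : ℕ → ℝ≥0∞) : stepSum y h t ≤ ∑' j, h j :=
  ENNReal.tsum_le_tsum fun j => by split_ifs <;> simp

lemma stepSum_eq_zero (h : ℕ → ℝ≥0∞) (ht : ∀ j, t < y j) : stepSum y h t = 0 := by
  simp [stepSum, ht]

lemma tsum_stepInc_le (h : ℕ → ℝ≥0∞) {z : ℕ → ℝ} (hz : Monotone z) :
    ∑' m, stepInc y h (z m) (z (m + 1)) ≤ ∑' j, h j := by
  refine ENNReal.tsum_le_of_sum_range_le fun n => ?_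
  have : stepSum y h (z 0) + ∑ m ∈ Finset.range n, stepInc y h (z m) (z (m + 1)) =
      stepSum y h (z n) := by
    induction n with
    | zero => simp
    | succ n ih => rw [Finset.sum_range_succ, ← add_assoc, ih, stepSum_add_stepInc h (hz n.le_succ)]
  exact (this ▸ le_add_self).trans (stepSum_le_tsum h)

lemma stepInc_rpow_mul_rpow_le (σ Θ : ℕ → ℝ≥0∞) {κ μ : ℝ} (hκ : 0 < κ) (hμ : 0 < μ)
    (h : κ + μ = 1) : stepInc y (fun j => σ j ^ κ * Θ j ^ μ) t t' ≤
      stepInc y σ t t' ^ κ * stepInc y Θ t t' ^ μ := by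
  refine le_trans (le_of_eq ?_) (tsum_rpow_mul_rpow_le _ _ hκ.le hμ.le h)
  refine tsum_congr fun j => ?_
  split_ifs <;> simp [hκ]

end StepSum

section Sufficiency

variable {a b p q r : ℝ} {u v w : ℝ → ℝ≥0∞}

lemma IsGrid.tail_mul_rpow_le {c : ℝ} {M : ℝ≥0∞} {t : ℕ → ℝ} (h : IsGrid u c b M t)
    (hM : 2 ≤ M) (hu : Measurable u) (hfin : tail u b c ≠ ∞) {β η : ℝ} (hβ : 0 ≤ β) (hη : 0 ≤ η)
    {S : ℝ → ℝ≥0∞} (hS : Monotone S) (m : ℕ) :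
    tail u b (t m) ^ (β + 1) * S (t (m + 1)) ^ η ≤
      (M ^ 2) ^ (β + 1) * ∫⁻ s in Ioo (t (m + 1)) (t (m + 2)), tail u b s ^ β * u s * S s ^ η := by
  have ht : ∀ k, tail u b (t k) ≠ ∞ := fun k =>
    ne_top_of_le_ne_top hfin (tail_antitone u b (h.le k))
  have hmono := h.strictMono.monotone
  set τ := tail u b (t (m + 2)) with hτ
  have e1 : tail u b (t m) = M ^ 2 * τ := by
    rw [← h.tail_succ m, ← h.tail_succ (m + 1)]; ring
  have e2 : τ ≤ ∫⁻ s in Ioo (t (m + 1)) (t (m + 2)), u s := by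
    have h1 : _ + τ = tail u b (t (m + 1)) :=
      lintegral_Ioo_add (hmono (m + 1).le_succ) (h.lt (m + 2)).le u
    rw [← h.tail_succ (m + 1)] at h1
    refine (ENNReal.add_le_add_iff_right (ht (m + 2))).1 ?_
    rw [← hτ, h1, ← two_mul]
    gcongr
  rw [e1, ENNReal.mul_rpow_of_nonneg _ _ (by linarith), mul_assoc]
  gcongr
  calc τ ^ (β + 1) * S (t (m + 1)) ^ η = τ ^ β * S (t (m + 1)) ^ η * τ := by
        rw [ENNReal.rpow_add_of_nonneg _ _ hβ zero_le_one, ENNReal.rpow_one]; ring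
    _ ≤ τ ^ β * S (t (m + 1)) ^ η * ∫⁻ s in Ioo (t (m + 1)) (t (m + 2)), u s := by gcongr
    _ = ∫⁻ s in Ioo (t (m + 1)) (t (m + 2)), τ ^ β * S (t (m + 1)) ^ η * u s :=
        (lintegral_const_mul _ hu).symm
    _ ≤ _ := by
        refine setLIntegral_mono' measurableSet_Ioo fun s hs => ?_
        calc _ ≤ tail u b s ^ β * S s ^ η * u s := by
              gcongr
              · exact tail_antitone u b hs.2.le
              · exact hS hs.1.le
          _ = _ := by ring

lemma exists_lintegral_stepSum_rpow_le (hr0 : 0 < r) (hr1 : r ≤ 1) (hq : 1 ≤ q) (hqp : q < p) :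
    ∃ K : ℝ≥0∞, K ≠ ∞ ∧ ∀ {b c : ℝ} {u : ℝ → ℝ≥0∞} {y : ℕ → ℝ} (σ Θ : ℕ → ℝ≥0∞), c < b →
      Measurable u → tail u b c ≠ ∞ → (∀ x ∈ Ioo c b, 0 < tail u b x) → (∀ j, c < y j) →
      ∫⁻ t in Ioo c b, u t *
          stepSum y (fun j => σ j ^ ((p - r) / p) * Θ j ^ (r / p)) t ^ (q / r) ≤
        K * ((∫⁻ t in Ioo c b, tail u b t ^ (q / (p - q)) * u t *
          stepSum y σ t ^ ((p - r) * q / ((p - q) * r))) ^ ((p - q) / p) *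
          (∑' j, Θ j) ^ (q / p)) := by
  have hp : 0 < p := by linarith
  have hq0 : 0 < q := by linarith
  have hpq : 0 < p - q := by linarith
  have hpr : 0 < p - r := by linarith
  have hQ : 0 < q / r := by positivity
  set M : ℝ≥0∞ := 2 * 2 ^ (q / r) with hM
  have hMt : M ≠ ∞ := ENNReal.mul_ne_top (by simp) (ENNReal.rpow_ne_top_of_nonneg hQ.le (by simp))
  have hM2 : 2 ≤ M := le_mul_of_one_le_right (by simp) (ENNReal.one_le_rpow (by norm_num) hQ)
  set β := q / (p - q) with hβ
  set η := (p - r) * q / ((p - q) * r) with hη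
  have hβ0 : 0 < β := by positivity
  have hη0 : 0 < η := by positivity
  refine ⟨M * ((M ^ 2) ^ (β + 1)) ^ ((p - q) / p), ?_, ?_⟩
  · refine ENNReal.mul_ne_top hMt (ENNReal.rpow_ne_top_of_nonneg (by positivity)
      (ENNReal.rpow_ne_top_of_nonneg (by positivity) (by simp [hMt])))
  intro b c u y σ Θ hcb hu hfin hpos hy
  obtain ⟨t, ht⟩ := exists_grid hu hcb hfin hpos hM2 hMt
  have hmono := ht.strictMono.monotone
  set G := stepSum y (fun j => σ j ^ ((p - r) / p) * Θ j ^ (r / p)) with hG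
  set I : ℝ≥0∞ := ∫⁻ t in Ioo c b, tail u b t ^ β * u t * stepSum y σ t ^ η with hI
  have hmain : ∀ m, tail u b (t m) *
      stepInc y (fun j => σ j ^ ((p - r) / p) * Θ j ^ (r / p)) (t m) (t (m + 1)) ^ (q / r) ≤
      (tail u b (t m) ^ (β + 1) * stepSum y σ (t (m + 1)) ^ η) ^ ((p - q) / p) *
        stepInc y Θ (t m) (t (m + 1)) ^ (q / p) := fun m => by
    calc _ ≤ tail u b (t m) * (stepSum y σ (t (m + 1)) ^ ((p - r) / p) *
          stepInc y Θ (t m) (t (m + 1)) ^ (r / p)) ^ (q / r) := by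
          gcongr
          refine (stepInc_rpow_mul_rpow_le σ Θ (by positivity) (by positivity)
            (by field_simp; ring)).trans ?_
          gcongr
          exact stepInc_le_stepSum σ (hmono m.le_succ)
      _ = _ := by
          rw [ENNReal.mul_rpow_of_nonneg _ _ hQ.le, ENNReal.mul_rpow_of_nonneg _ _ (by positivity),
            ← ENNReal.rpow_mul, ← ENNReal.rpow_mul, ← ENNReal.rpow_mul, ← ENNReal.rpow_mul]
          have e1 : (β + 1) * ((p - q) / p) = 1 := by rw [hβ]; field_simp; ring
          have e2 : (p - r) / p * (q / r) = η * ((p - q) / p) := by rw [hη]; field_simp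
          have e3 : r / p * (q / r) = q / p := by field_simp
          rw [e1, e2, e3, ENNReal.rpow_one, mul_assoc]
  have hsum : ∑' m, tail u b (t m) ^ (β + 1) * stepSum y σ (t (m + 1)) ^ η ≤
      (M ^ 2) ^ (β + 1) * I := by
    calc _ ≤ ∑' m, (M ^ 2) ^ (β + 1) * ∫⁻ s in Ioo (t (m + 1)) (t (m + 2)),
          tail u b s ^ β * u s * stepSum y σ s ^ η := ENNReal.tsum_le_tsum fun m =>
            ht.tail_mul_rpow_le hM2 hu hfin hβ0.le hη0.le (monotone_stepSum y σ) m
      _ ≤ (M ^ 2) ^ (β + 1) * ∑' m, ∫⁻ s in Ioo (t m) (t (m + 1)),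
          tail u b s ^ β * u s * stepSum y σ s ^ η := by
          rw [ENNReal.tsum_mul_left]
          refine mul_le_mul_right ?_ _
          exact ENNReal.tsum_comp_le_tsum_of_injective (add_left_injective 1)
            (fun m => ∫⁻ s in Ioo (t m) (t (m + 1)), tail u b s ^ β * u s * stepSum y σ s ^ η)
      _ = _ := by rw [tsum_lintegral_Ioo hmono ht.lt ht.cover, ht.zero]
  calc _ ≤ M * ∑' m, tail u b (t m) *
        stepInc y (fun j => σ j ^ ((p - r) / p) * Θ j ^ (r / p)) (t m) (t (m + 1)) ^ (q / r) :=
        ht.lintegral_rpow_mul_le hu hQ le_rfl (monotone_stepSum y _) (stepSum_eq_zero _ hy)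
          fun m => (stepSum_add_stepInc _ (hmono m.le_succ)).ge
    _ ≤ M * ((∑' m, tail u b (t m) ^ (β + 1) * stepSum y σ (t (m + 1)) ^ η) ^ ((p - q) / p) *
        (∑' m, stepInc y Θ (t m) (t (m + 1))) ^ (q / p)) := by
        gcongr
        exact (ENNReal.tsum_le_tsum hmain).trans (tsum_rpow_mul_rpow_le _ _ (by positivity)
          (by positivity) (by field_simp; ring))
    _ ≤ M * (((M ^ 2) ^ (β + 1) * I) ^ ((p - q) / p) * (∑' j, Θ j) ^ (q / p)) := by
        refine mul_le_mul_right (mul_le_mul' ?_ ?_) _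
        · gcongr
        · exact ENNReal.rpow_le_rpow (tsum_stepInc_le Θ hmono) (by positivity)
    _ = _ := by rw [ENNReal.mul_rpow_of_nonneg _ _ (by positivity)]; ring

lemma IsGrid.tail_rpow_mul_Vr_rpow_le (hr0 : 0 < r) (hr1 : r ≤ 1) (hrp : r < p)
    (hw : Measurable w) {c : ℝ} {x : ℕ → ℝ} (h : IsGrid w c b 2 x)
    (h0 : ∀ k, tail w b (x k) ≠ 0) (ht : ∀ k, tail w b (x k) ≠ ∞) {j k : ℕ} (hjk : j + 2 ≤ k) :
    tail w b (x (j + 1)) ^ (-(r / (p - r))) * Vr r v (x (j + 1)) (x (j + 2)) ^ (p * r / (p - r)) ≤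
      2 ^ (p / (p - r)) * ∫⁻ s in Ioo (x j) (x (j + 1)),
        tail w b s ^ (-(p / (p - r))) * w s * Vr r v s (x k) ^ (p * r / (p - r)) := by
  have hpr : 0 < p - r := by linarith
  have hp : 0 < p := by linarith
  set T := tail w b (x (j + 1)) with hT
  set A := Vr r v (x (j + 1)) (x (j + 2)) ^ (p * r / (p - r)) with hA
  have e1 : T ^ (-(r / (p - r))) = 2 ^ (p / (p - r)) * (tail w b (x j) ^ (-(p / (p - r))) * T) := by
    have e3 : (2 : ℝ≥0∞) ^ (p / (p - r)) * 2 ^ (-(p / (p - r))) = 1 := by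
      rw [← ENNReal.rpow_add _ _ (by simp) (by simp)]; simp
    have e4 : T ^ (-(r / (p - r))) = T ^ (-(p / (p - r))) * T := by
      nth_rw 3 [← ENNReal.rpow_one T]
      rw [← ENNReal.rpow_add _ _ (h0 _) (ht _)]
      congr 1; field_simp; ring
    rw [← h.tail_succ j, ENNReal.mul_rpow_of_ne_top (by simp) (ht _), e4, ← mul_assoc,
      ← mul_assoc, e3, one_mul]
  rw [e1, mul_assoc]
  gcongr
  calc tail w b (x j) ^ (-(p / (p - r))) * T * A
      = ∫⁻ s in Ioo (x j) (x (j + 1)), tail w b (x j) ^ (-(p / (p - r))) * A * w s := by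
        rw [lintegral_const_mul _ hw, h.lintegral_Ioo_eq ht]; ring
    _ ≤ _ := by
        refine setLIntegral_mono' measurableSet_Ioo fun s hs => ?_
        calc _ ≤ tail w b s ^ (-(p / (p - r))) * Vr r v s (x k) ^ (p * r / (p - r)) * w s := by
              refine mul_le_mul' (mul_le_mul' ?_ ?_) le_rfl
              · exact tail_rpow_neg_mono w b (κ := p / (p - r)) (by positivity) hs.1.le
              · exact ENNReal.rpow_le_rpow (Vr_mono hr0 hr1 hs.2.le
                  (h.strictMono.monotone hjk)) (by positivity)
          _ = _ := by ring

lemma IsGrid.stepSum_le_innerKernel (hr0 : 0 < r) (hr1 : r ≤ 1) (hrp : r < p)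
    (hw : Measurable w) {c : ℝ} (hac : a ≤ c) {x : ℕ → ℝ} (h : IsGrid w c b 2 x)
    (h0 : ∀ k, tail w b (x k) ≠ 0) (ht : ∀ k, tail w b (x k) ≠ ∞) {k : ℕ} {t : ℝ}
    (htk : t < x (k + 1)) :
    stepSum (fun j => x (j + 2)) (fun j => tail w b (x (j + 1)) ^ (-(r / (p - r))) *
      Vr r v (x (j + 1)) (x (j + 2)) ^ (p * r / (p - r))) t ≤
      2 ^ (p / (p - r)) * innerKernel p r v w b a (x k) := by
  have hjk : ∀ j, x (j + 2) ≤ t → j + 2 ≤ k := fun j hj => by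
    have := h.strictMono.lt_iff_lt.1 (hj.trans_lt htk)
    lia
  unfold stepSum
  rw [tsum_eq_sum (s := Finset.range k) fun j hj => if_neg fun hle => hj (by
    have := hjk j hle
    simp; lia)]
  calc _ ≤ ∑ j ∈ Finset.range k, 2 ^ (p / (p - r)) * ∫⁻ s in Ioo (x j) (x (j + 1)),
        tail w b s ^ (-(p / (p - r))) * w s * Vr r v s (x k) ^ (p * r / (p - r)) := by
        refine Finset.sum_le_sum fun j _ => ?_
        split_ifs with hj
        · exact h.tail_rpow_mul_Vr_rpow_le hr0 hr1 hrp hw h0 ht (hjk j hj)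
        · simp
    _ = 2 ^ (p / (p - r)) * innerKernel p r v w b c (x k) := by
        rw [← Finset.mul_sum, sum_lintegral_Ioo h.strictMono.monotone, h.zero]; rfl
    _ ≤ _ := by
        gcongr
        exact innerKernel_mono hr0 hr1 hrp hac le_rfl

lemma IsGrid.tsum_innerKernel_le (hr0 : 0 < r) (hr1 : r ≤ 1) (hq : 1 ≤ q) (hqp : q < p) {c : ℝ}
    {x : ℕ → ℝ} (h : IsGrid w c b 2 x) (hc : c ∈ Ioo a b) (hu : Measurable u) (hw : Measurable w)
    (hW : ∀ x ∈ Ioo a b, 0 < tail w b x ∧ tail w b x < ∞) :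
    ∑' k, ∫⁻ t in Ioo (x k) (x (k + 1)), tail u b t ^ (q / (p - q)) * u t *
      innerKernel p r v w b a (x k) ^ ((p - r) * q / ((p - q) * r)) ≤
      4 * C₆ a b r p q u v w ^ (p * q / (p - q)) := by
  have hp : 0 < p := by linarith
  have hpq : 0 < p - q := by linarith
  have hrp : r < p := by linarith
  have hpr : 0 < p - r := by linarith
  have hq0 : 0 < q := by linarith
  have hxm : ∀ k, x k ∈ Ioo a b := fun k => ⟨hc.1.trans_le (h.le k), h.lt k⟩
  have hW0 : ∀ k, tail w b (x k) ≠ 0 := fun k => (hW _ (hxm k)).1.ne'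
  have hWt : ∀ k, tail w b (x k) ≠ ∞ := fun k => (hW _ (hxm k)).2.ne
  set η := (p - r) * q / ((p - q) * r) with hη
  set φ : ℝ → ℝ≥0∞ := fun t => tail u b t ^ (q / (p - q)) * u t with hφ
  have hφm : Measurable φ := measurable_tail_rpow_mul hu b _
  set E : ℝ → ℝ≥0∞ := fun x => essSup (fun y => (tail w b y)⁻¹ *
    ∫⁻ t in Ioo y x, φ t * innerKernel p r v w b a y ^ η) (volume.restrict (Ioo a x)) with hE
  have hC : C₆ a b r p q u v w ^ (p * q / (p - q)) = ∫⁻ x in Ioo a b, w x * E x := by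
    have : C₆ a b r p q u v w = (∫⁻ x in Ioo a b, w x * E x) ^ ((p - q) / (p * q)) := rfl
    rw [this, ← ENNReal.rpow_mul]
    have : (p - q) / (p * q) * (p * q / (p - q)) = 1 := by field_simp
    rw [this, ENNReal.rpow_one]
  rw [hC]
  refine le_trans (le_of_eq ?_) (h.tsum_mul_le_lintegral hWt hw hc.1.le (E := E)
    (F := fun k => ∫⁻ t in Ioo (x k) (x (k + 1)),
      (tail w b (x k))⁻¹ * (φ t * innerKernel p r v w b a (x k) ^ η)) fun k z hz => ?_)
  · refine tsum_congr fun k => ?_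
    rw [lintegral_const_mul _ (hφm.mul_const _), ← mul_assoc,
      ENNReal.mul_inv_cancel (hW0 k) (hWt k), one_mul]
  · refine lintegral_Ioo_le_of_forall fun y' hy' => ?_
    rw [lintegral_const_mul _ (hφm.mul_const _)]
    refine le_essSup_Ioo hy'.1 (hxm k).1.le (hy'.2.trans hz.1).le fun y hy => ?_
    refine mul_le_mul' (ENNReal.inv_le_inv.2 (tail_antitone w b hy.1.le)) ?_
    refine (lintegral_Ioo_mono hy.2.le hz.1.le _).trans (lintegral_mono fun t => ?_)
    refine mul_le_mul_right (ENNReal.rpow_le_rpow ?_ (by positivity)) _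
    exact innerKernel_mono hr0 hr1 hrp le_rfl hy.1.le

lemma IsGrid.lintegral_stepSum_rpow_le (hr0 : 0 < r) (hr1 : r ≤ 1) (hq : 1 ≤ q) (hqp : q < p)
    {c : ℝ} {x : ℕ → ℝ} (h : IsGrid w c b 2 x) (hc : c ∈ Ioo a b) (hu : Measurable u)
    (hw : Measurable w) (hW : ∀ x ∈ Ioo a b, 0 < tail w b x ∧ tail w b x < ∞) :
    ∫⁻ t in Ioo c b, tail u b t ^ (q / (p - q)) * u t *
      stepSum (fun j => x (j + 2)) (fun j => tail w b (x (j + 1)) ^ (-(r / (p - r))) *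
        Vr r v (x (j + 1)) (x (j + 2)) ^ (p * r / (p - r))) t ^ ((p - r) * q / ((p - q) * r)) ≤
      (2 ^ (p / (p - r))) ^ ((p - r) * q / ((p - q) * r)) *
        (4 * C₆ a b r p q u v w ^ (p * q / (p - q))) := by
  have hp : 0 < p := by linarith
  have hpq : 0 < p - q := by linarith
  have hrp : r < p := by linarith
  have hpr : 0 < p - r := by linarith
  have hq0 : 0 < q := by linarith
  have hxm : ∀ k, x k ∈ Ioo a b := fun k => ⟨hc.1.trans_le (h.le k), h.lt k⟩
  have hη : 0 < (p - r) * q / ((p - q) * r) := by positivity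
  refine le_trans ?_ (mul_le_mul_right
    (h.tsum_innerKernel_le (v := v) hr0 hr1 hq hqp hc hu hw hW) _)
  rw [← h.zero, ← tsum_lintegral_Ioo h.strictMono.monotone h.lt h.cover, ← ENNReal.tsum_mul_left]
  refine ENNReal.tsum_le_tsum fun k => ?_
  rw [← lintegral_const_mul _ ((measurable_tail_rpow_mul hu b _).mul_const _)]
  refine setLIntegral_mono' measurableSet_Ioo fun t ht => ?_
  have := h.stepSum_le_innerKernel (v := v) hr0 hr1 hrp hw hc.1.le (fun k => (hW _ (hxm k)).1.ne')
    (fun k => (hW _ (hxm k)).2.ne) ht.2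
  calc _ ≤ tail u b t ^ (q / (p - q)) * u t *
        (2 ^ (p / (p - r)) * innerKernel p r v w b a (x k)) ^ ((p - r) * q / ((p - q) * r)) := by
        gcongr
    _ = _ := by rw [ENNReal.mul_rpow_of_nonneg _ _ hη.le]; ring

lemma IsGrid.lintegral_le_add_stepSum {c : ℝ} {M : ℝ≥0∞} {x : ℕ → ℝ} (h : IsGrid w c b M x)
    {g : ℝ → ℝ≥0∞} {θ : ℕ → ℝ≥0∞} (hθ : ∀ j, ∫⁻ s in Ioo (x (j + 1)) (x (j + 2)), g s ≤ θ j)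
    {k : ℕ} {t : ℝ} (ht : t ∈ Ioo (x k) (x (k + 1))) :
    ∫⁻ s in Ioo c t, g s ≤ (Ioi (x 1)).indicator (fun _ => ∫⁻ s in Ioo (x 0) (x 1), g s) t +
      (stepSum (fun j => x (j + 2)) θ t + ∫⁻ s in Ioo (x k) t, g s) := by
  have hm := h.strictMono.monotone
  rw [← lintegral_Ioo_add (h.le k) ht.1.le g, ← add_assoc]
  gcongr
  rcases k with _ | k
  · simp [h.zero]
  have hx1 : x 1 < t := (hm (by lia)).trans_lt ht.1
  nth_rw 1 [← h.zero]
  rw [← sum_lintegral_Ioo hm, Finset.sum_range_succ', add_comm,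
    indicator_of_mem (mem_Ioi.2 hx1)]
  refine add_le_add_right ?_ _
  calc _ ≤ ∑ j ∈ Finset.range k, if x (j + 2) ≤ t then θ j else 0 := by
        refine Finset.sum_le_sum fun j hj => ?_
        rw [if_pos ((hm (by simp at hj; lia)).trans ht.1.le)]
        exact hθ j
    _ ≤ _ := ENNReal.sum_le_tsum _

lemma IsGrid.lintegral_indicator_le (hr0 : 0 < r) (hr1 : r ≤ 1) (hq : 1 ≤ q) (hqp : q < p)
    {c : ℝ} {x : ℕ → ℝ} (h : IsGrid w c b 2 x) (hc : c ∈ Ioo a b)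
    (hu : IsWeight a b u) (hv : IsWeight a b v) (hw : Measurable w)
    (hW : ∀ x ∈ Ioo a b, 0 < tail w b x ∧ tail w b x < ∞)
    (hC : C₁ a b r p q u v w ≠ ∞) {f : ℝ → ℝ≥0∞} (hf : Measurable f) :
    ∫⁻ t in Ioo c b, u t *
      (Ioi (x 1)).indicator (fun _ => ∫⁻ s in Ioo (x 0) (x 1), f s ^ r * v s) t ^ (q / r) ≤
      4 ^ q * C₁ a b r p q u v w ^ q *
        (∑' k, tail w b (x k) * (∫⁻ s in Ioo (x k) (x (k + 1)), f s) ^ p) ^ (q / p) := by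
  have hp : 0 < p := by linarith
  have hq0 : 0 < q := by linarith
  set A := ∫⁻ s in Ioo (x 0) (x 1), f s ^ r * v s with hA
  set F := ∫⁻ s in Ioo (x 0) (x 1), f s with hF
  have hAF : A ^ (q / r) ≤ Vr r v (x 0) (x 1) ^ q * F ^ q := by
    refine (ENNReal.rpow_le_rpow (_root_.lintegral_rpow_mul_le hr0 hr1 hv.1 hf _ _)
      (by positivity)).trans (le_of_eq ?_)
    rw [ENNReal.mul_rpow_of_nonneg _ _ (by positivity), ← ENNReal.rpow_mul, ← ENNReal.rpow_mul,
      mul_div_cancel₀ _ hr0.ne']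
  calc _ = ∫⁻ t in Ioo c b, (Ioi (x 1)).indicator (fun t => u t * A ^ (q / r)) t := by
        refine lintegral_congr fun t => ?_
        by_cases ht : t ∈ Ioi (x 1)
        · simp [indicator_of_mem ht]
        · rw [indicator_of_notMem ht, indicator_of_notMem ht,
            ENNReal.zero_rpow_of_pos (by positivity), mul_zero]
    _ ≤ ∫⁻ t in Ioo (x 1) b, u t * A ^ (q / r) := by
        rw [setLIntegral_indicator measurableSet_Ioi]
        exact lintegral_mono_set fun t ht => ⟨ht.1, ht.2.2⟩
    _ = A ^ (q / r) * tail u b (x 1) := by rw [lintegral_mul_const _ hu.1, mul_comm]; rfl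
    _ ≤ Vr r v (x 0) (x 1) ^ q * F ^ q * tail u b (x 1) := by gcongr
    _ = Vr r v (x 0) (x 1) ^ q * tail u b (x 1) * F ^ q := by ring
    _ ≤ (4 * C₁ a b r p q u v w) ^ q * tail w b (x 0) ^ (q / p) * F ^ q := by
        refine mul_le_mul_left ?_ _
        exact Vr_rpow_mul_tail_le_C₁ hr0 hr1 hq (by linarith) hu hv hw hW hC
          (by rw [h.zero]; exact hc.1) (h.strictMono.monotone zero_le_one) (h.lt 1)
    _ = 4 ^ q * C₁ a b r p q u v w ^ q * (tail w b (x 0) * F ^ p) ^ (q / p) := by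
        rw [ENNReal.mul_rpow_of_nonneg _ _ hq0.le, ENNReal.mul_rpow_of_nonneg _ _ (by positivity),
          ← ENNReal.rpow_mul, mul_div_cancel₀ _ hp.ne', mul_assoc]
    _ ≤ _ := by
        refine mul_le_mul_right (ENNReal.rpow_le_rpow ?_ (by positivity)) _
        exact ENNReal.le_tsum (f := fun k => tail w b (x k) *
          (∫⁻ s in Ioo (x k) (x (k + 1)), f s) ^ p) 0

lemma exists_tsum_lintegral_le (hr0 : 0 < r) (hr1 : r ≤ 1) (hq : 1 ≤ q) (hqp : q < p) :
    ∃ K : ℝ≥0∞, K ≠ ∞ ∧ ∀ {a b c : ℝ} {u v w f : ℝ → ℝ≥0∞} {x : ℕ → ℝ}, IsGrid w c b 2 x →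
      c ∈ Ioo a b → IsWeight a b u → IsWeight a b v → Measurable w →
      (∀ x ∈ Ioo a b, 0 < tail w b x ∧ tail w b x < ∞) → tail u b c ≠ ∞ → Measurable f →
      ∑' k, ∫⁻ t in Ioo (x k) (x (k + 1)), u t *
        (∫⁻ s in Ioo (x k) t, f s ^ r * v s) ^ (q / r) ≤
      K * C₇ a b r p q u v w ^ q *
        (∑' k, tail w b (x k) * (∫⁻ s in Ioo (x k) (x (k + 1)), f s) ^ p) ^ (q / p) := by
  have hp : 0 < p := by linarith
  have hq0 : 0 < q := by linarith
  have hpq : 0 < p - q := by linarith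
  obtain ⟨K, hK, hloc⟩ := exists_lintegral_rpow_mul_le hr0 hr1 hq
  refine ⟨K * (4 * 2 ^ (p / (p - q))) ^ ((p - q) / p), ENNReal.mul_ne_top hK
    (ENNReal.rpow_ne_top_of_nonneg (by positivity) (ENNReal.mul_ne_top (by simp)
      (ENNReal.rpow_ne_top_of_nonneg (by positivity) (by simp)))), ?_⟩
  intro a b c u v w f x h hc hu hv hw hW hUc hf
  have hxm : ∀ k, x k ∈ Ioo a b := fun k => ⟨hc.1.trans_le (h.le k), h.lt k⟩
  set F : ℕ → ℝ≥0∞ := fun k => ∫⁻ s in Ioo (x k) (x (k + 1)), f s with hF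
  set B : ℕ → ℝ≥0∞ := fun k => cellConst q r u v (x k) (x (k + 1)) with hB
  have hBF : ∀ k, B k * F k ^ q = (tail w b (x k) ^ (-(q / (p - q))) *
      B k ^ (p / (p - q))) ^ ((p - q) / p) * (tail w b (x k) * F k ^ p) ^ (q / p) := fun k => by
    have h0 := (hW _ (hxm k)).1.ne'
    have ht := (hW _ (hxm k)).2.ne
    rw [ENNReal.mul_rpow_of_nonneg _ _ (by positivity), ENNReal.mul_rpow_of_nonneg _ _
      (by positivity), ← ENNReal.rpow_mul, ← ENNReal.rpow_mul, ← ENNReal.rpow_mul,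
      mul_div_cancel₀ _ hp.ne']
    have e1 : -(q / (p - q)) * ((p - q) / p) = -(q / p) := by field_simp
    have e2 : p / (p - q) * ((p - q) / p) = 1 := by field_simp
    have e3 : tail w b (x k) ^ (-(q / p)) * tail w b (x k) ^ (q / p) = 1 := by
      rw [← ENNReal.rpow_add _ _ h0 ht]; simp
    rw [e1, e2, ENNReal.rpow_one]
    calc _ = (tail w b (x k) ^ (-(q / p)) * tail w b (x k) ^ (q / p)) * (B k * F k ^ q) := by
          rw [e3, one_mul]
      _ = _ := by ring
  calc _ ≤ ∑' k, K * (B k * F k ^ q) := by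
        refine ENNReal.tsum_le_tsum fun k => hloc (h.strictMono k.lt_succ_self) hu.1 hv.1 hf
          (ne_top_of_le_ne_top hUc (lintegral_Ioo_mono (h.le k) (h.lt (k + 1)).le u))
          (fun y hy => hu.lintegral_pos ((hxm k).1.trans hy.1).le hy.2 (h.lt (k + 1)).le)
          fun t₁ t₂ h1 h2 h3 => ?_
        exact le_iSup₂_of_le t₁ t₂ (le_iSup_of_le ⟨h1, h2, h3⟩ le_rfl)
    _ ≤ K * ((∑' k, tail w b (x k) ^ (-(q / (p - q))) * B k ^ (p / (p - q))) ^ ((p - q) / p) *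
        (∑' k, tail w b (x k) * F k ^ p) ^ (q / p)) := by
        rw [ENNReal.tsum_mul_left]
        simp_rw [hBF]
        refine mul_le_mul_right (tsum_rpow_mul_rpow_le _ _ (by positivity) (by positivity) ?_) _
        field_simp; ring
    _ ≤ K * ((4 * 2 ^ (p / (p - q)) * C₇ a b r p q u v w ^ (p * q / (p - q))) ^ ((p - q) / p) *
        (∑' k, tail w b (x k) * F k ^ p) ^ (q / p)) := by
        refine mul_le_mul_right (mul_le_mul_left (ENNReal.rpow_le_rpow ?_ (by positivity)) _) _
        exact h.tsum_cellConst_le hr0 hr1 hq hqp hc hw hW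
    _ = _ := by
        rw [ENNReal.mul_rpow_of_nonneg _ _ (by positivity), ← ENNReal.rpow_mul (C₇ _ _ _ _ _ _ _ _)]
        have e1 : p * q / (p - q) * ((p - q) / p) = q := by field_simp
        rw [e1]; ring

lemma exists_lintegral_cell_stepSum_le (hr0 : 0 < r) (hr1 : r ≤ 1) (hq : 1 ≤ q) (hqp : q < p) :
    ∃ K : ℝ≥0∞, K ≠ ∞ ∧ ∀ {a b c : ℝ} {u v w : ℝ → ℝ≥0∞} {x : ℕ → ℝ} (F : ℕ → ℝ≥0∞),
      IsGrid w c b 2 x →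
      c ∈ Ioo a b → IsWeight a b u → Measurable w →
      (∀ x ∈ Ioo a b, 0 < tail w b x ∧ tail w b x < ∞) → tail u b c ≠ ∞ →
      ∫⁻ t in Ioo c b, u t * stepSum (fun j => x (j + 2))
        (fun j => Vr r v (x (j + 1)) (x (j + 2)) ^ r * F (j + 1) ^ r) t ^ (q / r) ≤
      K * C₆ a b r p q u v w ^ q * (∑' k, tail w b (x k) * F k ^ p) ^ (q / p) := by
  have hp : 0 < p := by linarith
  have hq0 : 0 < q := by linarith
  have hpq : 0 < p - q := by linarith
  have hpr : 0 < p - r := by linarith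
  obtain ⟨K, hK, hglob⟩ := exists_lintegral_stepSum_rpow_le hr0 hr1 hq hqp
  set κ : ℝ≥0∞ := (2 ^ (p / (p - r))) ^ ((p - r) * q / ((p - q) * r)) with hκ
  refine ⟨K * (κ * 4) ^ ((p - q) / p), ENNReal.mul_ne_top hK
    (ENNReal.rpow_ne_top_of_nonneg (by positivity) (ENNReal.mul_ne_top
      (ENNReal.rpow_ne_top_of_nonneg (by positivity)
        (ENNReal.rpow_ne_top_of_nonneg (by positivity) (by simp))) (by simp))), ?_⟩
  intro a b c u v w x F h hc hu hw hW hUc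
  have hxm : ∀ k, x k ∈ Ioo a b := fun k => ⟨hc.1.trans_le (h.le k), h.lt k⟩
  set σ : ℕ → ℝ≥0∞ := fun j => tail w b (x (j + 1)) ^ (-(r / (p - r))) *
    Vr r v (x (j + 1)) (x (j + 2)) ^ (p * r / (p - r)) with hσ
  set Θ : ℕ → ℝ≥0∞ := fun j => tail w b (x (j + 1)) * F (j + 1) ^ p with hΘ
  have hθ : (fun j => Vr r v (x (j + 1)) (x (j + 2)) ^ r * F (j + 1) ^ r) =
      fun j => σ j ^ ((p - r) / p) * Θ j ^ (r / p) := by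
    funext j
    have h0 := (hW _ (hxm (j + 1))).1.ne'
    have ht := (hW _ (hxm (j + 1))).2.ne
    rw [hσ, hΘ]
    dsimp only
    rw [ENNReal.mul_rpow_of_nonneg _ _ (by positivity), ENNReal.mul_rpow_of_nonneg _ _
      (by positivity), ← ENNReal.rpow_mul, ← ENNReal.rpow_mul, ← ENNReal.rpow_mul,
      mul_div_cancel₀ _ hp.ne']
    have e1 : -(r / (p - r)) * ((p - r) / p) = -(r / p) := by field_simp
    have e2 : p * r / (p - r) * ((p - r) / p) = r := by field_simp
    have e3 : tail w b (x (j + 1)) ^ (-(r / p)) * tail w b (x (j + 1)) ^ (r / p) = 1 := by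
      rw [← ENNReal.rpow_add _ _ h0 ht]; simp
    rw [e1, e2]
    calc _ = (tail w b (x (j + 1)) ^ (-(r / p)) * tail w b (x (j + 1)) ^ (r / p)) *
          (Vr r v (x (j + 1)) (x (j + 2)) ^ r * F (j + 1) ^ r) := by rw [e3, one_mul]
      _ = _ := by ring
  rw [hθ]
  refine (hglob σ Θ hc.2 hu.1 hUc (fun y hy => hu.lintegral_pos (hc.1.trans hy.1).le hy.2 le_rfl)
    fun j => (h.le 0).trans_lt (h.strictMono (by lia))).trans ?_
  calc _ ≤ K * ((κ * (4 * C₆ a b r p q u v w ^ (p * q / (p - q)))) ^ ((p - q) / p) *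
        (∑' k, tail w b (x k) * F k ^ p) ^ (q / p)) := by
        refine mul_le_mul_right (mul_le_mul' (ENNReal.rpow_le_rpow ?_ (by positivity))
          (ENNReal.rpow_le_rpow ?_ (by positivity))) _
        · exact h.lintegral_stepSum_rpow_le hr0 hr1 hq hqp hc hu.1 hw hW
        · exact ENNReal.tsum_comp_le_tsum_of_injective (add_left_injective 1)
            fun k => tail w b (x k) * F k ^ p
    _ = _ := by
        rw [← mul_assoc κ, ENNReal.mul_rpow_of_nonneg _ _ (by positivity),
          ← ENNReal.rpow_mul (C₆ _ _ _ _ _ _ _ _)]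
        have e1 : p * q / (p - q) * ((p - q) / p) = q := by field_simp
        rw [e1]; ring

end Sufficiency

section Sufficiency

lemma exists_lintegral_Ioo_le {p q r : ℝ} (hr0 : 0 < r) (hr1 : r ≤ 1) (hq : 1 ≤ q)
    (hqp : q < p) :
    ∃ K : ℝ≥0∞, K ≠ ∞ ∧ ∀ {a b c : ℝ} {u v w f : ℝ → ℝ≥0∞}, c ∈ Ioo a b →
      IsWeight a b u → IsWeight a b v → IsWeight a b w →
      (∀ x ∈ Ioo a b, 0 < tail w b x ∧ tail w b x < ∞) → C₁ a b r p q u v w ≠ ∞ → Measurable f →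
      ∫⁻ t in Ioo c b, u t * (∫⁻ s in Ioo c t, f s ^ r * v s) ^ (q / r) ≤
      K * (C₁ a b r p q u v w + C₆ a b r p q u v w + C₇ a b r p q u v w) ^ q *
        (∫⁻ t in Ioo a b, w t * (∫⁻ s in Ioo a t, f s) ^ p) ^ (q / p) := by
  have hp : 0 < p := by linarith
  have hq0 : 0 < q := by linarith
  have hQ : 0 < q / r := by positivity
  obtain ⟨K₆, hK₆, hglob⟩ := exists_lintegral_cell_stepSum_le hr0 hr1 hq hqp
  obtain ⟨K₇, hK₇, hloc⟩ := exists_tsum_lintegral_le hr0 hr1 hq hqp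
  set T : ℝ≥0∞ := 2 ^ (q / r) with hT
  have hTt : T ≠ ∞ := ENNReal.rpow_ne_top_of_nonneg hQ.le (by simp)
  have hT1 : 1 ≤ T := ENNReal.one_le_rpow (by norm_num) hQ
  have h4 : ∀ κ : ℝ, 0 < κ → (4 : ℝ≥0∞) ^ κ ≠ ∞ := fun κ hκ =>
    ENNReal.rpow_ne_top_of_nonneg hκ.le (by simp)
  refine ⟨T * T * (4 ^ q + K₆ + K₇) * 4 ^ (q / p), ENNReal.mul_ne_top (ENNReal.mul_ne_top
    (ENNReal.mul_ne_top hTt hTt) (ENNReal.add_ne_top.2 ⟨ENNReal.add_ne_top.2 ⟨h4 q hq0, hK₆⟩, hK₇⟩))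
    (h4 _ (by positivity)), ?_⟩
  intro a b c u v w f hc hu hv hw hW hC hf
  have hUc : tail u b c ≠ ∞ := tail_ne_top_of_C₁ hr0 hr1 hq0 hp hv hW hC hc
  obtain ⟨x, hx⟩ := exists_grid hw.1 hc.2 (hW c hc).2.ne
    (fun y hy => (hW y ⟨hc.1.trans hy.1, hy.2⟩).1) le_rfl (by simp)
  have hxm : ∀ k, x k ∈ Ioo a b := fun k => ⟨hc.1.trans_le (hx.le k), hx.lt k⟩
  set F : ℕ → ℝ≥0∞ := fun k => ∫⁻ s in Ioo (x k) (x (k + 1)), f s with hF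
  set θ : ℕ → ℝ≥0∞ := fun j => Vr r v (x (j + 1)) (x (j + 2)) ^ r * F (j + 1) ^ r with hθ
  set A : ℝ → ℝ≥0∞ := (Ioi (x 1)).indicator
    (fun _ => ∫⁻ s in Ioo (x 0) (x 1), f s ^ r * v s) with hA
  set S : ℝ → ℝ≥0∞ := stepSum (fun j => x (j + 2)) θ with hS
  set X := (∑' k, tail w b (x k) * F k ^ p) ^ (q / p) with hX
  set D := C₁ a b r p q u v w + C₆ a b r p q u v w + C₇ a b r p q u v w with hD
  have hAm : Measurable fun t => u t * A t ^ (q / r) :=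
    hu.1.mul ((measurable_const.indicator measurableSet_Ioi).pow_const _)
  have hSm : Measurable fun t => u t * S t ^ (q / r) :=
    hu.1.mul ((monotone_stepSum _ _).measurable.pow_const _)
  have hXle : X ≤ 4 ^ (q / p) * (∫⁻ t in Ioo a b, w t * (∫⁻ s in Ioo a t, f s) ^ p) ^ (q / p) := by
    rw [← ENNReal.mul_rpow_of_nonneg _ _ (by positivity)]
    refine ENNReal.rpow_le_rpow ?_ (by positivity)
    refine hx.tsum_mul_le_lintegral (fun k => (hW _ (hxm k)).2.ne) hw.1 hc.1.le fun k y hy => ?_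
    exact ENNReal.rpow_le_rpow (lintegral_Ioo_mono (hxm k).1.le hy.1.le f) hp.le
  have hpt : ∀ k, ∀ t ∈ Ioo (x k) (x (k + 1)),
      u t * (∫⁻ s in Ioo c t, f s ^ r * v s) ^ (q / r) ≤
      T * T * (u t * A t ^ (q / r) + (u t * S t ^ (q / r) +
        u t * (∫⁻ s in Ioo (x k) t, f s ^ r * v s) ^ (q / r))) := fun k t ht => by
    set L := ∫⁻ s in Ioo (x k) t, f s ^ r * v s with hL
    calc _ ≤ u t * (A t + (S t + L)) ^ (q / r) := by
          refine mul_le_mul_right (ENNReal.rpow_le_rpow ?_ hQ.le) _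
          exact hx.lintegral_le_add_stepSum
            (fun j => lintegral_rpow_mul_le hr0 hr1 hv.1 hf _ _) ht
      _ ≤ u t * (T * (A t ^ (q / r) + T * (S t ^ (q / r) + L ^ (q / r)))) := by
          gcongr
          refine (add_rpow_le_two_rpow_mul hQ.le _ _).trans ?_
          gcongr
          exact add_rpow_le_two_rpow_mul hQ.le _ _
      _ ≤ u t * (T * (T * A t ^ (q / r) + T * (S t ^ (q / r) + L ^ (q / r)))) := by
          gcongr
          exact le_mul_of_one_le_left (by simp) hT1
      _ = _ := by ring
  calc ∫⁻ t in Ioo c b, u t * (∫⁻ s in Ioo c t, f s ^ r * v s) ^ (q / r)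
      = ∑' k, ∫⁻ t in Ioo (x k) (x (k + 1)),
        u t * (∫⁻ s in Ioo c t, f s ^ r * v s) ^ (q / r) := by
        rw [tsum_lintegral_Ioo hx.strictMono.monotone hx.lt hx.cover, hx.zero]
    _ ≤ ∑' k, T * T * ((∫⁻ t in Ioo (x k) (x (k + 1)), u t * A t ^ (q / r)) +
        ((∫⁻ t in Ioo (x k) (x (k + 1)), u t * S t ^ (q / r)) +
        ∫⁻ t in Ioo (x k) (x (k + 1)),
          u t * (∫⁻ s in Ioo (x k) t, f s ^ r * v s) ^ (q / r))) := by
        refine ENNReal.tsum_le_tsum fun k => ?_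
        refine (setLIntegral_mono' measurableSet_Ioo (hpt k)).trans (le_of_eq ?_)
        rw [lintegral_const_mul' _ _ (ENNReal.mul_ne_top hTt hTt),
          lintegral_add_left hAm,
          lintegral_add_left hSm]
    _ = T * T * ((∫⁻ t in Ioo c b, u t * A t ^ (q / r)) +
        ((∫⁻ t in Ioo c b, u t * S t ^ (q / r)) +
        ∑' k, ∫⁻ t in Ioo (x k) (x (k + 1)),
          u t * (∫⁻ s in Ioo (x k) t, f s ^ r * v s) ^ (q / r))) := by
        rw [ENNReal.tsum_mul_left, ENNReal.tsum_add, ENNReal.tsum_add,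
          tsum_lintegral_Ioo hx.strictMono.monotone hx.lt hx.cover,
          tsum_lintegral_Ioo hx.strictMono.monotone hx.lt hx.cover, hx.zero]
    _ ≤ T * T * (4 ^ q * C₁ a b r p q u v w ^ q * X + (K₆ * C₆ a b r p q u v w ^ q * X +
        K₇ * C₇ a b r p q u v w ^ q * X)) := by
        refine mul_le_mul_right (add_le_add ?_ (add_le_add ?_ ?_)) _
        · exact hx.lintegral_indicator_le hr0 hr1 hq hqp hc hu hv hw.1 hW hC hf
        · exact hglob F hx hc hu hw.1 hW hUc
        · exact hloc hx hc hu hv hw.1 hW hUc hf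
    _ ≤ T * T * (4 ^ q * D ^ q * X + (K₆ * D ^ q * X + K₇ * D ^ q * X)) := by
        gcongr
        · exact le_self_add.trans le_self_add
        · exact le_add_self.trans le_self_add
        · exact le_add_self
    _ = T * T * (4 ^ q + K₆ + K₇) * D ^ q * X := by ring
    _ ≤ T * T * (4 ^ q + K₆ + K₇) * D ^ q * (4 ^ (q / p) *
        (∫⁻ t in Ioo a b, w t * (∫⁻ s in Ioo a t, f s) ^ p) ^ (q / p)) := by gcongr
    _ = _ := by ring

lemma lintegral_mul_rpow_le_of_forall {a b κ : ℝ} (hab : a < b) {u g : ℝ → ℝ≥0∞}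
    (hu : Measurable u) (hκ : 0 < κ) {B : ℝ≥0∞}
    (h : ∀ c ∈ Ioo a b, ∫⁻ t in Ioo c b, u t * (∫⁻ s in Ioo c t, g s) ^ κ ≤ B) :
    ∫⁻ t in Ioo a b, u t * (∫⁻ s in Ioo a t, g s) ^ κ ≤ B := by
  refine le_trans (setLIntegral_mono' measurableSet_Ioo fun t ht => ?_)
    (lintegral_mul_essSup_le hab hu (g := fun c _ t => (∫⁻ s in Ioo c t, g s) ^ κ)
      (fun c₁ c₂ _ t hc => ENNReal.rpow_le_rpow (lintegral_Ioo_mono hc le_rfl g) hκ.le)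
      (fun c _ t₁ t₂ ht => ENNReal.rpow_le_rpow (lintegral_Ioo_mono le_rfl ht g) hκ.le)
      (fun y t hy => ?_) fun c hc => le_trans ?_ (h c hc))
  · refine mul_le_mul_right ?_ _
    exact le_essSup_Ioo ht.1 le_rfl le_rfl fun _ _ => le_rfl
  · rw [← rpow_iSup₂ _ hκ]
    refine ENNReal.rpow_le_rpow (lintegral_Ioo_le_of_forall fun z hz => ?_) hκ.le
    obtain ⟨c, hc⟩ := exists_between (lt_min hz.1 hy)
    exact le_iSup₂_of_le c ⟨hc.1, hc.2.trans_le (min_le_right _ _)⟩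
      (lintegral_Ioo_mono (hc.2.trans_le (min_le_left _ _)).le le_rfl g)
  · refine lintegral_mono fun t => mul_le_mul_right ?_ _
    exact essSup_le_of_ae_le _ (Filter.Eventually.of_forall fun _ => le_rfl)

lemma exists_cesCesIneq {p q r : ℝ} (hr0 : 0 < r) (hr1 : r ≤ 1) (hq : 1 ≤ q) (hqp : q < p) :
    ∃ K : ℝ≥0∞, K ≠ ∞ ∧ ∀ {a b : ℝ} {u v w : ℝ → ℝ≥0∞}, a < b →
      IsWeight a b u → IsWeight a b v → IsWeight a b w →
      (∀ x ∈ Ioo a b, 0 < tail w b x ∧ tail w b x < ∞) → C₁ a b r p q u v w ≠ ∞ →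
      CesCesIneq a b r p q u v w
        (K * (C₁ a b r p q u v w + C₆ a b r p q u v w + C₇ a b r p q u v w)) := by
  have hq0 : 0 < q := by linarith
  obtain ⟨K, hK, hmain⟩ := exists_lintegral_Ioo_le hr0 hr1 hq hqp
  refine ⟨K ^ (1 / q), ENNReal.rpow_ne_top_of_nonneg (by positivity) hK, ?_⟩
  intro a b u v w hab hu hv hw hW hC f hf
  have h := lintegral_mul_rpow_le_of_forall hab hu.1 (κ := q / r) (by positivity)
    fun c hc => hmain hc hu hv hw hW hC hf
  simp_rw [mul_comm (u _), mul_comm (w _)] at h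
  refine (ENNReal.rpow_le_rpow h (z := 1 / q) (by positivity)).trans (le_of_eq ?_)
  rw [ENNReal.mul_rpow_of_nonneg _ _ (by positivity),
    ENNReal.mul_rpow_of_nonneg _ _ (by positivity),
    ← ENNReal.rpow_mul, ← ENNReal.rpow_mul, mul_one_div_cancel hq0.ne', ENNReal.rpow_one]
  congr 2
  field_simp

end Sufficiency

/-- case (vii) of the main theorem: for `0 < r ≤ 1 ≤ q < p < ∞`,
the inequality holds iff `C₁, C₆, C₇ < ∞`, and `C ≈ C₁ + C₆ + C₇`. -/
theorem main_case_vii (p q r : ℝ) (hr0 : 0 < r) (hr1 : r ≤ 1) (hq1 : 1 ≤ q) (hqp : q < p) :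
    ∃ κ₁ κ₂ : ℝ≥0∞, 0 < κ₁ ∧ κ₂ < ∞ ∧
    ∀ (a b : ℝ), a < b → ∀ u v w : ℝ → ℝ≥0∞,
      IsWeight a b u → IsWeight a b v → IsWeight a b w →
      (∀ x ∈ Set.Ioo a b,
        0 < (∫⁻ t in Set.Ioo x b, w t) ∧ (∫⁻ t in Set.Ioo x b, w t) < ∞) →
      (((∃ C : ℝ≥0∞, C < ∞ ∧ CesCesIneq a b r p q u v w C) ↔
          (C₁ a b r p q u v w < ∞ ∧ C₆ a b r p q u v w < ∞ ∧ C₇ a b r p q u v w < ∞)) ∧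
        κ₁ * (C₁ a b r p q u v w + C₆ a b r p q u v w + C₇ a b r p q u v w) ≤
          BestC a b r p q u v w ∧
        BestC a b r p q u v w ≤
          κ₂ * (C₁ a b r p q u v w + C₆ a b r p q u v w + C₇ a b r p q u v w)) := by
  have hp : 0 < p := by linarith
  have hq0 : 0 < q := by linarith
  obtain ⟨K₆, hK₆, h₆⟩ := CesCesIneq.exists_C₆_le hr0 hr1 hq1 hqp
  obtain ⟨K₇, hK₇, h₇⟩ := CesCesIneq.exists_C₇_le hr0 hr1 hq1 hqp
  obtain ⟨K, hK, hsuf⟩ := exists_cesCesIneq hr0 hr1 hq1 hqp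
  have hL0 : 1 + K₆ + K₇ ≠ 0 := by simp
  have hLt : 1 + K₆ + K₇ ≠ ∞ := by simp [hK₆, hK₇]
  refine ⟨(1 + K₆ + K₇)⁻¹, K + 1, ENNReal.inv_pos.2 hLt, by simp [hK.lt_top], ?_⟩
  intro a b hab u v w hu hv hw hW
  have hn₁ : ∀ {C}, CesCesIneq a b r p q u v w C → C₁ a b r p q u v w ≤ C := fun h =>
    h.C₁_le hr0 hr1 hq0 hp hu hv hW
  have hn₆ : ∀ {C}, CesCesIneq a b r p q u v w C → C ≠ ∞ → C₆ a b r p q u v w ≤ K₆ * C :=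
    fun h hC => h₆ hab h hC hu hv hw hW
  have hn₇ : ∀ {C}, CesCesIneq a b r p q u v w C → C ≠ ∞ → C₇ a b r p q u v w ≤ K₇ * C :=
    fun h hC => h₇ hab h hC hu hv hw hW
  refine ⟨⟨fun ⟨C, hC, h⟩ => ⟨(hn₁ h).trans_lt hC,
    (hn₆ h hC.ne).trans_lt (ENNReal.mul_lt_top hK₆.lt_top hC),
    (hn₇ h hC.ne).trans_lt (ENNReal.mul_lt_top hK₇.lt_top hC)⟩, fun ⟨hC₁, hC₆, hC₇⟩ =>
    ⟨_, ENNReal.mul_lt_top hK.lt_top (ENNReal.add_lt_top.2 ⟨ENNReal.add_lt_top.2 ⟨hC₁, hC₆⟩, hC₇⟩),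
      hsuf hab hu hv hw hW hC₁.ne⟩⟩, le_sInf fun C h => ?_, ?_⟩
  · rcases eq_or_ne C ∞ with rfl | hC
    · exact le_top
    refine (ENNReal.inv_mul_le_iff hL0 hLt).2 ?_
    rw [add_mul, add_mul, one_mul]
    exact add_le_add (add_le_add (hn₁ h) (hn₆ h hC)) (hn₇ h hC)
  · rcases eq_or_ne (C₁ a b r p q u v w) ∞ with hC | hC
    · rw [hC]; simp
    refine (sInf_le (hsuf hab hu hv hw hW hC)).trans ?_
    gcongr
    exact le_self_add
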